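/- Let τ be a strictly convex norm on ℝ² and M ∈ ℕ. There exists δ₁ > 0, depending only on M and τ, such that for every m > 0, every set E ⊆ ∂Q_m with |E| ≤ M, every partition E̲ of E, every F ∈ Ω^min_{E̲} each of whose connected components contains a point of E, and any two distinct connected components T₁ ≠ T₂ of F: for every a ∈ T₁ ∩ Q_{m/2} and every b ∈ T₂ ∩ Q_{m/2} one has τ(a − b) ≥ δ₁ m. -/

import Mathlib

open scoped ENNReal

/-- The plane `ℝ²`. -/
abbrev P2 : Type := ℝ × ℝ

/-- `τ : ℝ² → ℝ` is a norm. -/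
structure IsNorm (τ : P2 → ℝ) : Prop where
  eq_zero_iff : ∀ x : P2, τ x = 0 ↔ x = 0
  smul_eq : ∀ (c : ℝ) (x : P2), τ (c • x) = |c| * τ x
  add_le : ∀ x y : P2, τ (x + y) ≤ τ x + τ y

/-- `τ` is a strictly convex norm: `τ(x+y) < τ(x)+τ(y)` whenever `x` and `y` are not
nonnegative multiples of one another. -/
def IsStrictlyConvexNorm (τ : P2 → ℝ) : Prop :=
  IsNorm τ ∧ ∀ x y : P2, ¬ (∃ c : ℝ, 0 ≤ c ∧ (x = c • y ∨ y = c • x)) →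
    τ (x + y) < τ x + τ y

/-- The `τ`-diameter of a set (in `ℝ≥0∞`). -/
noncomputable def tauDiam (τ : P2 → ℝ) (A : Set P2) : ℝ≥0∞ :=
  ⨆ x ∈ A, ⨆ y ∈ A, ENNReal.ofReal (τ (x - y))

/-- The one-dimensional Hausdorff measure of `S` computed in the metric
`(x,y) ↦ τ(x−y)`: `lim_{ε→0} inf {Σ diam_τ(Aᵢ) : S ⊆ ⋃ Aᵢ, diam_τ(Aᵢ) ≤ ε}`. -/
noncomputable def tauLen (τ : P2 → ℝ) (S : Set P2) : ℝ≥0∞ :=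
  ⨆ (ε : ℝ) (_ : 0 < ε),
    ⨅ (A : ℕ → Set P2) (_ : S ⊆ ⋃ i, A i)
      (_ : ∀ i, tauDiam τ (A i) ≤ ENNReal.ofReal ε),
      ∑' i, tauDiam τ (A i)

/-- `Ep` (a family `E₁,…,E_r`) is a partition of `E`: nonempty, pairwise disjoint pieces
whose union is `E`. -/
def IsPartitionOf {r : ℕ} (Ep : Fin r → Set P2) (E : Set P2) : Prop :=
  (∀ j, (Ep j).Nonempty) ∧ (∀ j k, j ≠ k → Disjoint (Ep j) (Ep k)) ∧ (⋃ j, Ep j) = E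

/-- `Ω_{E̲}`: compact sets `S` such that each `E_j` is contained in a single connected
component of `S`. -/
def OmegaSet {r : ℕ} (Ep : Fin r → Set P2) : Set (Set P2) :=
  {S | IsCompact S ∧ ∀ j, ∃ x ∈ S, Ep j ⊆ connectedComponentIn S x}

/-- `τ_{E̲} = inf {τ(S) : S ∈ Ω_{E̲}}`. -/
noncomputable def tauMin (τ : P2 → ℝ) {r : ℕ} (Ep : Fin r → Set P2) : ℝ≥0∞ :=
  ⨅ S ∈ OmegaSet Ep, tauLen τ S

/-- `Ω^min_{E̲}`: the Steiner forests of `E̲`. -/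
def OmegaMinSet (τ : P2 → ℝ) {r : ℕ} (Ep : Fin r → Set P2) : Set (Set P2) :=
  {S ∈ OmegaSet Ep | tauLen τ S = tauMin τ Ep}

/-- The box `Q_m = [−m,m]² ⊂ ℝ²`. -/
def Qbox (m : ℝ) : Set P2 := Set.Icc (-m) m ×ˢ Set.Icc (-m) m

/-- `Ω^min_{M,m}`: all Steiner forests `F ∈ Ω^min_{E̲}`, over `E ⊆ ∂Q_m` with `|E| ≤ M` and
partitions `E̲` of `E`, each of whose connected components contains a point of `E`. -/
def OmegaMinMm (τ : P2 → ℝ) (M : ℕ) (m : ℝ) : Set (Set P2) :=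
  {F | ∃ (E : Set P2) (r : ℕ) (Ep : Fin r → Set P2),
    E ⊆ frontier (Qbox m) ∧ E.Finite ∧ E.ncard ≤ M ∧ IsPartitionOf Ep E ∧
    F ∈ OmegaMinSet τ Ep ∧ ∀ x ∈ F, (connectedComponentIn F x ∩ E).Nonempty}

/-- The `τ`-Hausdorff "distance" `d_τ(A,B) = sup_{a∈A} inf_{b∈B} τ(a−b)` (in `ℝ≥0∞`). -/
noncomputable def dTau (τ : P2 → ℝ) (A B : Set P2) : ℝ≥0∞ :=
  ⨆ a ∈ A, ⨅ b ∈ B, ENNReal.ofReal (τ (a - b))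

section Helpers

set_option linter.unusedSectionVars false
set_option linter.style.haveILetI false
set_option linter.unusedSimpArgs false

open Set Filter Topology MeasureTheory
open scoped ENNReal NNReal unitInterval

section Graphs

variable {V : Type} [NormedAddCommGroup V] [NormedSpace ℝ V]

open Classical in
/-- twice the length of a network -/
noncomputable def glen2 {ι : Type} [Fintype ι] (G : SimpleGraph ι) (q : ι → V) : ℝ :=
  ∑ i, ∑ j, if G.Adj i j then dist (q i) (q j) else 0

/-- network data -/
def NetData {M : ℕ} (e : Fin M → V) (A : Set V) (C : ℝ) (ι : Type) [Fintype ι] : Prop :=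
  ∃ G : SimpleGraph ι, ∃ q : ι → V, G.Connected ∧ (∀ m, ∃ i, q i = e m) ∧ glen2 G q ≤ C ∧
    ∀ a ∈ A, ∃ i j, (G.Adj i j ∨ i = j) ∧
      dist (q i) a + dist a (q j) + glen2 G q ≤ dist (q i) (q j) + C

/-- adding a leaf -/
def addLeafG {ι : Type} (G : SimpleGraph ι) (i : ι) : SimpleGraph (Option ι) where
  Adj a b := match a, b with
    | none, none => False
    | none, some b => b = i
    | some a, none => a = i
    | some a, some b => G.Adj a b
  symm := ⟨by
    intro a b h
    cases a <;> cases b <;> simp_all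
    exact h.symm⟩
  loopless := ⟨by
    intro a h
    cases a <;> simp_all⟩

lemma addLeafG_connected {ι : Type} {G : SimpleGraph ι} (hG : G.Connected) (i : ι) :
    (addLeafG G i).Connected := by
  let f : G →g addLeafG G i := ⟨some, fun {a b} h => h⟩
  have h1 : ∀ a : Option ι, (addLeafG G i).Reachable (some i) a := by
    intro a
    cases a with
    | none => exact SimpleGraph.Adj.reachable (show (addLeafG G i).Adj (some i) none from rfl)
    | some a => exact (hG.preconnected i a).map f
  haveI : Nonempty (Option ι) := ⟨none⟩
  exact ⟨fun a b => (h1 a).symm.trans (h1 b)⟩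

lemma addLeafG_glen2 {ι : Type} [Fintype ι] (G : SimpleGraph ι) (q : ι → V) (i : ι) (w : V) :
    glen2 (addLeafG G i) (fun o => o.elim w q) = glen2 G q + 2 * dist w (q i) := by
  classical
  unfold glen2
  simp only [Fintype.sum_option, Option.elim]
  have h1 : ∀ b, (addLeafG G i).Adj none (some b) ↔ b = i := fun b => Iff.rfl
  have h2 : ∀ b, (addLeafG G i).Adj (some b) none ↔ b = i := fun b => Iff.rfl
  have h3 : ∀ a b, (addLeafG G i).Adj (some a) (some b) ↔ G.Adj a b := fun a b => Iff.rfl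
  have h4 : ¬ (addLeafG G i).Adj none none := fun h => h
  simp only [h1, h2, h3, h4, Finset.sum_add_distrib, if_false]
  simp only [Finset.sum_ite_eq', Finset.mem_univ, if_true]
  rw [dist_comm (q i) w]
  ring

lemma NetData.pad {M : ℕ} {e : Fin M → V} {A : Set V} {C : ℝ} {ι : Type} [Fintype ι]
    (h : NetData e A C ι) : NetData e A C (Option ι) := by
  obtain ⟨G, q, hG, he, hl, hA⟩ := h
  obtain ⟨i0⟩ := hG.nonempty
  have hlen : glen2 (addLeafG G i0) (fun o => o.elim (q i0) q) = glen2 G q := by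
    rw [addLeafG_glen2]; simp
  refine ⟨addLeafG G i0, fun o => o.elim (q i0) q, addLeafG_connected hG i0, ?_, ?_, ?_⟩
  · intro m
    obtain ⟨i, hi⟩ := he m
    exact ⟨some i, hi⟩
  · rw [hlen]; exact hl
  · intro a ha
    obtain ⟨i, j, hij, h⟩ := hA a ha
    refine ⟨some i, some j, ?_, ?_⟩
    · rcases hij with h | h
      · left; exact h
      · right; rw [h]
    · rw [hlen]; exact h

lemma glen2_iso {ι κ : Type} [Fintype ι] [Fintype κ] (f : ι ≃ κ) (G : SimpleGraph ι) (q : ι → V) :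
    glen2 (G.map f.toEmbedding) (fun k => q (f.symm k)) = glen2 G q := by
  classical
  unfold glen2
  rw [← f.sum_comp]
  refine Finset.sum_congr rfl fun i _ => ?_
  rw [← f.sum_comp]
  refine Finset.sum_congr rfl fun j _ => ?_
  have : (G.map f.toEmbedding).Adj (f i) (f j) ↔ G.Adj i j :=
    SimpleGraph.map_adj_apply (f := f.toEmbedding)
  simp only [Equiv.symm_apply_apply]
  exact if_congr this rfl rfl

lemma NetData.equiv {M : ℕ} {e : Fin M → V} {A : Set V} {C : ℝ} {ι κ : Type} [Fintype ι] [Fintype κ]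
    (f : ι ≃ κ) (h : NetData e A C ι) : NetData e A C κ := by
  obtain ⟨G, q, hG, he, hl, hA⟩ := h
  refine ⟨G.map f.toEmbedding, fun k => q (f.symm k), ?_, ?_, ?_, ?_⟩
  · exact (SimpleGraph.Iso.map f G).connected_iff.1 hG
  · intro m
    obtain ⟨i, hi⟩ := he m
    exact ⟨f i, by simpa using hi⟩
  · rw [glen2_iso]; exact hl
  · intro a ha
    obtain ⟨i, j, hij, h⟩ := hA a ha
    refine ⟨f i, f j, ?_, ?_⟩
    · rcases hij with h | h
      · left; exact (SimpleGraph.map_adj_apply (f := f.toEmbedding)).2 h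
      · right; rw [h]
    · rw [glen2_iso]; simpa using h

lemma glen2_nonneg {ι : Type} [Fintype ι] (G : SimpleGraph ι) (q : ι → V) : 0 ≤ glen2 G q := by
  classical
  unfold glen2
  refine Finset.sum_nonneg fun i _ => Finset.sum_nonneg fun j _ => ?_
  split_ifs <;> positivity

lemma glen2_mono {ι : Type} [Fintype ι] {G H : SimpleGraph ι} (h : H ≤ G) (q : ι → V) :
    glen2 H q ≤ glen2 G q := by
  classical
  unfold glen2
  refine Finset.sum_le_sum fun i _ => Finset.sum_le_sum fun j _ => ?_
  by_cases h1 : H.Adj i j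
  · simp [h1, h h1]
  · simp only [h1, if_false]; split_ifs <;> positivity

lemma glen2_mono_strict {ι : Type} [Fintype ι] {G H : SimpleGraph ι} (h : H ≤ G) (q : ι → V)
    {i j : ι} (hg : G.Adj i j) (hh : ¬ H.Adj i j) :
    glen2 H q + 2 * dist (q i) (q j) ≤ glen2 G q := by
  classical
  have key : ∀ a b, (if H.Adj a b then dist (q a) (q b) else 0) +
      (if a = i ∧ b = j then dist (q i) (q j) else 0) + (if a = j ∧ b = i then dist (q i) (q j) else 0)
      ≤ if G.Adj a b then dist (q a) (q b) else 0 := by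
    intro a b
    have hne := hg.ne
    by_cases h1 : a = i ∧ b = j
    · obtain ⟨rfl, rfl⟩ := h1
      simp [hg, hh, hne]
    · by_cases h2 : a = j ∧ b = i
      · obtain ⟨rfl, rfl⟩ := h2
        have hh' : ¬ H.Adj a b := fun hx => hh hx.symm
        simp [hg.symm, hh', hne, dist_comm, hne.symm]
      · simp only [h1, h2, if_false, add_zero]
        by_cases h3 : H.Adj a b
        · simp [h3, h h3]
        · simp only [h3, if_false]; split_ifs <;> positivity
  have := Finset.sum_le_sum (s := Finset.univ) fun a _ =>
    Finset.sum_le_sum (s := Finset.univ) fun b _ => key a b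
  simp only [Finset.sum_add_distrib] at this
  have e1 : ∀ x y : ι, (∑ a, ∑ b, if a = x ∧ b = y then dist (q i) (q j) else 0) = dist (q i) (q j) := by
    intro x y
    simp [ite_and]
  rw [e1, e1] at this
  unfold glen2
  linarith

/-- remove vertex `v`, turn its neighbours into a clique -/
def elimG {ι : Type} (H : SimpleGraph ι) (v : ι) : SimpleGraph {w // w ≠ v} where
  Adj a b := a ≠ b ∧ (H.Adj a b ∨ (H.Adj v a ∧ H.Adj v b))
  symm := ⟨by
    rintro a b ⟨h1, h2⟩
    exact ⟨h1.symm, h2.imp (fun h => h.symm) (fun h => ⟨h.2, h.1⟩)⟩⟩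
  loopless := ⟨fun a h => h.1 rfl⟩

lemma elimG_connected {ι : Type} {H : SimpleGraph ι} (hH : H.Connected) (v p : ι)
    (hp : H.Adj v p) : (elimG H v).Connected := by
  classical
  let f : ι → {w // w ≠ v} := fun w => if h : w = v then ⟨p, hp.ne'⟩ else ⟨w, h⟩
  have hadj : ∀ a b, H.Adj a b → (elimG H v).Reachable (f a) (f b) := by
    intro a b hab
    by_cases hf : f a = f b
    · rw [hf]
    apply SimpleGraph.Adj.reachable
    refine ⟨hf, ?_⟩
    by_cases ha : a = v
    · subst ha
      have hb : b ≠ a := hab.ne'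
      right
      simp [f, hb, hp, hab]
    · by_cases hb : b = v
      · subst hb
        right
        simp [f, ha, hp, hab.symm]
      · left
        simpa [f, ha, hb] using hab
  have hr : ∀ a b, H.Reachable a b → (elimG H v).Reachable (f a) (f b) := by
    rintro a b ⟨w⟩
    induction w with
    | nil => exact SimpleGraph.Reachable.refl _
    | cons h _ ih => exact (hadj _ _ h).trans ih
  haveI : Nonempty {w // w ≠ v} := ⟨⟨p, hp.ne'⟩⟩
  refine ⟨fun a b => ?_⟩
  have := hr a b (hH.preconnected a b)
  simpa [f, a.2, b.2] using this

lemma sum_ne_eq {ι : Type} [Fintype ι] [DecidableEq ι] (v : ι) (f : ι → ℝ) :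
    ∑ a : {w // w ≠ v}, f a = ∑ a, if a = v then 0 else f a := by
  have h2 : ∑ a : {w // w ≠ v}, f a = ∑ a ∈ Finset.univ.filter (· ≠ v), f a := by
    exact (Finset.sum_subtype (Finset.univ.filter (· ≠ v)) (by simp) f).symm
  rw [h2, Finset.sum_filter]
  refine Finset.sum_congr rfl fun a _ => ?_
  by_cases h : a = v <;> simp [h]

lemma elimG_glen2 {ι : Type} [Fintype ι] [DecidableEq ι] (H : SimpleGraph ι) (q : ι → V)
    (v p r : ι) (hpr : ∀ w, H.Adj v w ↔ w = p ∨ w = r) :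
    glen2 (elimG H v) (fun w => q w) + (dist (q v) (q p) + dist (q v) (q r) - dist (q p) (q r))
      ≤ glen2 H q := by
  classical
  have hvp : v ≠ p := ((hpr p).2 (Or.inl rfl)).ne
  have hvr : v ≠ r := ((hpr r).2 (Or.inr rfl)).ne
  set D : ℝ := if p = r then 0 else dist (q p) (q r) with hD
  set D' : ℝ := if p = r then 0 else dist (q v) (q r) with hD'
  -- pointwise comparison on ι
  let g : ι → ι → ℝ := fun a b => if a = v ∨ b = v then 0 else
    if a ≠ b ∧ (H.Adj a b ∨ (H.Adj v a ∧ H.Adj v b)) then dist (q a) (q b) else 0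
  have hg : glen2 (elimG H v) (fun w => q w) = ∑ a, ∑ b, g a b := by
    unfold glen2
    have : ∀ a : {w // w ≠ v}, (∑ b : {w // w ≠ v}, if (elimG H v).Adj a b then dist (q a) (q b) else 0)
        = ∑ b, g a b := by
      intro a
      have h0 : ∀ b : {w // w ≠ v}, (if (elimG H v).Adj a b then dist (q a) (q b) else 0) =
          (fun b : ι => if ((a:ι) ≠ b ∧ (H.Adj a b ∨ (H.Adj v a ∧ H.Adj v b))) then dist (q a) (q b) else 0) b := by
        intro b
        have : (elimG H v).Adj a b ↔ ((a:ι) ≠ b ∧ (H.Adj a b ∨ (H.Adj v a ∧ H.Adj v b))) := by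
          simp [elimG, Subtype.ext_iff]
        simp [this]
      rw [Finset.sum_congr rfl fun b _ => h0 b, sum_ne_eq v (fun b : ι => if ((a:ι) ≠ b ∧ (H.Adj a b ∨ (H.Adj v a ∧ H.Adj v b))) then dist (q a) (q b) else 0)]
      refine Finset.sum_congr rfl fun b _ => ?_
      simp only [g, a.2, false_or]
    rw [Finset.sum_congr rfl fun a _ => this a]
    rw [sum_ne_eq v (fun a => ∑ b, g a b)]
    refine Finset.sum_congr rfl fun a _ => ?_
    by_cases h : a = v
    · simp [h, g]
    · simp [h]
  have key : ∀ a b, g a b + (if a = v ∧ b = p then dist (q v) (q p) else 0)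
      + (if a = v ∧ b = r then D' else 0)
      + (if a = p ∧ b = v then dist (q v) (q p) else 0)
      + (if a = r ∧ b = v then D' else 0)
      ≤ (if H.Adj a b then dist (q a) (q b) else 0)
      + (if a = p ∧ b = r then D else 0) + (if a = r ∧ b = p then D else 0) := by
    intro a b
    have hD0 : 0 ≤ D := by rw [hD]; split_ifs <;> positivity
    by_cases ha : a = v
    · subst ha
      have hbv : ∀ b, H.Adj a b → b ≠ a := fun b h => h.ne'
      simp only [g, true_or, if_true, hvp, hvr, false_and, if_false, true_and, zero_add, add_zero]
      by_cases hbp : b = p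
      · subst hbp
        have hadj : H.Adj a b := (hpr b).2 (Or.inl rfl)
        by_cases hbr : b = r
        · subst hbr; simp [hadj, D']
        · simp [hadj, hbr]
      · by_cases hbr : b = r
        · subst hbr
          have hadj : H.Adj a b := (hpr b).2 (Or.inr rfl)
          simp [hadj, hbp, D', Ne.symm hbp]
        · have hadj : ¬ H.Adj a b := by rw [hpr]; tauto
          simp [hadj, hbp, hbr]
    · by_cases hb : b = v
      · subst hb
        simp only [g, or_true, if_true, hvp, hvr, and_false, if_false, and_true, zero_add, add_zero,
          ha, false_and]
        by_cases hbp : a = p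
        · subst hbp
          have hadj : H.Adj a b := ((hpr a).2 (Or.inl rfl)).symm
          by_cases hbr : a = r
          · subst hbr; simp [hadj, D', dist_comm]
          · simp [hadj, hbr, dist_comm]
        · by_cases hbr : a = r
          · subst hbr
            have hadj : H.Adj a b := ((hpr a).2 (Or.inr rfl)).symm
            simp [hadj, hbp, D', Ne.symm hbp, dist_comm]
          · have hadj : ¬ H.Adj a b := by rw [SimpleGraph.adj_comm, hpr]; tauto
            simp [hadj, hbp, hbr]
      · simp only [g, ha, hb, false_or, if_false, false_and, and_false, add_zero]
        by_cases hab : H.Adj a b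
        · have : a ≠ b := hab.ne
          simp only [hab, this, ne_eq, not_false_eq_true, true_or, and_self, if_true]
          split_ifs <;> linarith
        · by_cases hc : a ≠ b ∧ (H.Adj v a ∧ H.Adj v b)
          · obtain ⟨hne, h1, h2⟩ := hc
            rw [hpr] at h1 h2
            have : (a = p ∧ b = r) ∨ (a = r ∧ b = p) := by
              rcases h1 with h1 | h1 <;> rcases h2 with h2 | h2
              · exact absurd (h1.trans h2.symm) hne
              · exact Or.inl ⟨h1, h2⟩
              · exact Or.inr ⟨h1, h2⟩
              · exact absurd (h1.trans h2.symm) hne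
            rcases this with ⟨rfl, rfl⟩ | ⟨rfl, rfl⟩
            · simp [hab, hne, D, (hpr a).2 (Or.inl rfl), (hpr b).2 (Or.inr rfl)]
            · simp [hab, hne, D, (hpr a).2 (Or.inr rfl), (hpr b).2 (Or.inl rfl), dist_comm, hne.symm]
          · have hc' : ¬ (a ≠ b ∧ (H.Adj a b ∨ (H.Adj v a ∧ H.Adj v b))) := by tauto
            rw [if_neg hc', if_neg hab]
            split_ifs <;> linarith
  have := Finset.sum_le_sum (s := Finset.univ) fun a _ =>
    Finset.sum_le_sum (s := Finset.univ) fun b _ => key a b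
  simp only [Finset.sum_add_distrib] at this
  have e1 : ∀ (x y : ι) (t : ℝ), (∑ a, ∑ b, if a = x ∧ b = y then t else 0) = t := by
    intro x y t
    simp [ite_and]
  simp only [e1] at this
  rw [← hg] at this
  have h5 : glen2 H q = ∑ a, ∑ b, if H.Adj a b then dist (q a) (q b) else 0 := rfl
  rw [← h5] at this
  have tri : dist (q p) (q r) ≤ dist (q v) (q p) + dist (q v) (q r) := by
    rw [dist_comm (q v) (q p)]; exact dist_triangle _ _ _
  by_cases hpr' : p = r
  · subst hpr'
    simp [D, D'] at this
    simp
    linarith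
  · simp [D, D', hpr'] at this
    linarith

lemma exists_low_degree {ι : Type} [Fintype ι] {H : SimpleGraph ι} (hH : H.IsTree)
    (t : Finset ι) (hcard : 2 * t.card < Fintype.card ι) (h2 : 2 ≤ Fintype.card ι) :
    ∃ v ∉ t, ∃ p r, ∀ w, H.Adj v w ↔ w = p ∨ w = r := by
  classical
  haveI : Nontrivial ι := Fintype.one_lt_card_iff_nontrivial.1 h2
  have hpos : ∀ v, 1 ≤ H.degree v := fun v => hH.1.preconnected.degree_pos_of_nontrivial v
  have : ∃ v ∉ t, H.degree v ≤ 2 := by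
    by_contra hcon
    push Not at hcon
    have hsum := H.sum_degrees_eq_twice_card_edges
    have hedge := hH.card_edgeFinset
    have h3 : ∑ v, (if v ∈ t then 1 else 3) ≤ ∑ v, H.degree v := by
      refine Finset.sum_le_sum fun v _ => ?_
      split_ifs with hv
      · exact hpos v
      · exact hcon v hv
    have h4 : ∑ v, (if v ∈ t then 1 else 3) + 2 * t.card = 3 * Fintype.card ι := by
      have : ∀ v : ι, (if v ∈ t then 1 else 3) + (if v ∈ t then 2 else 0) = 3 := by
        intro v; split_ifs <;> rfl
      have h5 := Finset.sum_congr (rfl : (Finset.univ : Finset ι) = Finset.univ) fun v _ => this v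
      rw [Finset.sum_add_distrib] at h5
      simp only [Finset.sum_const, Finset.card_univ, smul_eq_mul] at h5
      rw [Finset.sum_ite_mem, Finset.univ_inter, Finset.sum_const, smul_eq_mul] at h5
      linarith
    omega
  obtain ⟨v, hv, hd⟩ := this
  refine ⟨v, hv, ?_⟩
  have hmem : ∀ w, H.Adj v w ↔ w ∈ H.neighborFinset v := by simp
  have h1 := hpos v
  rw [← SimpleGraph.card_neighborFinset_eq_degree] at hd h1
  rcases (show (H.neighborFinset v).card = 1 ∨ (H.neighborFinset v).card = 2 by omega) with h | h
  · obtain ⟨p, hp⟩ := Finset.card_eq_one.1 h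
    exact ⟨p, p, fun w => by rw [hmem, hp]; simp⟩
  · obtain ⟨p, r, -, hp⟩ := Finset.card_eq_two.1 h
    exact ⟨p, r, fun w => by rw [hmem, hp]; simp⟩

lemma NetData.reduce {M : ℕ} (hM : 1 ≤ M) {e : Fin M → V} {A : Set V} {C : ℝ} {ι : Type} [Fintype ι]
    [DecidableEq ι]
    (h : NetData e A C ι) (hcard : 2 * M < Fintype.card ι) :
    ∃ v : ι, NetData e A C {w // w ≠ v} := by
  classical
  obtain ⟨G, q, hG, he, hl, hA⟩ := h
  obtain ⟨H, hHG, hH⟩ := hG.exists_isTree_le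
  choose idx hidx using he
  have hlH : glen2 H q ≤ glen2 G q := glen2_mono hHG q
  have hAH : ∀ a ∈ A, ∃ i j, (H.Adj i j ∨ i = j) ∧
      dist (q i) a + dist a (q j) + glen2 H q ≤ dist (q i) (q j) + C := by
    intro a ha
    obtain ⟨i, j, hij, hs⟩ := hA a ha
    rcases hij with hij | rfl
    · by_cases hh : H.Adj i j
      · exact ⟨i, j, Or.inl hh, by linarith⟩
      · refine ⟨i, i, Or.inr rfl, ?_⟩
        have h1 := glen2_mono_strict hHG q hij hh
        have h2 := dist_triangle (q i) (q j) a
        rw [dist_comm (q j) a] at h2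
        rw [dist_self, dist_comm a (q i)]
        linarith
    · exact ⟨i, i, Or.inr rfl, by linarith⟩
  have hc : (Finset.univ.image idx).card ≤ M := by
    simpa using Finset.card_image_le (s := Finset.univ) (f := idx)
  obtain ⟨v, hv, p, r, hpr⟩ := exists_low_degree hH (Finset.univ.image idx) (by omega) (by omega)
  have hvp : p ≠ v := ((hpr p).2 (Or.inl rfl)).ne'
  have hvr : r ≠ v := ((hpr r).2 (Or.inr rfl)).ne'
  have hlen := elimG_glen2 H q v p r hpr
  have tri : dist (q p) (q r) ≤ dist (q v) (q p) + dist (q v) (q r) := by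
    rw [dist_comm (q v) (q p)]; exact dist_triangle _ _ _
  have hprA : (elimG H v).Adj ⟨p, hvp⟩ ⟨r, hvr⟩ ∨ (⟨p, hvp⟩ : {w // w ≠ v}) = ⟨r, hvr⟩ := by
    by_cases hh : p = r
    · right; simp [hh]
    · left
      exact ⟨by simpa using hh, Or.inr ⟨(hpr p).2 (Or.inl rfl), (hpr r).2 (Or.inr rfl)⟩⟩
  refine ⟨v, elimG H v, fun w => q w, elimG_connected hH.1 v p ((hpr p).2 (Or.inl rfl)), ?_, by linarith, ?_⟩
  · intro m
    refine ⟨⟨idx m, ?_⟩, hidx m⟩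
    intro hm
    apply hv
    rw [← hm]; simp
  · intro a ha
    obtain ⟨i, j, hij, hs⟩ := hAH a ha
    by_cases hiv : i = v
    · subst hiv
      refine ⟨⟨p, hvp⟩, ⟨r, hvr⟩, hprA, ?_⟩
      simp only
      have t1 := dist_triangle (q p) (q i) a
      have t2 := dist_triangle a (q i) (q r)
      rw [dist_comm (q p) (q i)] at t1
      rcases hij with hij | rfl
      · rcases (hpr j).1 hij with rfl | rfl
        · rw [dist_comm (q j) a]
          rw [dist_comm a (q i)] at t2
          linarith
        · linarith
      · rw [dist_self] at hs
        have := dist_comm a (q i)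
        linarith
    · by_cases hjv : j = v
      · subst hjv
        refine ⟨⟨p, hvp⟩, ⟨r, hvr⟩, hprA, ?_⟩
        simp only
        have t1 := dist_triangle (q p) (q j) a
        have t2 := dist_triangle a (q j) (q r)
        rw [dist_comm (q p) (q j)] at t1
        rcases hij with hij | rfl
        · rw [dist_comm (q j) a] at t1
          rcases (hpr i).1 hij.symm with rfl | rfl
          · rw [dist_comm (q i) (q j)] at hs
            linarith
          · rw [dist_comm (q i) (q j), dist_comm (q i) a] at hs
            linarith
        · exact absurd rfl hiv
      · refine ⟨⟨i, hiv⟩, ⟨j, hjv⟩, ?_, ?_⟩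
        · by_cases hh : i = j
          · right; simp [hh]
          · left
            refine ⟨by simpa using hh, Or.inl ?_⟩
            rcases hij with hij | hij
            · exact hij
            · exact absurd hij hh
        · simp only
          linarith

lemma NetData.toFin {M : ℕ} (hM : 1 ≤ M) {e : Fin M → V} {A : Set V} {C : ℝ} {ι : Type} [Fintype ι]
    (h : NetData e A C ι) : NetData e A C (Fin (2 * M)) := by
  classical
  -- first reduce
  have hred : ∀ n : ℕ, ∀ (ι : Type) (_ : Fintype ι), Fintype.card ι = n → NetData e A C ι →
      ∃ (κ : Type) (_ : Fintype κ), Fintype.card κ ≤ 2 * M ∧ NetData e A C κ := by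
    intro n
    induction n with
    | zero => 
      intro ι _ hc h
      exact ⟨ι, inferInstance, by omega, h⟩
    | succ n ih =>
      intro ι _ hc h
      by_cases hcard : Fintype.card ι ≤ 2 * M
      · exact ⟨ι, inferInstance, hcard, h⟩
      · obtain ⟨v, hv⟩ := h.reduce hM (by omega)
        refine ih {w // w ≠ v} inferInstance ?_ hv
        have := Fintype.card_subtype_compl (fun w => w = v)
        simp only [Fintype.card_subtype_eq] at this
        simp only [ne_eq]
        omega
  obtain ⟨κ, _, hκ, hN⟩ := hred _ ι inferInstance rfl h
  have hpad : ∀ n : ℕ, ∀ (ι : Type) (_ : Fintype ι), Fintype.card ι + n = 2 * M → NetData e A C ι →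
      ∃ (κ : Type) (_ : Fintype κ), Fintype.card κ = 2 * M ∧ NetData e A C κ := by
    intro n
    induction n with
    | zero => intro ι _ hc h; exact ⟨ι, inferInstance, by omega, h⟩
    | succ n ih =>
      intro ι _ hc h
      exact ih (Option ι) inferInstance (by rw [Fintype.card_option]; omega) h.pad
  obtain ⟨κ', _, hκ', hN'⟩ := hpad (2 * M - Fintype.card κ) κ inferInstance (by omega) hN
  exact hN'.equiv (Fintype.equivFinOfCardEq hκ')

end Graphs

/-- lifting lemma: a continuous nonvanishing function on the square has a continuous argument -/
lemma exists_arg_lift (g : I × I → ℂ) (hg : Continuous g) (h0 : ∀ p, g p ≠ 0) :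
    ∃ θ : I × I → ℝ, Continuous θ ∧ ∀ p, (0 < Real.cos (θ p) ↔ 0 < (g p).re) ∧
      (Real.cos (θ p) < 0 ↔ (g p).re < 0) ∧ (0 < Real.sin (θ p) ↔ 0 < (g p).im) ∧
      (Real.sin (θ p) < 0 ↔ (g p).im < 0) := by
  let pr : ℝ × ℝ → I × I := fun p => (projIcc 0 1 zero_le_one p.1, projIcc 0 1 zero_le_one p.2)
  have hpr : Continuous pr := by
    have := continuous_projIcc (a := (0:ℝ)) (b := 1) (h := zero_le_one)
    fun_prop
  let f : C(ℝ × ℝ, {z : ℂ // z ≠ 0}) := ⟨fun p => ⟨g (pr p), h0 _⟩, by fun_prop⟩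
  obtain ⟨F', ⟨_, hF⟩, _⟩ := Complex.isCoveringMap_exp.existsUnique_continuousMap_lifts f (0, 0)
    (Complex.log (g (pr (0,0)))) (by
      apply Subtype.ext
      simp [f, Complex.exp_log (h0 _)])
  let F : I × I → ℂ := fun p => F' ((p.1 : ℝ), (p.2 : ℝ))
  have hFc : Continuous F := by fun_prop
  have hF' : ∀ p, Complex.exp (F p) = g p := fun p => by
    have := congrArg Subtype.val (congrFun hF ((p.1 : ℝ), (p.2 : ℝ)))
    simpa [f, pr, F] using this
  refine ⟨fun p => (F p).im, by fun_prop, fun p => ?_⟩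
  have hre : (g p).re = Real.exp (F p).re * Real.cos (F p).im := by rw [← hF' p, Complex.exp_re]
  have him : (g p).im = Real.exp (F p).re * Real.sin (F p).im := by rw [← hF' p, Complex.exp_im]
  have he := Real.exp_pos (F p).re
  rw [hre, him]
  refine ⟨?_, ?_, ?_, ?_⟩
  · rw [mul_pos_iff_of_pos_left he]
  · constructor
    · intro h; exact mul_neg_of_pos_of_neg he h
    · intro h; by_contra hc; push Not at hc; nlinarith [mul_nonneg he.le hc]
  · rw [mul_pos_iff_of_pos_left he]
  · constructor
    · intro h; exact mul_neg_of_pos_of_neg he h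
    · intro h; by_contra hc; push Not at hc; nlinarith [mul_nonneg he.le hc]

/-- a continuous function on `I` avoiding two values stays between them -/
lemma stay_between (f : I → ℝ) (hf : Continuous f) (a b : ℝ) (ha : ∀ t, f t ≠ a)
    (hb : ∀ t, f t ≠ b) (t₀ : I) (h0 : f t₀ ∈ Ioo a b) (t : I) : f t ∈ Ioo a b := by
  have hpc : IsPreconnected (range f) := isPreconnected_range hf
  have hoc := hpc.ordConnected
  constructor
  · by_contra h
    push Not at h
    obtain ⟨s, hs⟩ := hoc.out (mem_range_self t) (mem_range_self t₀) ⟨h, h0.1.le⟩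
    exact ha s hs
  · by_contra h
    push Not at h
    obtain ⟨s, hs⟩ := hoc.out (mem_range_self t₀) (mem_range_self t) ⟨h0.2.le, h⟩
    exact hb s hs

lemma square_no_zero (g : I × I → ℂ) (hg : Continuous g) (h0 : ∀ p, g p ≠ 0)
    (hl : ∀ t, (g (0, t)).re < 0) (hr : ∀ t, 0 < (g (1, t)).re)
    (hb : ∀ s, 0 < (g (s, 0)).im) (ht : ∀ s, (g (s, 1)).im < 0) : False := by
  obtain ⟨θ', hθ', hs'⟩ := exists_arg_lift g hg h0
  -- normalise
  obtain ⟨k, hk⟩ : ∃ k : ℤ, θ' (0,0) + k * (2 * Real.pi) ∈ Ioc (-Real.pi) Real.pi := by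
    have h2 : (0:ℝ) < 2 * Real.pi := by positivity
    refine ⟨-toIocDiv h2 (-Real.pi) (θ' (0,0)), ?_⟩
    have := sub_toIocDiv_zsmul_mem_Ioc h2 (-Real.pi) (θ' (0,0))
    rw [zsmul_eq_mul] at this
    push_cast
    convert this using 1
    · ring_nf
    · ring_nf
  set θ : I × I → ℝ := fun p => θ' p + k * (2 * Real.pi) with hθdef
  have hθ : Continuous θ := by fun_prop
  have hs : ∀ p, (0 < Real.cos (θ p) ↔ 0 < (g p).re) ∧
      (Real.cos (θ p) < 0 ↔ (g p).re < 0) ∧ (0 < Real.sin (θ p) ↔ 0 < (g p).im) ∧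
      (Real.sin (θ p) < 0 ↔ (g p).im < 0) := by
    intro p
    simp only [hθdef, Real.cos_add_int_mul_two_pi, Real.sin_add_int_mul_two_pi]
    exact hs' p
  have hpi := Real.pi_pos
  -- corner (0,0)
  have c00 : θ (0,0) ∈ Ioo (Real.pi/2) Real.pi := by
    have hsin := (hs (0,0)).2.2.1.2 (hb 0)
    have hcos := (hs (0,0)).2.1.2 (hl 0)
    have h1 : 0 < θ (0,0) := by
      by_contra h
      push Not at h
      have := Real.sin_nonpos_of_nonpos_of_neg_pi_le h hk.1.le
      linarith
    have h2 : Real.pi/2 < θ (0,0) := by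
      by_contra h
      push Not at h
      have := Real.cos_nonneg_of_mem_Icc ⟨by linarith, h⟩
      linarith
    refine ⟨h2, lt_of_le_of_ne hk.2 ?_⟩
    intro h
    have h' : θ (0,0) = Real.pi := h
    rw [h', Real.sin_pi] at hsin
    exact lt_irrefl _ hsin
  have bot : ∀ s, θ (s, 0) ∈ Ioo 0 Real.pi := by
    refine stay_between (fun s => θ (s,0)) (by fun_prop) 0 Real.pi ?_ ?_ 0 ⟨by linarith [c00.1], c00.2⟩
    · intro s h
      have := (hs (s,0)).2.2.1.2 (hb s)
      rw [h, Real.sin_zero] at this; exact lt_irrefl _ this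
    · intro s h
      have := (hs (s,0)).2.2.1.2 (hb s)
      rw [h, Real.sin_pi] at this; exact lt_irrefl _ this
  have c10 : θ (1,0) ∈ Ioo (-(Real.pi/2)) (Real.pi/2) := by
    refine ⟨by linarith [(bot 1).1], ?_⟩
    by_contra h
    push Not at h
    have := Real.cos_nonpos_of_pi_div_two_le_of_le h (by linarith [(bot 1).2])
    linarith [(hs (1,0)).1.2 (hr 0)]
  have right : ∀ t, θ (1, t) ∈ Ioo (-(Real.pi/2)) (Real.pi/2) := by
    refine stay_between (fun t => θ (1,t)) (by fun_prop) _ _ ?_ ?_ 0 c10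
    · intro s h
      have := (hs (1,s)).1.2 (hr s)
      rw [h, Real.cos_neg, Real.cos_pi_div_two] at this; exact lt_irrefl _ this
    · intro s h
      have := (hs (1,s)).1.2 (hr s)
      rw [h, Real.cos_pi_div_two] at this; exact lt_irrefl _ this
  have c11 : θ (1,1) ∈ Ioo (-Real.pi) 0 := by
    refine ⟨by linarith [(right 1).1], ?_⟩
    by_contra h
    push Not at h
    have := Real.sin_nonneg_of_nonneg_of_le_pi h (by linarith [(right 1).2])
    linarith [(hs (1,1)).2.2.2.2 (ht 1)]
  have top : ∀ s, θ (s, 1) ∈ Ioo (-Real.pi) 0 := by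
    refine stay_between (fun s => θ (s,1)) (by fun_prop) _ _ ?_ ?_ 1 c11
    · intro s h
      have := (hs (s,1)).2.2.2.2 (ht s)
      rw [h, Real.sin_neg, Real.sin_pi] at this; simp at this
    · intro s h
      have := (hs (s,1)).2.2.2.2 (ht s)
      rw [h, Real.sin_zero] at this; exact lt_irrefl _ this
  have left : ∀ t, θ (0, t) ∈ Ioo (Real.pi/2) (Real.pi + Real.pi/2) := by
    refine stay_between (fun t => θ (0,t)) (by fun_prop) _ _ ?_ ?_ 0 ⟨c00.1, by linarith [c00.2]⟩
    · intro s h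
      have := (hs (0,s)).2.1.2 (hl s)
      rw [h, Real.cos_pi_div_two] at this; exact lt_irrefl _ this
    · intro s h
      have := (hs (0,s)).2.1.2 (hl s)
      rw [h, add_comm, Real.cos_add_pi, Real.cos_pi_div_two] at this; simp at this
  linarith [(left 1).1, (top 0).2]

variable {V : Type*} [NormedAddCommGroup V] [NormedSpace ℝ V]

lemma isPreconnected_thickening {K : Set V} (hK : IsPreconnected K) (δ : ℝ) :
    IsPreconnected (Metric.thickening δ K) := by
  rcases le_or_gt δ 0 with h | hδ
  · rw [Metric.thickening_of_nonpos h]; exact isPreconnected_empty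
  rcases K.eq_empty_or_nonempty with rfl | ⟨x0, hx0⟩
  · simpa using isPreconnected_empty
  refine isPreconnected_of_forall x0 ?_
  intro y hy
  rw [Metric.mem_thickening_iff] at hy
  obtain ⟨z, hz, hyz⟩ := hy
  refine ⟨K ∪ Metric.ball z δ, ?_, Or.inl hx0, Or.inr hyz, ?_⟩
  · refine union_subset (Metric.self_subset_thickening hδ K) ?_
    intro w hw
    exact Metric.mem_thickening_iff.2 ⟨z, hz, hw⟩
  · exact hK.union z hz (Metric.mem_ball_self hδ) (convex_ball z δ).isPreconnected

/-- Crossing lemma. -/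
lemma crossing (u w : V → ℝ) (hu : Continuous u) (hw : Continuous w)
    (huw : ∀ p q, u p = u q → w p = w q → p = q)
    (K₁ K₂ : Set V) (c₁ : IsCompact K₁) (c₂ : IsCompact K₂) (p₁ : IsPreconnected K₁)
    (p₂ : IsPreconnected K₂) (hd : Disjoint K₁ K₂) (ρ : ℝ)
    (h₁ : ∀ z ∈ K₁, |w z| < ρ) (h₂ : ∀ z ∈ K₂, |u z| < ρ)
    (a₁ : V) (ha₁ : a₁ ∈ K₁) (hua₁ : u a₁ = -ρ) (b₁ : V) (hb₁ : b₁ ∈ K₁) (hub₁ : u b₁ = ρ)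
    (a₂ : V) (ha₂ : a₂ ∈ K₂) (hwa₂ : w a₂ = -ρ) (b₂ : V) (hb₂ : b₂ ∈ K₂) (hwb₂ : w b₂ = ρ) :
    False := by
  obtain ⟨δ₀, hδ₀, hdis⟩ := hd.exists_thickenings c₁ c₂.isClosed
  obtain ⟨δ₁, hδ₁, hs₁⟩ := c₁.exists_thickening_subset_open
    (isOpen_lt (hw.abs) continuous_const : IsOpen {z | |w z| < ρ}) (fun z hz => h₁ z hz)
  obtain ⟨δ₂, hδ₂, hs₂⟩ := c₂.exists_thickening_subset_open
    (isOpen_lt (hu.abs) continuous_const : IsOpen {z | |u z| < ρ}) (fun z hz => h₂ z hz)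
  set δ := min δ₀ (min δ₁ δ₂) with hδdef
  have hδ : 0 < δ := by simp [hδdef, hδ₀, hδ₁, hδ₂]
  have pc₁ : IsPathConnected (Metric.thickening δ K₁) := by
    rw [← Metric.isOpen_thickening.isConnected_iff_isPathConnected]
    exact ⟨⟨a₁, Metric.self_subset_thickening hδ _ ha₁⟩, isPreconnected_thickening p₁ δ⟩
  have pc₂ : IsPathConnected (Metric.thickening δ K₂) := by
    rw [← Metric.isOpen_thickening.isConnected_iff_isPathConnected]
    exact ⟨⟨a₂, Metric.self_subset_thickening hδ _ ha₂⟩, isPreconnected_thickening p₂ δ⟩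
  obtain ⟨γ₁, hγ₁⟩ := pc₁.joinedIn a₁ (Metric.self_subset_thickening hδ _ ha₁) b₁
    (Metric.self_subset_thickening hδ _ hb₁)
  obtain ⟨γ₂, hγ₂⟩ := pc₂.joinedIn a₂ (Metric.self_subset_thickening hδ _ ha₂) b₂
    (Metric.self_subset_thickening hδ _ hb₂)
  have m₁ : ∀ s, |w (γ₁ s)| < ρ := fun s => hs₁ (Metric.thickening_mono (by simp [hδdef]) _ (hγ₁ s))
  have m₂ : ∀ s, |u (γ₂ s)| < ρ := fun s => hs₂ (Metric.thickening_mono (by simp [hδdef]) _ (hγ₂ s))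
  have hne : ∀ s t, γ₁ s ≠ γ₂ t := by
    intro s t h
    refine Set.disjoint_left.1 hdis (Metric.thickening_mono (by simp [hδdef]) _ (hγ₁ s)) ?_
    rw [h]
    exact Metric.thickening_mono (by simp [hδdef]) _ (hγ₂ t)
  refine square_no_zero (fun p => ⟨u (γ₁ p.1) - u (γ₂ p.2), w (γ₁ p.1) - w (γ₂ p.2)⟩) ?_ ?_ ?_ ?_ ?_ ?_
  · have : Continuous fun p : I × I => (((u (γ₁ p.1) - u (γ₂ p.2) : ℝ) : ℂ) +
        ((w (γ₁ p.1) - w (γ₂ p.2) : ℝ) : ℂ) * Complex.I) := by fun_prop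
    convert this using 2 with p
    apply Complex.ext <;> simp
  · intro p h
    have h1 := congrArg Complex.re h
    have h2 := congrArg Complex.im h
    simp only [Complex.zero_re, Complex.zero_im] at h1 h2
    exact hne p.1 p.2 (huw _ _ (by linarith) (by linarith))
  · intro t
    have := abs_lt.1 (m₂ t)
    simp only [γ₁.source, hua₁]; linarith
  · intro t
    have := abs_lt.1 (m₂ t)
    simp only [γ₁.target, hub₁]; linarith
  · intro t
    have := abs_lt.1 (m₁ t)
    simp only [γ₂.source, hwa₂]; linarith
  · intro t
    have := abs_lt.1 (m₁ t)
    simp only [γ₂.target, hwb₂]; linarith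

section Basic

variable {V : Type} [NormedAddCommGroup V] [NormedSpace ℝ V] [MeasurableSpace V] [BorelSpace V]

lemma seg_len (x y : V) : Measure.hausdorffMeasure 1 (segment ℝ x y) = ENNReal.ofReal (dist x y) := by
  rw [hausdorffMeasure_segment, edist_dist]

/-- Lipschitz function separating two points of a connected set gives a length bound -/
lemma lip_len {S : Set V} (hS : IsPreconnected S) (h : V → ℝ) (K : ℝ≥0) (hh : LipschitzWith K h)
    {x y : V} (hx : x ∈ S) (hy : y ∈ S) (s t : ℝ) (hs : h x ≤ s) (ht : t ≤ h y) :
    ENNReal.ofReal (t - s) ≤ K * Measure.hausdorffMeasure 1 (S ∩ {z | s < h z ∧ h z < t}) := by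
  have h1 : Ioo s t ⊆ h '' (S ∩ {z | s < h z ∧ h z < t}) := by
    intro r hr
    have : Icc (h x) (h y) ⊆ h '' S := hS.intermediate_value hx hy hh.continuous.continuousOn
    obtain ⟨z, hz, rfl⟩ := this ⟨hs.trans hr.1.le, hr.2.le.trans ht⟩
    exact ⟨z, ⟨hz, hr.1, hr.2⟩, rfl⟩
  calc ENNReal.ofReal (t - s) = volume (Ioo s t) := by rw [Real.volume_Ioo]
    _ = Measure.hausdorffMeasure 1 (Ioo s t) := by rw [hausdorffMeasure_real]
    _ ≤ Measure.hausdorffMeasure 1 (h '' (S ∩ {z | s < h z ∧ h z < t})) := measure_mono h1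
    _ ≤ (K : ℝ≥0∞) ^ (1:ℝ) * Measure.hausdorffMeasure 1 (S ∩ {z | s < h z ∧ h z < t}) :=
      hh.hausdorffMeasure_image_le zero_le_one _
    _ = _ := by rw [ENNReal.rpow_one]

lemma conn_len {S : Set V} (hS : IsPreconnected S) {x y : V} (hx : x ∈ S) (hy : y ∈ S) :
    ENNReal.ofReal (dist x y) ≤ Measure.hausdorffMeasure 1 S := by
  have := lip_len hS (fun z => dist z x) 1 (LipschitzWith.dist_left x) hx hy 0 (dist y x) (by simp) le_rfl
  simp only [sub_zero, ENNReal.coe_one, one_mul] at this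
  rw [dist_comm]
  exact this.trans (measure_mono inter_subset_left)

lemma glue {X : Type*} [TopologicalSpace X] {A B Z : Set X} (hAB : IsPreconnected (A ∪ B)) (hZ : IsPreconnected Z)
    (hB : B.Nonempty) (cA : IsClosed A) (cB : IsClosed B) (cZ : IsClosed Z) (h : A ∩ B ⊆ Z) :
    IsPreconnected (A ∪ Z) := by
  -- key step
  have key : ∀ s t : Set X, IsClosed s → IsClosed t → A ∪ Z ⊆ s ∪ t → ((A ∪ Z) ∩ t).Nonempty →
      Z ⊆ s → ((A ∪ Z) ∩ (s ∩ t)).Nonempty := by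
    intro s t hs ht hst hne hZs
    by_contra hem
    rw [not_nonempty_iff_eq_empty] at hem
    have hem' : ∀ x, x ∈ A ∪ Z → x ∈ s → x ∈ t → False := fun x h1 h2 h3 => by
      have : x ∈ (A ∪ Z) ∩ (s ∩ t) := ⟨h1, h2, h3⟩
      rw [hem] at this; exact this
    obtain ⟨x, hxA, hxt⟩ := hne
    have hxA' : x ∈ A := by
      rcases hxA with h | h
      · exact h
      · exact (hem' x (Or.inr h) (hZs h) hxt).elim
    rw [isPreconnected_closed_iff] at hAB
    obtain ⟨y, hy, hy1, hy2⟩ := hAB (A ∩ t) ((A ∩ s) ∪ B) (cA.inter ht) ((cA.inter hs).union cB) (by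
      rintro z (hz | hz)
      · rcases hst (Or.inl hz) with h | h
        · exact Or.inr (Or.inl ⟨hz, h⟩)
        · exact Or.inl ⟨hz, h⟩
      · exact Or.inr (Or.inr hz)) ⟨x, Or.inl hxA', hxA', hxt⟩
      (hB.imp fun b hb => ⟨Or.inr hb, Or.inr hb⟩)
    rcases hy2 with h2 | h2
    · exact hem' y (Or.inl hy1.1) h2.2 hy1.2
    · exact hem' y (Or.inl hy1.1) (hZs (h ⟨hy1.1, h2⟩)) hy1.2
  rw [isPreconnected_closed_iff]
  intro s t hs ht hst hns hnt
  by_cases hZ1 : Z ⊆ s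
  · exact key s t hs ht hst hnt hZ1
  by_cases hZ2 : Z ⊆ t
  · have := key t s ht hs (by rwa [union_comm t s]) hns hZ2
    rwa [inter_comm t s] at this
  rw [not_subset] at hZ1 hZ2
  obtain ⟨x, hx, hxs⟩ := hZ1
  obtain ⟨y, hy, hyt⟩ := hZ2
  rw [isPreconnected_closed_iff] at hZ
  have hZst : Z ⊆ s ∪ t := subset_union_right.trans hst
  obtain ⟨z, hz, hz'⟩ := hZ s t hs ht hZst ⟨y, hy, (hZst hy).resolve_right hyt⟩
    ⟨x, hx, (hZst hx).resolve_left hxs⟩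
  exact ⟨z, Or.inr hz, hz'⟩

/-- underlying set of a network -/
def netset {ι : Type} (G : SimpleGraph ι) (q : ι → V) : Set V :=
  ⋃ i, ⋃ j, ⋃ (_ : G.Adj i j ∨ i = j), segment ℝ (q i) (q j)

lemma mem_netset {ι : Type} {G : SimpleGraph ι} {q : ι → V} {z : V} :
    z ∈ netset G q ↔ ∃ i j, (G.Adj i j ∨ i = j) ∧ z ∈ segment ℝ (q i) (q j) := by
  simp [netset]

lemma netset_vertex {ι : Type} (G : SimpleGraph ι) (q : ι → V) (i : ι) : q i ∈ netset G q :=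
  mem_netset.2 ⟨i, i, Or.inr rfl, left_mem_segment ℝ _ _⟩

lemma segment_compact (x y : V) : IsCompact (segment ℝ x y) := by
  rw [segment_eq_image_lineMap]
  exact isCompact_Icc.image (by exact AffineMap.lineMap_continuous)

lemma netset_compact {ι : Type} [Finite ι] (G : SimpleGraph ι) (q : ι → V) : IsCompact (netset G q) := by
  classical
  refine isCompact_iUnion fun i => isCompact_iUnion fun j => ?_
  by_cases h : G.Adj i j ∨ i = j
  · simp only [h, iUnion_true]; exact segment_compact _ _
  · simp only [h, iUnion_false]; exact isCompact_empty

lemma netset_connected {ι : Type} {G : SimpleGraph ι} (hG : G.Connected) (q : ι → V) :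
    IsConnected (netset G q) := by
  obtain ⟨i0⟩ := hG.nonempty
  have hseg : ∀ i j, (G.Adj i j ∨ i = j) → q i ∈ connectedComponentIn (netset G q) (q i0) →
      segment ℝ (q i) (q j) ⊆ connectedComponentIn (netset G q) (q i0) := by
    intro i j hij hi
    rw [connectedComponentIn_eq hi]
    exact (convex_segment _ _).isPreconnected.subset_connectedComponentIn (left_mem_segment ℝ _ _)
      fun z hz => mem_netset.2 ⟨i, j, hij, hz⟩
  have hv : ∀ i j, G.Reachable i j → q i ∈ connectedComponentIn (netset G q) (q i0) →
      q j ∈ connectedComponentIn (netset G q) (q i0) := by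
    rintro i j ⟨w⟩
    induction w with
    | nil => exact id
    | cons h _ ih => exact fun hi => ih (hseg _ _ (Or.inl h) hi (right_mem_segment ℝ _ _))
  have h0 := mem_connectedComponentIn (netset_vertex G q i0)
  have : netset G q = connectedComponentIn (netset G q) (q i0) := by
    refine subset_antisymm ?_ (connectedComponentIn_subset _ _)
    intro z hz
    obtain ⟨i, j, hij, hz⟩ := mem_netset.1 hz
    exact hseg i j hij (hv i0 i (hG.preconnected _ _) h0) hz
  refine ⟨⟨_, netset_vertex G q i0⟩, ?_⟩
  rw [this]
  exact isPreconnected_connectedComponentIn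

lemma netset_measure {K : ℕ} (G : SimpleGraph (Fin K)) (q : Fin K → V) :
    Measure.hausdorffMeasure 1 (netset G q) ≤ ENNReal.ofReal (glen2 G q / 2) := by
  classical
  let S : Fin K → Fin K → Set V := fun i j => if G.Adj i j ∧ i < j then segment ℝ (q i) (q j) else
    if i = j then {q i} else ∅
  have hsub : netset G q ⊆ ⋃ i, ⋃ j, S i j := by
    intro z hz
    obtain ⟨i, j, hij, hz⟩ := mem_netset.1 hz
    simp only [mem_iUnion]
    rcases hij with h | h
    · rcases lt_or_gt_of_ne h.ne with hl | hl
      · exact ⟨i, j, by simpa [S, h, hl] using hz⟩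
      · exact ⟨j, i, by rw [segment_symm] at hz; simpa [S, h.symm, hl] using hz⟩
    · subst h
      exact ⟨i, i, by simpa [S] using hz⟩
  have hm : ∀ i j, Measure.hausdorffMeasure 1 (S i j) =
      ENNReal.ofReal (if G.Adj i j ∧ i < j then dist (q i) (q j) else 0) := by
    intro i j
    by_cases h : G.Adj i j ∧ i < j
    · simp only [S, h, and_self, if_true, seg_len]
    · by_cases h2 : i = j
      · have : ({q i} : Set V) = segment ℝ (q i) (q i) := by simp
        subst h2
        simp only [S, h, if_false, if_true]
        rw [this, seg_len]; simp
      · simp [S, h, h2]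
  have hnn : ∀ i j, 0 ≤ (if G.Adj i j ∧ i < j then dist (q i) (q j) else 0) := by
    intro i j; split_ifs <;> positivity
  have hlen : glen2 G q = 2 * ∑ i, ∑ j, if G.Adj i j ∧ i < j then dist (q i) (q j) else 0 := by
    have h1 : ∀ i j, (if G.Adj i j then dist (q i) (q j) else 0) =
        (if G.Adj i j ∧ i < j then dist (q i) (q j) else 0) +
        (if G.Adj j i ∧ j < i then dist (q j) (q i) else 0) := by
      intro i j
      by_cases h : G.Adj i j
      · rcases lt_or_gt_of_ne h.ne with hl | hl
        · simp [h, hl, hl.le]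
        · simp [h, h.symm, hl, hl.le, dist_comm]
      · have : ¬ G.Adj j i := fun h' => h h'.symm
        simp [h, this]
    have h2 : glen2 G q = ∑ i, ∑ j, (if G.Adj i j then dist (q i) (q j) else 0) := rfl
    rw [h2, Finset.sum_congr rfl fun i _ => Finset.sum_congr rfl fun j _ => h1 i j]
    simp only [Finset.sum_add_distrib]
    rw [Finset.sum_comm (f := fun i j => if G.Adj j i ∧ j < i then dist (q j) (q i) else 0)]
    ring
  calc Measure.hausdorffMeasure 1 (netset G q) ≤ Measure.hausdorffMeasure 1 (⋃ i, ⋃ j, S i j) := measure_mono hsub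
    _ ≤ ∑ i, Measure.hausdorffMeasure 1 (⋃ j, S i j) := measure_iUnion_fintype_le _ _
    _ ≤ ∑ i, ∑ j, Measure.hausdorffMeasure 1 (S i j) :=
      Finset.sum_le_sum fun i _ => measure_iUnion_fintype_le _ _
    _ = ∑ i, ∑ j, ENNReal.ofReal (if G.Adj i j ∧ i < j then dist (q i) (q j) else 0) := by
      simp only [hm]
    _ = ENNReal.ofReal (glen2 G q / 2) := by
      rw [hlen, mul_div_cancel_left₀ _ two_ne_zero, ENNReal.ofReal_sum_of_nonneg
        fun i _ => Finset.sum_nonneg fun j _ => hnn i j]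
      refine Finset.sum_congr rfl fun i _ => ?_
      rw [ENNReal.ofReal_sum_of_nonneg fun j _ => hnn i j]

end Basic

section Approx

variable {V : Type} [NormedAddCommGroup V] [NormedSpace ℝ V] [MeasurableSpace V] [BorelSpace V]

/-- there is a network containing `S`, touching all `W j`, `j ∈ J`, with small length -/
def HN (W : ℕ → Set V) (w : ℕ → ℝ) (S : Set V) (J : Finset ℕ) (L : ℝ) : Prop :=
  ∃ (ι : Type) (_ : Fintype ι) (G : SimpleGraph ι) (q : ι → V), G.Connected ∧ S ⊆ range q ∧
    (∀ j ∈ J, ∃ i, q i ∈ W j) ∧ glen2 G q ≤ 2 * (L + ∑ j ∈ J, w j)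

lemma HN.attach {W : ℕ → Set V} {w : ℕ → ℝ} {r : ℝ} {s : Finset ℕ} {N : SimpleGraph ℕ}
    (hw : ∀ i ∈ s, ∀ x ∈ W i, ∀ y ∈ W i, dist x y ≤ w i) (hr : ∀ i ∈ s, w i ≤ r)
    (hN : ∀ i j, N.Adj i j → i ∈ s ∧ j ∈ s ∧ (W i ∩ W j).Nonempty)
    {S : Set V} {J : Finset ℕ} {L : ℝ} (hJ : J ⊆ s) (h : HN W w S J L) {i j : ℕ} (p : N.Walk i j) :
    p.IsPath → j ∈ J → i ∈ s → ∀ x ∈ W i, ∃ J', J ⊆ J' ∧ J' ⊆ s ∧ (∀ k ∈ J', k ∈ J ∨ k ∈ p.support) ∧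
      HN W w (insert x S) J' (L + r) := by
  have hin : ∀ i ∈ J, ∀ x ∈ W i, HN W w (insert x S) J (L + r) := by
    intro i hi x hx
    obtain ⟨ι, _, G, q, hG, hS, hJq, hl⟩ := h
    obtain ⟨k, hk⟩ := hJq i hi
    refine ⟨Option ι, inferInstance, addLeafG G k, fun o => o.elim x q, addLeafG_connected hG k, ?_, ?_, ?_⟩
    · rintro y (rfl | hy)
      · exact ⟨none, rfl⟩
      · obtain ⟨l, hl⟩ := hS hy
        exact ⟨some l, hl⟩
    · intro j hj
      obtain ⟨l, hl⟩ := hJq j hj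
      exact ⟨some l, hl⟩
    · rw [addLeafG_glen2]
      have := hw i (hJ hi) x hx _ hk
      have := hr i (hJ hi)
      linarith
  induction p with
  | nil =>
    intro _ hj _ x hx
    exact ⟨J, le_rfl, hJ, fun k hk => Or.inl hk, hin _ hj x hx⟩
  | @cons u v t huv p ih =>
    intro hp hj hi x hx
    rw [SimpleGraph.Walk.cons_isPath_iff] at hp
    by_cases hu : u ∈ J
    · exact ⟨J, le_rfl, hJ, fun k hk => Or.inl hk, hin _ hu x hx⟩
    obtain ⟨_, hv, y, hyu, hyv⟩ := hN _ _ huv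
    obtain ⟨J', h1, h2, h3, h4⟩ := ih hp.1 hj hv y hyv
    have huJ : u ∉ J' := fun hh => (h3 u hh).elim hu hp.2
    obtain ⟨ι, _, G, q, hG, hS, hJq, hl⟩ := h4
    obtain ⟨k, hk⟩ := hS (mem_insert y S)
    refine ⟨insert u J', h1.trans (Finset.subset_insert _ _), Finset.insert_subset hi h2, ?_,
      Option ι, inferInstance, addLeafG G k, fun o => o.elim x q, addLeafG_connected hG k, ?_, ?_, ?_⟩
    · intro l hl
      rw [Finset.mem_insert] at hl
      rcases hl with rfl | hl
      · right; simp
      · rcases h3 l hl with h | h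
        · exact Or.inl h
        · right; simp [h]
    · rintro z (rfl | hz)
      · exact ⟨none, rfl⟩
      · obtain ⟨l, hl⟩ := hS (mem_insert_of_mem y hz)
        exact ⟨some l, hl⟩
    · intro j hj
      rw [Finset.mem_insert] at hj
      rcases hj with rfl | hj
      · exact ⟨none, hx⟩
      · obtain ⟨l, hl⟩ := hJq j hj
        exact ⟨some l, hl⟩
    · rw [addLeafG_glen2, Finset.sum_insert huJ]
      have := hw u hi x hx y hyu
      rw [← hk] at this
      linarith

/-- nerve graph -/
def nerveG (W : ℕ → Set V) (T : Set V) (s : Finset ℕ) : SimpleGraph ℕ where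
  Adj i j := i ≠ j ∧ i ∈ s ∧ j ∈ s ∧ (T ∩ (W i ∩ W j)).Nonempty
  symm := ⟨fun i j h => ⟨h.1.symm, h.2.2.1, h.2.1, by rw [inter_comm (W j)]; exact h.2.2.2⟩⟩
  loopless := ⟨fun i h => h.1 rfl⟩

lemma nerve_reach {W : ℕ → Set V} {T : Set V} {s : Finset ℕ} (hW : ∀ i, IsOpen (W i))
    (hT : IsPreconnected T) (hs : T ⊆ ⋃ i ∈ s, W i) {i j : ℕ} (hi : i ∈ s) (hj : j ∈ s)
    (hiT : (T ∩ W i).Nonempty) (hjT : (T ∩ W j).Nonempty) : (nerveG W T s).Reachable i j := by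
  by_contra hcon
  let A : Set V := ⋃ k ∈ {k | k ∈ s ∧ (nerveG W T s).Reachable i k}, W k
  let B : Set V := ⋃ k ∈ {k | k ∈ s ∧ ¬ (nerveG W T s).Reachable i k}, W k
  obtain ⟨x, hx, hxA, hxB⟩ := hT A B (isOpen_biUnion fun k _ => hW k) (isOpen_biUnion fun k _ => hW k) (by
    intro x hx
    obtain ⟨k, hk, hxk⟩ := mem_iUnion₂.1 (hs hx)
    by_cases h : (nerveG W T s).Reachable i k
    · exact Or.inl (mem_iUnion₂.2 ⟨k, ⟨hk, h⟩, hxk⟩)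
    · exact Or.inr (mem_iUnion₂.2 ⟨k, ⟨hk, h⟩, hxk⟩))
    (hiT.imp fun x hx => ⟨hx.1, mem_iUnion₂.2 ⟨i, ⟨hi, SimpleGraph.Reachable.refl _⟩, hx.2⟩⟩)
    (hjT.imp fun x hx => ⟨hx.1, mem_iUnion₂.2 ⟨j, ⟨hj, hcon⟩, hx.2⟩⟩)
  obtain ⟨k, hk, hxk⟩ := mem_iUnion₂.1 hxA
  obtain ⟨l, hl, hxl⟩ := mem_iUnion₂.1 hxB
  have hkl : k ≠ l := fun h => hl.2 (h ▸ hk.2)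
  exact hl.2 (hk.2.trans (SimpleGraph.Adj.reachable ⟨hkl, hk.1, hl.1, x, hx, hxk, hxl⟩))

lemma good_cover {T : Set V} (hT : IsCompact T) (hm : Measure.hausdorffMeasure 1 T ≠ ∞)
    (r : ℝ) (hr : 0 < r) : ∃ (W : ℕ → Set V) (w : ℕ → ℝ) (s : Finset ℕ),
      (∀ i, IsOpen (W i)) ∧ T ⊆ (⋃ i ∈ s, W i) ∧ (∀ i, ∀ x ∈ W i, ∀ y ∈ W i, dist x y ≤ w i) ∧
      (∀ i, w i ≤ r) ∧ (∀ i, 0 ≤ w i) ∧ ∑ i ∈ s, w i ≤ (Measure.hausdorffMeasure 1 T).toReal + r := by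
  set μ := Measure.hausdorffMeasure 1 T with hμ
  have hr2 : 0 < ENNReal.ofReal (r / 2) := by simpa using hr
  have h1 : ⨅ (t : ℕ → Set V) (_ : T ⊆ ⋃ n, t n) (_ : ∀ n, Metric.ediam (t n) ≤ ENNReal.ofReal (r/2)),
          ∑' n, ⨆ _ : (t n).Nonempty, Metric.ediam (t n) ^ (1:ℝ) < μ + ENNReal.ofReal (r / 2) := by
    refine lt_of_le_of_lt ?_ (ENNReal.lt_add_right hm hr2.ne')
    rw [hμ, Measure.hausdorffMeasure_apply]
    exact le_iSup₂ (f := fun (r : ℝ≥0∞) (_ : 0 < r) => ⨅ (t : ℕ → Set V) (_ : T ⊆ ⋃ n, t n)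
      (_ : ∀ n, Metric.ediam (t n) ≤ r), ∑' n, ⨆ _ : (t n).Nonempty, Metric.ediam (t n) ^ (1:ℝ)) _ hr2
  simp only [iInf_lt_iff] at h1
  obtain ⟨t, ht, htd, hsum⟩ := h1
  obtain ⟨δ, hδ, hδs⟩ := ENNReal.exists_pos_sum_of_countable (ε := ENNReal.ofReal (r/4)) (by simpa using hr) ℕ
  let W : ℕ → Set V := fun i => Metric.thickening (δ i) (t i)
  have hdW : ∀ i, Metric.ediam (W i) ≤ (⨆ _ : (t i).Nonempty, Metric.ediam (t i) ^ (1:ℝ)) + 2 * δ i := by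
    intro i
    by_cases hne : (t i).Nonempty
    · simp only [hne, iSup_true, ENNReal.rpow_one]
      exact Metric.ediam_thickening_le _
    · rw [not_nonempty_iff_eq_empty] at hne
      simp [W, hne]
  have hsumW : ∑' i, Metric.ediam (W i) ≤ μ + ENNReal.ofReal r := by
    calc ∑' i, Metric.ediam (W i) ≤ ∑' i, ((⨆ _ : (t i).Nonempty, Metric.ediam (t i) ^ (1:ℝ)) + 2 * δ i) :=
        ENNReal.tsum_le_tsum hdW
      _ = (∑' i, ⨆ _ : (t i).Nonempty, Metric.ediam (t i) ^ (1:ℝ)) + 2 * ∑' i, (δ i : ℝ≥0∞) := by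
        rw [ENNReal.tsum_add, ENNReal.tsum_mul_left]
      _ ≤ (μ + ENNReal.ofReal (r/2)) + 2 * ENNReal.ofReal (r/4) := by gcongr
      _ = μ + ENNReal.ofReal r := by
        rw [add_assoc]
        congr 1
        rw [show (2:ℝ≥0∞) = ENNReal.ofReal 2 by simp, ← ENNReal.ofReal_mul (by norm_num),
          ← ENNReal.ofReal_add (by positivity) (by positivity)]
        congr 1; ring
  have hδi : ∀ i, (δ i : ℝ≥0∞) ≤ ENNReal.ofReal (r/4) := fun i => (ENNReal.le_tsum i).trans hδs.le
  have hWr : ∀ i, Metric.ediam (W i) ≤ ENNReal.ofReal r := by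
    intro i
    calc Metric.ediam (W i) ≤ Metric.ediam (t i) + 2 * δ i := Metric.ediam_thickening_le _
      _ ≤ ENNReal.ofReal (r/2) + 2 * ENNReal.ofReal (r/4) := by gcongr; exact htd i; exact hδi i
      _ = ENNReal.ofReal r := by
        rw [show (2:ℝ≥0∞) = ENNReal.ofReal 2 by simp, ← ENNReal.ofReal_mul (by norm_num),
          ← ENNReal.ofReal_add (by positivity) (by positivity)]
        congr 1; ring
  have hfin : ∀ i, Metric.ediam (W i) ≠ ∞ := fun i => ne_top_of_le_ne_top ENNReal.ofReal_ne_top (hWr i)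
  have hopen : ∀ i, IsOpen (W i) := fun i => Metric.isOpen_thickening
  have hcov : T ⊆ ⋃ i, W i := fun x hx => by
    obtain ⟨i, hi⟩ := mem_iUnion.1 (ht hx)
    exact mem_iUnion.2 ⟨i, Metric.self_subset_thickening (by exact_mod_cast hδ i) _ hi⟩
  obtain ⟨s, hs⟩ := hT.elim_finite_subcover W hopen hcov
  refine ⟨W, fun i => (Metric.ediam (W i)).toReal, s, hopen, hs, ?_, ?_, fun i => ENNReal.toReal_nonneg, ?_⟩
  · intro i x hx y hy
    rw [dist_edist]
    exact ENNReal.toReal_mono (hfin i) (Metric.edist_le_ediam_of_mem hx hy)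
  · intro i
    exact ENNReal.toReal_le_of_le_ofReal hr.le (hWr i)
  · rw [← ENNReal.toReal_sum fun i _ => hfin i]
    have : ∑ i ∈ s, Metric.ediam (W i) ≤ μ + ENNReal.ofReal r := (ENNReal.sum_le_tsum s).trans hsumW
    have h2 := ENNReal.toReal_mono (by finiteness) this
    rwa [ENNReal.toReal_add hm (by finiteness), ENNReal.toReal_ofReal hr.le] at h2

lemma exists_net {T : Set V} (hT : IsCompact T) (hc : IsPreconnected T)
    (hm : Measure.hausdorffMeasure 1 T ≠ ∞) (A : Finset V) (hA : (A : Set V) ⊆ T) (hne : A.Nonempty)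
    (ε : ℝ) (hε : 0 < ε) :
    ∃ (ι : Type) (_ : Fintype ι) (G : SimpleGraph ι) (q : ι → V), G.Connected ∧ (A : Set V) ⊆ range q ∧
      glen2 G q ≤ 2 * ((Measure.hausdorffMeasure 1 T).toReal + ε) := by
  classical
  have hcard : (0:ℝ) < A.card + 1 := by positivity
  obtain ⟨W, w, s, hW, hs, hw, hwr, hw0, hsum⟩ := good_cover hT hm (ε / (A.card + 1)) (by positivity)
  set r := ε / (A.card + 1) with hr
  have main : ∀ A' : Finset V, (A' : Set V) ⊆ T → A'.Nonempty → ∃ J : Finset ℕ, J.Nonempty ∧ J ⊆ s ∧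
      (∀ j ∈ J, (T ∩ W j).Nonempty) ∧ HN W w A' J (A'.card * r) := by
    intro A'
    induction A' using Finset.induction_on with
    | empty => intro _ h; exact absurd h (by simp)
    | insert a A' ha ih =>
      intro hsub _
      have haT : a ∈ T := hsub (by simp)
      obtain ⟨i, hi, hai⟩ := mem_iUnion₂.1 (hs haT)
      by_cases hA' : A'.Nonempty
      · obtain ⟨J, hJ, hJs, hJT, hN⟩ := ih (fun x hx => hsub (by simp [show x ∈ A' from hx])) hA'
        obtain ⟨j, hj⟩ := hJ
        obtain ⟨p, hp⟩ := (nerve_reach hW hc hs hi (hJs hj) ⟨a, haT, hai⟩ (hJT j hj)).exists_isPath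
        obtain ⟨J', h1, h2, h3, h4⟩ := hN.attach (r := r) (N := nerveG W T s) (fun i _ => hw i) (fun i _ => hwr i)
          (fun i j h => ⟨h.2.1, h.2.2.1, h.2.2.2.imp fun x hx => hx.2⟩) hJs p hp hj hi a hai
        refine ⟨J', ⟨j, h1 hj⟩, h2, ?_, ?_⟩
        · have hsup : ∀ (i j : ℕ) (p : (nerveG W T s).Walk i j), (T ∩ W i).Nonempty → ∀ k ∈ p.support, (T ∩ W k).Nonempty := by
            intro i j p
            induction p with
            | nil => intro h k hk; simp at hk; rw [hk]; exact h
            | cons h p ih =>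
              intro h1 k hk
              rw [SimpleGraph.Walk.support_cons, List.mem_cons] at hk
              rcases hk with rfl | hk
              · exact h1
              · exact ih (h.2.2.2.imp fun x hx => ⟨hx.1, hx.2.2⟩) k hk
          intro k hk
          rcases h3 k hk with h | h
          · exact hJT k h
          · exact hsup _ _ p ⟨a, haT, hai⟩ k h
        · have : ((insert a A' : Finset V).card : ℝ) * r = A'.card * r + r := by
            rw [Finset.card_insert_of_notMem ha]; push_cast; ring
          rw [this, Finset.coe_insert]
          exact h4
      · rw [Finset.not_nonempty_iff_eq_empty] at hA'
        subst hA'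
        refine ⟨{i}, by simp, by simpa using hi, by simpa using ⟨a, haT, hai⟩, Unit, inferInstance, ⊥,
          fun _ => a, ?_, ?_, ?_, ?_⟩
        · haveI : Nonempty Unit := ⟨()⟩
          exact ⟨fun a b => by rw [Subsingleton.elim a b]⟩
        · simp
        · simpa using hai
        · have := hw0 i
          have hrr : 0 < r := by positivity
          simp [glen2]
          positivity
  obtain ⟨J, hJ, hJs, -, ι, _, G, q, hG, hS, -, hl⟩ := main A hA hne
  refine ⟨ι, inferInstance, G, q, hG, hS, hl.trans ?_⟩
  have h1 : ∑ j ∈ J, w j ≤ ∑ j ∈ s, w j := Finset.sum_le_sum_of_subset_of_nonneg hJs fun i _ _ => hw0 i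
  have h2 : A.card * r + r = ε := by rw [hr]; field_simp
  linarith

end Approx

section Limit

variable {V : Type} [NormedAddCommGroup V] [NormedSpace ℝ V] [MeasurableSpace V] [BorelSpace V]

lemma ultra_const {α : Type*} [Finite α] (u : Ultrafilter ℕ) (f : ℕ → α) : ∃ a, ∀ᶠ n in u, f n = a := by
  obtain ⟨a, ha⟩ := (u.map f).eq_pure_of_finite
  refine ⟨a, ?_⟩
  have : {a} ∈ u.map f := by rw [ha]; simp
  exact this

lemma ultra_lim {X : Type*} [NormedAddCommGroup X] [ProperSpace X] (u : Ultrafilter ℕ) (f : ℕ → X) (C : ℝ)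
    (h : ∀ᶠ n in u, ‖f n‖ ≤ C) : ∃ x, Tendsto f u (𝓝 x) := by
  obtain ⟨x, _, hx⟩ := (isCompact_closedBall (0:X) C).ultrafilter_le_nhds (u.map f) (by
    rw [le_principal_iff]
    have h2 : ∀ᶠ n in u, f n ∈ Metric.closedBall (0:X) C := by
      filter_upwards [h] with n hn
      simpa using hn
    exact h2)
  exact ⟨x, hx⟩

lemma star_bound {M : ℕ} (e : Fin M → V) (R : ℝ) (he : ∀ m, ‖e m‖ ≤ R) :
    ∃ S : Set V, IsCompact S ∧ IsPreconnected S ∧ (∀ m, e m ∈ S) ∧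
      Measure.hausdorffMeasure 1 S ≤ ENNReal.ofReal (M * R) := by
  refine ⟨⋃ m, segment ℝ 0 (e m), isCompact_iUnion fun m => segment_compact _ _,
    isPreconnected_iUnion ⟨0, mem_iInter.2 fun m => left_mem_segment ℝ _ _⟩ fun m => (convex_segment _ _).isPreconnected,
    fun m => mem_iUnion.2 ⟨m, right_mem_segment ℝ _ _⟩, ?_⟩
  calc Measure.hausdorffMeasure 1 (⋃ m, segment ℝ 0 (e m)) ≤ ∑ m, Measure.hausdorffMeasure 1 (segment ℝ 0 (e m)) :=
        measure_iUnion_fintype_le _ _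
    _ ≤ ∑ m : Fin M, ENNReal.ofReal R := by
      refine Finset.sum_le_sum fun m _ => ?_
      rw [seg_len]
      exact ENNReal.ofReal_le_ofReal (by simpa using he m)
    _ = ENNReal.ofReal (M * R) := by
      simp only [Finset.sum_const, Finset.card_univ, Fintype.card_fin, nsmul_eq_mul]
      rw [ENNReal.ofReal_mul (by positivity), ENNReal.ofReal_natCast]

lemma near_net {M : ℕ} (hM : 1 ≤ M) (e : Fin M → V) {T : Set V} (hT : IsCompact T) (hc : IsPreconnected T)
    (hm : Measure.hausdorffMeasure 1 T ≠ ∞) (he : ∀ m, e m ∈ T)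
    (hmin : ∀ S, IsCompact S → IsPreconnected S → (∀ m, e m ∈ S) →
      Measure.hausdorffMeasure 1 T ≤ Measure.hausdorffMeasure 1 S) (η : ℝ) (hη : 0 < η) :
    ∃ (G : SimpleGraph (Fin (2 * M))) (q : Fin (2 * M) → V), G.Connected ∧ (∀ m, ∃ i, q i = e m) ∧
      glen2 G q ≤ 2 * ((Measure.hausdorffMeasure 1 T).toReal + η) ∧
      ∀ z ∈ T, ∃ i j, (G.Adj i j ∨ i = j) ∧ dist (q i) z + dist z (q j) ≤ dist (q i) (q j) + η := by
  classical
  obtain ⟨A0, hA0, hA0f, hA0c⟩ := hT.finite_cover_balls (e := η / 8) (by positivity)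
  let A : Finset V := hA0f.toFinset ∪ Finset.univ.image e
  have hAT : (A : Set V) ⊆ T := by
    intro x hx
    simp only [A, Finset.coe_union, Finite.coe_toFinset, Finset.coe_image, Finset.coe_univ, image_univ] at hx
    rcases hx with h | ⟨m, rfl⟩
    · exact hA0 h
    · exact he m
  have heA : ∀ m, e m ∈ A := fun m => by simp [A]
  obtain ⟨ι, _, G, q, hG, hq, hl⟩ := exists_net hT hc hm A hAT ⟨_, heA ⟨0, hM⟩⟩ (η / 4) (by positivity)
  set μ := (Measure.hausdorffMeasure 1 T).toReal
  have hN : NetData e A (2 * (μ + η / 4)) ι := by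
    refine ⟨G, q, hG, fun m => hq (heA m), hl, fun a ha => ?_⟩
    obtain ⟨i, rfl⟩ := hq ha
    exact ⟨i, i, Or.inr rfl, by simpa using hl⟩
  obtain ⟨G, q, hG, hq, hl, hA⟩ := hN.toFin hM
  have hlow : 2 * μ ≤ glen2 G q := by
    have h1 := (hmin _ (netset_compact G q) (netset_connected hG q).isPreconnected (fun m => by
      obtain ⟨i, hi⟩ := hq m
      rw [← hi]; exact netset_vertex G q i)).trans (netset_measure G q)
    have h2 := ENNReal.toReal_le_of_le_ofReal (by have := glen2_nonneg G q; positivity) h1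
    linarith
  refine ⟨G, q, hG, hq, hl.trans (by linarith), fun z hz => ?_⟩
  obtain ⟨a, ha, hza⟩ := mem_iUnion₂.1 (hA0c hz)
  obtain ⟨i, j, hij, h⟩ := hA a (by simp [A, ha])
  rw [Metric.mem_ball] at hza
  refine ⟨i, j, hij, ?_⟩
  have t1 := dist_triangle (q i) a z
  have t2 := dist_triangle z a (q j)
  rw [dist_comm a z] at t1
  linarith

/-- limit of a sequence of minimal trees along an ultrafilter -/
lemma limit_tree [ProperSpace V] [StrictConvexSpace ℝ V] (u : Ultrafilter ℕ) (hu : (u : Filter ℕ) ≤ atTop)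
    {M : ℕ} (hM : 1 ≤ M) (e : ℕ → Fin M → V) (es : Fin M → V) (he : ∀ m, Tendsto (fun n => e n m) u (𝓝 (es m)))
    (R C : ℝ) (hR : ∀ n m, ‖e n m‖ ≤ R) (T : ℕ → Set V) (hT : ∀ n, IsCompact (T n))
    (hc : ∀ n, IsPreconnected (T n)) (hC0 : 0 ≤ C) (hC : ∀ n, Measure.hausdorffMeasure 1 (T n) ≤ ENNReal.ofReal C)
    (heT : ∀ n m, e n m ∈ T n)
    (hmin : ∀ n, ∀ S, IsCompact S → IsPreconnected S → (∀ m, e n m ∈ S) →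
      Measure.hausdorffMeasure 1 (T n) ≤ Measure.hausdorffMeasure 1 S) :
    ∃ (G : SimpleGraph (Fin (2 * M))) (q : Fin (2 * M) → V), G.Connected ∧ (∀ m, ∃ i, q i = es m) ∧
      (∀ ε > 0, ∀ᶠ n in u, glen2 G q / 2 ≤ (Measure.hausdorffMeasure 1 (T n)).toReal + ε) ∧
      (∀ ε > 0, ∀ᶠ n in u, ∀ z ∈ T n, Metric.infDist z (netset G q) < ε) := by
  classical
  have hm : ∀ n, Measure.hausdorffMeasure 1 (T n) ≠ ∞ := fun n =>
    ne_top_of_le_ne_top ENNReal.ofReal_ne_top (hC n)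
  have hη : ∀ n : ℕ, 0 < (1:ℝ) / (n + 1) := fun n => by positivity
  choose Gn qn hGn hqn hln hzn using fun n => near_net hM (e n) (hT n) (hc n) (hm n) (heT n) (hmin n) _ (hη n)
  have hη0 : Tendsto (fun n : ℕ => (1:ℝ) / (n + 1)) u (𝓝 0) :=
    tendsto_one_div_add_atTop_nhds_zero_nat.mono_left hu
  have hmu : ∀ n, (Measure.hausdorffMeasure 1 (T n)).toReal ≤ C := fun n =>
    ENNReal.toReal_le_of_le_ofReal hC0 (hC n)
  have hη1 : ∀ n : ℕ, (1:ℝ) / (n + 1) ≤ 1 := fun n => by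
    rw [div_le_one (by positivity)]; linarith [Nat.cast_nonneg (α := ℝ) n]
  have hqb : ∀ n i, ‖qn n i‖ ≤ R + (C + 1) := by
    intro n i
    obtain ⟨j, hj⟩ := hqn n ⟨0, hM⟩
    have h1 := (conn_len (netset_connected (hGn n) (qn n)).isPreconnected (netset_vertex (Gn n) (qn n) i)
      (netset_vertex (Gn n) (qn n) j)).trans (netset_measure (Gn n) (qn n))
    have h2 := (ENNReal.ofReal_le_ofReal_iff (by have := glen2_nonneg (Gn n) (qn n); positivity)).1 h1
    have h3 := hln n
    have h4 := hR n ⟨0, hM⟩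
    rw [hj, dist_eq_norm] at h2
    have h5 : ‖qn n i‖ ≤ ‖qn n i - e n ⟨0, hM⟩‖ + ‖e n ⟨0, hM⟩‖ := by
      simpa using norm_add_le (qn n i - e n ⟨0, hM⟩) (e n ⟨0, hM⟩)
    have := hmu n
    have := hη1 n
    linarith
  have hTb : ∀ n, ∀ z ∈ T n, ‖z‖ ≤ R + C := by
    intro n z hz
    have h1 := (conn_len (hc n) hz (heT n ⟨0, hM⟩)).trans (hC n)
    have h2 := (ENNReal.ofReal_le_ofReal_iff hC0).1 h1
    have h4 := hR n ⟨0, hM⟩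
    rw [dist_eq_norm] at h2
    have h5 : ‖z‖ ≤ ‖z - e n ⟨0, hM⟩‖ + ‖e n ⟨0, hM⟩‖ := by
      simpa using norm_add_le (z - e n ⟨0, hM⟩) (e n ⟨0, hM⟩)
    linarith
  obtain ⟨G, hG⟩ := ultra_const u Gn
  choose q hq using fun i => ultra_lim u (fun n => qn n i) _ (Eventually.of_forall fun n => hqb n i)
  have hGc : G.Connected := by
    obtain ⟨n, hn⟩ := hG.exists
    rw [← hn]; exact hGn n
  refine ⟨G, q, hGc, ?_, ?_, ?_⟩
  · intro m
    choose f hf using fun n => hqn n m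
    obtain ⟨i, hi⟩ := ultra_const u f
    refine ⟨i, tendsto_nhds_unique (hq i) ((he m).congr' ?_)⟩
    filter_upwards [hi] with n hn
    rw [← hf n, hn]
  · intro ε hε
    have h1 : Tendsto (fun n => glen2 G (qn n)) u (𝓝 (glen2 G q)) := by
      unfold glen2
      refine tendsto_finsetSum _ fun i _ => tendsto_finsetSum _ fun j _ => ?_
      split_ifs
      · exact (hq i).dist (hq j)
      · exact tendsto_const_nhds
    have h2 := h1.eventually (lt_mem_nhds (show glen2 G q - ε < glen2 G q by linarith))
    have h3 := hη0.eventually (gt_mem_nhds (show (0:ℝ) < ε / 2 by positivity))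
    filter_upwards [h2, h3, hG] with n h2 h3 hn
    have := hln n
    rw [hn] at this
    linarith
  · intro ε hε
    by_contra hcon
    rw [← Ultrafilter.eventually_not] at hcon
    push Not at hcon
    have : ∀ n, ∃ z, (∃ z ∈ T n, ε ≤ Metric.infDist z (netset G q)) → (z ∈ T n ∧ ε ≤ Metric.infDist z (netset G q)) := by
      intro n
      by_cases h : ∃ z ∈ T n, ε ≤ Metric.infDist z (netset G q)
      · obtain ⟨z, hz⟩ := h
        exact ⟨z, fun _ => hz⟩
      · exact ⟨0, fun h' => absurd h' h⟩
    choose z hz using this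
    have hz' : ∀ᶠ n in u, z n ∈ T n ∧ ε ≤ Metric.infDist (z n) (netset G q) := by
      filter_upwards [hcon] with n hn
      exact hz n hn
    obtain ⟨zs, hzs⟩ := ultra_lim u z (R + C) (by
      filter_upwards [hz'] with n hn
      exact hTb n _ hn.1)
    have h4 : ∃ i j, ∀ᶠ n in u, ((Gn n).Adj i j ∨ i = j) ∧
        dist (qn n i) (z n) + dist (z n) (qn n j) ≤ dist (qn n i) (qn n j) + 1 / (n + 1) := by
      have : ∀ n, ∃ p : Fin (2 * M) × Fin (2 * M), z n ∈ T n → ((Gn n).Adj p.1 p.2 ∨ p.1 = p.2) ∧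
        dist (qn n p.1) (z n) + dist (z n) (qn n p.2) ≤ dist (qn n p.1) (qn n p.2) + 1 / (n + 1) := by
        intro n
        by_cases h : z n ∈ T n
        · obtain ⟨i, j, h1, h2⟩ := hzn n (z n) h
          exact ⟨(i, j), fun _ => ⟨h1, h2⟩⟩
        · exact ⟨(⟨0, by omega⟩, ⟨0, by omega⟩), fun h' => absurd h' h⟩
      choose p hp using this
      obtain ⟨a, ha⟩ := ultra_const u p
      refine ⟨a.1, a.2, ?_⟩
      filter_upwards [ha, hz'] with n hn hn'
      have := hp n hn'.1
      rwa [hn] at this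
    obtain ⟨i, j, hij⟩ := h4
    have h5 : G.Adj i j ∨ i = j := by
      obtain ⟨n, hn, hn'⟩ := (hij.and hG).exists
      rw [← hn']; exact hn.1
    have h6 : dist (q i) zs + dist zs (q j) ≤ dist (q i) (q j) + 0 := by
      refine le_of_tendsto_of_tendsto (((hq i).dist hzs).add (hzs.dist (hq j)))
        (((hq i).dist (hq j)).add hη0) ?_
      filter_upwards [hij] with n hn
      exact hn.2
    have h7 : zs ∈ netset G q := by
      rw [mem_netset]
      refine ⟨i, j, h5, ?_⟩
      rw [mem_segment_iff_wbtw, ← dist_add_dist_eq_iff]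
      have := dist_triangle (q i) zs (q j)
      linarith
    have h8 : ε ≤ Metric.infDist zs (netset G q) := by
      refine ge_of_tendsto (((Metric.continuous_infDist_pt _).tendsto zs).comp hzs) ?_
      filter_upwards [hz'] with n hn
      exact hn.2
    rw [Metric.infDist_zero_of_mem h7] at h8
    linarith

end Limit

section Conic

variable {V : Type} [NormedAddCommGroup V] [NormedSpace ℝ V] [MeasurableSpace V] [BorelSpace V]

/-- normalization -/
noncomputable def nrm (v : V) : V := ‖v‖⁻¹ • v

lemma nrm_norm {v : V} (hv : v ≠ 0) : ‖nrm v‖ = 1 := by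
  rw [nrm, norm_smul, norm_inv, norm_norm, inv_mul_cancel₀ (norm_ne_zero_iff.2 hv)]

lemma nrm_smul {v : V} {t : ℝ} (ht : 0 < t) : nrm (t • v) = nrm v := by
  rw [nrm, nrm, norm_smul, Real.norm_of_nonneg ht.le, smul_smul, mul_inv]
  congr 1; field_simp

lemma norm_smul_nrm (v : V) : ‖v‖ • nrm v = v := by
  by_cases h : v = 0
  · simp [h]
  rw [nrm, smul_smul, mul_inv_cancel₀ (norm_ne_zero_iff.2 h), one_smul]

lemma nrm_of_unit {v : V} (h : ‖v‖ = 1) : nrm v = v := by rw [nrm, h]; simp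

/-- `N` looks like a cone over the finite direction set `D` near `c` -/
def Conic (c : V) (N : Set V) (D : Set V) (r : ℝ) : Prop :=
  D.Finite ∧ 0 < r ∧ (∀ d ∈ D, ‖d‖ = 1) ∧
    ∀ z, z ≠ c → ‖z - c‖ ≤ r → (z ∈ N ↔ nrm (z - c) ∈ D)

lemma Conic.union {c : V} {N N' D D' : Set V} {r r' : ℝ} (h : Conic c N D r) (h' : Conic c N' D' r') :
    Conic c (N ∪ N') (D ∪ D') (min r r') := by
  obtain ⟨h1, h2, h3, h4⟩ := h
  obtain ⟨h1', h2', h3', h4'⟩ := h'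
  refine ⟨h1.union h1', lt_min h2 h2', ?_, fun z hz hr => ?_⟩
  · rintro d (hd | hd)
    exacts [h3 d hd, h3' d hd]
  · rw [mem_union, mem_union, h4 z hz (hr.trans (min_le_left _ _)), h4' z hz (hr.trans (min_le_right _ _))]

lemma Conic.mono {c : V} {N D : Set V} {r r' : ℝ} (h : Conic c N D r) (h0 : 0 < r') (hr : r' ≤ r) :
    Conic c N D r' := ⟨h.1, h0, h.2.2.1, fun z hz hz' => h.2.2.2 z hz (hz'.trans hr)⟩

lemma conic_leg (c p : V) : ∃ D r, Conic c (segment ℝ c p) D r := by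
  by_cases hp : p = c
  · refine ⟨∅, 1, finite_empty, one_pos, by simp, fun z hz _ => ?_⟩
    simp [hp, hz]
  have hpc : p - c ≠ 0 := sub_ne_zero.2 hp
  have hn : 0 < ‖p - c‖ := norm_pos_iff.2 hpc
  refine ⟨{nrm (p - c)}, ‖p - c‖, finite_singleton _, hn, ?_, ?_⟩
  · simpa using nrm_norm hpc
  · intro z hz hr
    have hzc : 0 < ‖z - c‖ := norm_pos_iff.2 (sub_ne_zero.2 hz)
    rw [mem_singleton_iff]
    constructor
    · rw [segment_eq_image']
      rintro ⟨t, ⟨ht0, ht1⟩, rfl⟩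
      have : t ≠ 0 := by rintro rfl; simp at hz
      rw [add_sub_cancel_left]
      exact nrm_smul (lt_of_le_of_ne ht0 this.symm)
    · intro h
      rw [segment_eq_image']
      refine ⟨‖z - c‖ / ‖p - c‖, ⟨by positivity, (div_le_one hn).2 hr⟩, ?_⟩
      have h1 : (‖z - c‖ / ‖p - c‖) • (p - c) = z - c := by
        have h2 := norm_smul_nrm (z - c)
        rw [h, nrm, smul_smul, ← div_eq_mul_inv] at h2
        exact h2
      simp only [h1]; abel

lemma segment_split {x y c : V} (hc : c ∈ segment ℝ x y) :
    segment ℝ x y = segment ℝ c x ∪ segment ℝ c y := by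
  refine subset_antisymm ?_ (union_subset ?_ ?_)
  · rw [segment_eq_image_lineMap] at hc
    obtain ⟨s, hs, rfl⟩ := hc
    intro z hz
    rw [segment_eq_image_lineMap] at hz
    obtain ⟨t, ht, rfl⟩ := hz
    rcases le_total t s with h | h
    · left
      rw [segment_symm, mem_segment_iff_wbtw]
      by_cases hs0 : s = 0
      · have : t = 0 := le_antisymm (hs0 ▸ h) ht.1
        subst hs0 this
        simp
      have hs0' : 0 < s := lt_of_le_of_ne hs.1 (Ne.symm hs0)
      refine ⟨t / s, ⟨div_nonneg ht.1 hs.1, (div_le_one hs0').2 h⟩, ?_⟩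
      simp only [AffineMap.lineMap_apply_module']
      rw [add_sub_cancel_right, smul_smul, div_mul_cancel₀ _ hs0]
    · right
      rw [mem_segment_iff_wbtw]
      by_cases hs1 : s = 1
      · have : t = 1 := le_antisymm ht.2 (hs1 ▸ h)
        subst hs1 this
        simp
      have hs1' : 0 < 1 - s := sub_pos.2 (lt_of_le_of_ne hs.2 hs1)
      refine ⟨(t - s) / (1 - s), ⟨div_nonneg (sub_nonneg.2 h) hs1'.le, (div_le_one hs1').2 (by linarith [ht.2])⟩, ?_⟩
      simp only [AffineMap.lineMap_apply_module']
      have : y - (s • (y - x) + x) = (1 - s) • (y - x) := by module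
      rw [this, smul_smul, div_mul_cancel₀ _ hs1'.ne']
      module
  · exact (convex_segment _ _).segment_subset hc (left_mem_segment ℝ _ _)
  · exact (convex_segment _ _).segment_subset hc (right_mem_segment ℝ _ _)

lemma conic_of_notMem {c : V} {N : Set V} (hN : IsClosed N) (hc : c ∉ N) : ∃ D r, Conic c N D r := by
  obtain ⟨ε, hε, h⟩ := Metric.isOpen_iff.1 hN.isOpen_compl c hc
  refine ⟨∅, ε / 2, finite_empty, by positivity, by simp, fun z _ hz => ?_⟩
  have : z ∈ Nᶜ := h (by rw [Metric.mem_ball, dist_eq_norm]; linarith)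
  simpa using this

lemma conic_segment (c x y : V) : ∃ D r, Conic c (segment ℝ x y) D r := by
  by_cases hc : c ∈ segment ℝ x y
  · rw [segment_split hc]
    obtain ⟨D, r, h⟩ := conic_leg c x
    obtain ⟨D', r', h'⟩ := conic_leg c y
    exact ⟨_, _, h.union h'⟩
  · exact conic_of_notMem (segment_compact x y).isClosed hc

lemma conic_iUnion {ι : Type} [Finite ι] (c : V) (N : ι → Set V) (h : ∀ i, ∃ D r, Conic c (N i) D r) :
    ∃ D r, Conic c (⋃ i, N i) D r := by
  classical
  cases nonempty_fintype ι
  have : ∀ s : Finset ι, ∃ D r, Conic c (⋃ i ∈ s, N i) D r := by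
    intro s
    induction s using Finset.induction_on with
    | empty => simpa using conic_of_notMem (c := c) isClosed_empty (notMem_empty _)
    | insert i s _ ih =>
      obtain ⟨D, r, hD⟩ := h i
      obtain ⟨D', r', hD'⟩ := ih
      rw [Finset.set_biUnion_insert]
      exact ⟨_, _, hD.union hD'⟩
  simpa using this Finset.univ

lemma conic_netset {ι : Type} [Finite ι] (c : V) (G : SimpleGraph ι) (q : ι → V) :
    ∃ D r, Conic c (netset G q) D r := by
  refine conic_iUnion c _ fun i => conic_iUnion c _ fun j => ?_
  by_cases h : G.Adj i j ∨ i = j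
  · simp only [h, iUnion_true]; exact conic_segment _ _ _
  · simp only [h, iUnion_false]; exact conic_of_notMem isClosed_empty (notMem_empty _)

lemma Conic.leg_mem {c : V} {N D : Set V} {r : ℝ} (h : Conic c N D r) {d : V} (hd : d ∈ D) {t : ℝ}
    (ht0 : 0 < t) (ht : t ≤ r) : c + t • d ∈ N := by
  have hd1 := h.2.2.1 d hd
  have hd0 : d ≠ 0 := by rintro rfl; simp at hd1
  refine (h.2.2.2 _ ?_ ?_).2 ?_
  · simpa using ⟨ht0.ne', hd0⟩
  · rw [add_sub_cancel_left, norm_smul, hd1, Real.norm_of_nonneg ht0.le]; simpa using ht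
  · rw [add_sub_cancel_left, nrm_smul ht0, nrm_of_unit hd1]; exact hd

/-- a leg -/
def leg (c d : V) (r : ℝ) : Set V := segment ℝ c (c + r • d)

lemma mem_leg {c d : V} {r : ℝ} (hr : 0 ≤ r) {z : V} : z ∈ leg c d r ↔ ∃ t, 0 ≤ t ∧ t ≤ r ∧ z = c + t • d := by
  rw [leg, segment_eq_image']
  simp only [add_sub_cancel_left]
  constructor
  · rintro ⟨t, ⟨h0, h1⟩, rfl⟩
    exact ⟨t * r, by positivity, by nlinarith, by simp only [smul_smul]⟩
  · rintro ⟨t, h0, h1, rfl⟩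
    rcases hr.eq_or_lt with rfl | hr
    · exact ⟨0, by simp, by simp [le_antisymm h1 h0]⟩
    · exact ⟨t / r, ⟨by positivity, (div_le_one hr).2 h1⟩, by
        simp only [smul_smul]; rw [div_mul_cancel₀ _ hr.ne']⟩

lemma Conic.leg_subset {c : V} {N D : Set V} {r : ℝ} (h : Conic c N D r) (hc : c ∈ N) {d : V} (hd : d ∈ D)
    {s : ℝ} (hs0 : 0 ≤ s) (hs : s ≤ r) : leg c d s ⊆ N ∩ Metric.closedBall c s := by
  intro z hz
  obtain ⟨t, h0, h1, rfl⟩ := (mem_leg hs0).1 hz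
  refine ⟨?_, ?_⟩
  · rcases h0.eq_or_lt with rfl | h0
    · simpa using hc
    · exact h.leg_mem hd h0 (h1.trans hs)
  · rw [Metric.mem_closedBall, dist_eq_norm, add_sub_cancel_left, norm_smul, h.2.2.1 d hd,
      Real.norm_of_nonneg h0]; simpa using h1

lemma Conic.sphere {c : V} {N D : Set V} {r : ℝ} (h : Conic c N D r) {s : ℝ} (hs0 : 0 < s) (hs : s ≤ r)
    {z : V} (hz : z ∈ N) (hzs : ‖z - c‖ = s) : ∃ d ∈ D, z = c + s • d := by
  have hzc : z ≠ c := by rintro rfl; simp at hzs; exact hs0.ne hzs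
  refine ⟨_, (h.2.2.2 z hzc (hzs.trans_le hs)).1 hz, ?_⟩
  rw [← hzs, norm_smul_nrm]; abel

lemma leg_inter {c d d' : V} (h1 : ‖d‖ = 1) (h1' : ‖d'‖ = 1) (hne : d ≠ d') {r r' : ℝ} (hr : 0 ≤ r) (hr' : 0 ≤ r') :
    leg c d r ∩ leg c d' r' ⊆ {c} := by
  rintro z ⟨hz, hz'⟩
  obtain ⟨t, h0, _, rfl⟩ := (mem_leg hr).1 hz
  obtain ⟨t', h0', _, h⟩ := (mem_leg hr').1 hz'
  have h2 : t • d = t' • d' := by simpa using h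
  have h3 : t = t' := by
    have := congrArg norm h2
    rwa [norm_smul, norm_smul, h1, h1', Real.norm_of_nonneg h0, Real.norm_of_nonneg h0', mul_one, mul_one] at this
  subst h3
  by_cases ht : t = 0
  · simp [ht]
  · exact absurd (smul_right_injective V ht h2) hne

end Conic

section Surgery

variable {V : Type} [NormedAddCommGroup V] [NormedSpace ℝ V] [MeasurableSpace V] [BorelSpace V]

/-- locally conic minimizer -/
structure LM (N E D : Set V) (c : V) (r : ℝ) : Prop where
  comp : IsCompact N
  conn : IsPreconnected N
  fin : Measure.hausdorffMeasure 1 N ≠ ∞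
  sub : E ⊆ N
  min : ∀ S, IsCompact S → IsPreconnected S → E ⊆ S →
    Measure.hausdorffMeasure 1 N ≤ Measure.hausdorffMeasure 1 S
  cN : c ∈ N
  far : ∀ e ∈ E, r ≤ ‖e - c‖
  con : Conic c N D r

lemma LM.surgery {N E D : Set V} {c : V} {r : ℝ} (h : LM N E D c r) {S : Set V} (hS : IsCompact S)
    (hSc : IsPreconnected S) (hD : ∀ d ∈ D, c + r • d ∈ S) :
    Measure.hausdorffMeasure 1 (N ∩ Metric.closedBall c r) ≤ Measure.hausdorffMeasure 1 S := by
  have hr : 0 < r := h.con.2.1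
  have hsub : N ∩ Metric.sphere c r ⊆ (fun d => c + r • d) '' D := by
    rintro z ⟨hz, hz'⟩
    rw [mem_sphere_iff_norm] at hz'
    obtain ⟨d, hd, rfl⟩ := h.con.sphere hr le_rfl hz hz'
    exact ⟨d, hd, rfl⟩
  have hsphS : N ∩ Metric.sphere c r ⊆ S := fun z hz => by
    obtain ⟨d, hd, rfl⟩ := hsub hz
    exact hD d hd
  have hfin : (N ∩ Metric.sphere c r).Finite := (h.con.1.image _).subset hsub
  have h0 : Measure.hausdorffMeasure 1 (N ∩ Metric.sphere c r) = 0 := by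
    haveI : NullSingletonClass (Measure.hausdorffMeasure 1 : Measure V) :=
      Measure.nullSingletonClass_hausdorff V (by norm_num)
    exact hfin.measure_zero _
  have hXc : IsClosed (N \ Metric.ball c r) := h.comp.isClosed.sdiff Metric.isOpen_ball
  have hYc : IsClosed (N ∩ Metric.closedBall c r) := h.comp.isClosed.inter Metric.isClosed_closedBall
  have hpre : IsPreconnected (N \ Metric.ball c r ∪ S) := by
    refine glue (B := N ∩ Metric.closedBall c r) ?_ hSc ⟨c, h.cN, by simp [hr.le]⟩ hXc hYc hS.isClosed ?_
    · convert h.conn using 1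
      ext z
      simp only [mem_union, mem_diff, mem_inter_iff, Metric.mem_ball, Metric.mem_closedBall]
      constructor
      · tauto
      · intro hz
        rcases lt_or_ge (dist z c) r with h | h
        · exact Or.inr ⟨hz, h.le⟩
        · exact Or.inl ⟨hz, not_lt.2 h⟩
    · rintro z ⟨⟨h1, h2⟩, _, h3⟩
      refine hsphS ⟨h1, ?_⟩
      rw [Metric.mem_ball, not_lt] at h2
      exact le_antisymm h3 h2
  have hcomp : IsCompact (N \ Metric.ball c r ∪ S) := (h.comp.diff Metric.isOpen_ball).union hS
  have h1 := h.min _ hcomp hpre (fun e he => Or.inl ⟨h.sub he, fun hb => by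
    rw [mem_ball_iff_norm] at hb
    exact absurd (h.far e he) (not_le.2 hb)⟩)
  have h2 := h1.trans (measure_union_le _ _)
  have h3 : Measure.hausdorffMeasure 1 N = Measure.hausdorffMeasure 1 (N ∩ Metric.ball c r) +
      Measure.hausdorffMeasure 1 (N \ Metric.ball c r) :=
    (measure_inter_add_diff N Metric.isOpen_ball.measurableSet).symm
  rw [h3, add_comm] at h2
  have h4 := (ENNReal.add_le_add_iff_left (ne_top_of_le_ne_top h.fin (measure_mono diff_subset))).1 h2
  calc Measure.hausdorffMeasure 1 (N ∩ Metric.closedBall c r)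
      ≤ Measure.hausdorffMeasure 1 ((N ∩ Metric.ball c r) ∪ (N ∩ Metric.sphere c r)) := by
        refine measure_mono fun z hz => ?_
        rw [← inter_union_distrib_left, Metric.ball_union_sphere]
        exact hz
    _ ≤ Measure.hausdorffMeasure 1 (N ∩ Metric.ball c r) + Measure.hausdorffMeasure 1 (N ∩ Metric.sphere c r) :=
      measure_union_le _ _
    _ ≤ _ := by rw [h0, add_zero]; exact h4

lemma leg_measure {c d : V} (hd : ‖d‖ = 1) {r : ℝ} (hr : 0 ≤ r) :
    Measure.hausdorffMeasure 1 (leg c d r) = ENNReal.ofReal r := by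
  rw [leg, seg_len]
  congr 1
  rw [dist_eq_norm, sub_add_cancel_left, norm_neg, norm_smul, hd, mul_one, Real.norm_of_nonneg hr]

lemma singleton_measure (c : V) : Measure.hausdorffMeasure 1 ({c} : Set V) = 0 := by
  rw [← segment_same ℝ c, seg_len]; simp

lemma LM.slide {N E D : Set V} {c : V} {r : ℝ} (h : LM N E D c r) {d1 d2 : V} (hd1 : d1 ∈ D) (hd2 : d2 ∈ D)
    (hne : d1 ≠ d2) {t : ℝ} (ht0 : 0 ≤ t) (ht1 : t ≤ 1) : 1 ≤ ‖d1 - t • d2‖ := by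
  have hr : 0 < r := h.con.2.1
  let A : Set V := ⋃ d ∈ D \ {d1}, leg c d r
  have hDf : (D \ {d1}).Finite := h.con.1.subset diff_subset
  have hAc : IsCompact A := hDf.isCompact_biUnion fun d _ => segment_compact _ _
  have hAp : IsPreconnected A := by
    have hA2 : A = ⋃₀ ((fun d => leg c d r) '' (D \ {d1})) := by rw [sUnion_image]
    rw [hA2]
    refine isPreconnected_sUnion c _ ?_ ?_
    · rintro _ ⟨d, _, rfl⟩; exact left_mem_segment ℝ _ _
    · rintro _ ⟨d, _, rfl⟩; exact (convex_segment _ _).isPreconnected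
  have hd2A : d2 ∈ D \ {d1} := ⟨hd2, hne.symm⟩
  have hpA : c + (r * t) • d2 ∈ A := mem_iUnion₂.2 ⟨d2, hd2A, (mem_leg hr.le).2
    ⟨r * t, by positivity, by nlinarith, rfl⟩⟩
  have hAN : A ⊆ N ∩ Metric.closedBall c r := iUnion₂_subset fun d hd => h.con.leg_subset h.cN hd.1 hr.le le_rfl
  have h1 := h.surgery (S := A ∪ segment ℝ (c + (r * t) • d2) (c + r • d1)) (hAc.union (segment_compact _ _))
    (hAp.union _ hpA (left_mem_segment ℝ _ _) (convex_segment _ _).isPreconnected) (by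
      intro d hd
      by_cases hdd : d = d1
      · right; rw [hdd]; exact right_mem_segment ℝ _ _
      · left; exact mem_iUnion₂.2 ⟨d, ⟨hd, hdd⟩, right_mem_segment ℝ _ _⟩)
  have hinter : Measure.hausdorffMeasure 1 (A ∩ leg c d1 r) = 0 := by
    refine measure_mono_null (t := {c}) ?_ (singleton_measure c)
    rintro z ⟨hz, hz'⟩
    obtain ⟨d, hd, hz⟩ := mem_iUnion₂.1 hz
    exact leg_inter (h.con.2.2.1 d hd.1) (h.con.2.2.1 d1 hd1) hd.2 hr.le hr.le ⟨hz, hz'⟩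
  have h2 := measure_union_add_inter (μ := (Measure.hausdorffMeasure 1 : Measure V)) A
    (segment_compact c (c + r • d1)).isClosed.measurableSet
  change _ + Measure.hausdorffMeasure 1 (A ∩ leg c d1 r) = _ + Measure.hausdorffMeasure 1 (leg c d1 r) at h2
  rw [hinter, add_zero, leg_measure (h.con.2.2.1 d1 hd1) hr.le] at h2
  have h3 : A ∪ leg c d1 r ⊆ N ∩ Metric.closedBall c r :=
    union_subset hAN (h.con.leg_subset h.cN hd1 hr.le le_rfl)
  have h4 := ((measure_mono h3).trans h1).trans (measure_union_le _ _)
  change Measure.hausdorffMeasure 1 (A ∪ segment ℝ c (c + r • d1)) ≤ _ at h4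
  rw [h2, seg_len] at h4
  have hAfin : Measure.hausdorffMeasure 1 A ≠ ∞ :=
    ne_top_of_le_ne_top h.fin (measure_mono (hAN.trans inter_subset_left))
  have h5 := (ENNReal.ofReal_le_ofReal_iff dist_nonneg).1 ((ENNReal.add_le_add_iff_left hAfin).1 h4)
  have h6 : dist (c + (r * t) • d2) (c + r • d1) = r * ‖d1 - t • d2‖ := by
    rw [dist_comm, dist_eq_norm, show c + r • d1 - (c + (r * t) • d2) = r • (d1 - t • d2) by module,
      norm_smul, Real.norm_of_nonneg hr.le]
  rw [h6] at h5
  exact le_of_mul_le_mul_left (by simpa using h5) hr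

lemma LM.slide' {N E D : Set V} {c : V} {r : ℝ} (h : LM N E D c r) {d1 d2 : V} (hd1 : d1 ∈ D) (hd2 : d2 ∈ D)
    (hne : d1 ≠ d2) {t : ℝ} (ht0 : 0 ≤ t) : 1 ≤ ‖d1 - t • d2‖ := by
  rcases le_or_gt t 1 with ht | ht
  · exact h.slide hd1 hd2 hne ht0 ht
  · have h1 := h.slide hd2 hd1 hne.symm (t := t⁻¹) (by positivity) (inv_le_one_of_one_le₀ ht.le)
    have h2 : ‖d1 - t • d2‖ = t * ‖d2 - t⁻¹ • d1‖ := by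
      rw [← Real.norm_of_nonneg ht0, ← norm_smul, Real.norm_of_nonneg ht0, smul_sub, smul_smul,
        mul_inv_cancel₀ (by positivity), one_smul, norm_sub_rev]
    rw [h2]; nlinarith

lemma LM.no_cone [StrictConvexSpace ℝ V] {N E D : Set V} {c : V} {r : ℝ} (h : LM N E D c r) {d1 d2 d3 : V}
    (hd1 : d1 ∈ D) (hd2 : d2 ∈ D) (hd3 : d3 ∈ D) (h12 : d1 ≠ d2) (h32 : d3 ≠ d2) {α β : ℝ} (hα : 0 < α)
    (hβ : 0 < β) : d2 ≠ α • d1 + β • d3 := by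
  intro heq
  have n1 := h.con.2.2.1 d1 hd1
  have n2 := h.con.2.2.1 d2 hd2
  have n3 := h.con.2.2.1 d3 hd3
  have f1 : ∀ t : ℝ, 0 ≤ t → α ≤ ‖α • d1 - t • d2‖ := by
    intro t ht
    have h1 := h.slide' hd1 hd2 h12 (t := t / α) (by positivity)
    have h2 : α • d1 - t • d2 = α • (d1 - (t / α) • d2) := by
      rw [smul_sub, smul_smul, mul_div_cancel₀ _ hα.ne']
    rw [h2, norm_smul, Real.norm_of_nonneg hα.le]
    nlinarith
  have f2 : ∀ t : ℝ, t ≤ 1 → β ≤ ‖α • d1 - t • d2‖ := by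
    intro t ht
    have h1 := h.slide' hd3 hd2 h32 (t := (1 - t) / β) (div_nonneg (by linarith) hβ.le)
    have h2 : α • d1 - t • d2 = (-β) • (d3 - ((1 - t) / β) • d2) := by
      rw [smul_sub, smul_smul, show -β * ((1 - t) / β) = -(1 - t) by field_simp]
      have : α • d1 = d2 - β • d3 := by rw [heq]; abel
      rw [this]; module
    rw [h2, norm_smul, norm_neg, Real.norm_of_nonneg hβ.le]
    nlinarith
  have g0 : ‖α • d1‖ = α := by rw [norm_smul, n1, Real.norm_of_nonneg hα.le, mul_one]
  have e1 : α • d1 - d2 = -(β • d3) := by rw [heq]; abel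
  have g1 : ‖α • d1 - d2‖ = β := by
    rw [e1, norm_neg, norm_smul, n3, Real.norm_of_nonneg hβ.le, mul_one]
  have hab : α = β := by
    have := f1 1 zero_le_one
    have := f2 0 zero_le_one
    simp only [one_smul, zero_smul, sub_zero, g0, g1] at *
    linarith
  have hlt := (norm_midpoint_lt_iff (x := α • d1) (y := α • d1 - d2) (by rw [g0, g1, hab])).2 (by
    intro hh
    have : d2 = 0 := by simpa using hh.symm
    rw [this] at n2; simp at n2)
  have h3 := f1 (1/2) (by norm_num)
  have h4 : (1 / 2 : ℝ) • (α • d1 + (α • d1 - d2)) = α • d1 - (1/2 : ℝ) • d2 := by module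
  rw [h4, g0] at hlt
  linarith

lemma LM.two_dirs {N E D : Set V} {c : V} {r : ℝ} (h : LM N E D c r) (hE : E.Nonempty) :
    ∃ d1 ∈ D, ∃ d2 ∈ D, d1 ≠ d2 := by
  have hr : 0 < r := h.con.2.1
  obtain ⟨e, he⟩ := hE
  have h1 : ∃ z ∈ N, ‖z - c‖ = r := by
    have := h.conn.intermediate_value h.cN (h.sub he) (f := fun z => ‖z - c‖) (by fun_prop)
    obtain ⟨z, hz, hz'⟩ := this (show r ∈ Icc _ _ from ⟨by simp [hr.le], h.far e he⟩)
    exact ⟨z, hz, hz'⟩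
  obtain ⟨z, hz, hzr⟩ := h1
  obtain ⟨d, hd, rfl⟩ := h.con.sphere hr le_rfl hz hzr
  refine ⟨d, hd, ?_⟩
  by_contra hcon
  push Not at hcon
  have h2 := h.surgery (S := {c + r • d}) isCompact_singleton isPreconnected_singleton (fun d' hd' => by
    rw [hcon d' hd']; simp)
  rw [singleton_measure] at h2
  have h3 := (measure_mono (h.con.leg_subset h.cN hd hr.le le_rfl)).trans h2
  rw [leg_measure (h.con.2.2.1 d hd) hr.le] at h3
  simp at h3
  linarith

lemma LM.antipodal [StrictConvexSpace ℝ V] {N E D : Set V} {c : V} {r : ℝ} (h : LM N E D c r) {d1 d2 : V}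
    (hd1 : d1 ∈ D) (hd2 : d2 ∈ D) (hne : d1 ≠ d2) (hD : ∀ d ∈ D, d = d1 ∨ d = d2) : d2 = -d1 := by
  have hr : 0 < r := h.con.2.1
  have n1 := h.con.2.2.1 d1 hd1
  have n2 := h.con.2.2.1 d2 hd2
  have h1 := h.surgery (S := segment ℝ (c + r • d1) (c + r • d2)) (segment_compact _ _)
    (convex_segment _ _).isPreconnected (by
      intro d hd
      rcases hD d hd with rfl | rfl
      · exact left_mem_segment ℝ _ _
      · exact right_mem_segment ℝ _ _)
  have h2 := measure_union_add_inter (μ := (Measure.hausdorffMeasure 1 : Measure V)) (leg c d2 r)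
    (segment_compact c (c + r • d1)).isClosed.measurableSet
  change _ + Measure.hausdorffMeasure 1 (leg c d2 r ∩ leg c d1 r) = _ + Measure.hausdorffMeasure 1 (leg c d1 r) at h2
  rw [measure_mono_null (leg_inter n2 n1 hne.symm hr.le hr.le) (singleton_measure c), add_zero,
    leg_measure n1 hr.le, leg_measure n2 hr.le] at h2
  have h3 : leg c d2 r ∪ leg c d1 r ⊆ N ∩ Metric.closedBall c r :=
    union_subset (h.con.leg_subset h.cN hd2 hr.le le_rfl) (h.con.leg_subset h.cN hd1 hr.le le_rfl)
  have h4 := (measure_mono h3).trans h1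
  change Measure.hausdorffMeasure 1 (leg c d2 r ∪ segment ℝ c (c + r • d1)) ≤ _ at h4
  rw [h2, seg_len, ← ENNReal.ofReal_add hr.le hr.le] at h4
  have h5 := (ENNReal.ofReal_le_ofReal_iff dist_nonneg).1 h4
  have h6 : dist (c + r • d1) (c + r • d2) = r * ‖d1 - d2‖ := by
    rw [dist_eq_norm, show c + r • d1 - (c + r • d2) = r • (d1 - d2) by module,
      norm_smul, Real.norm_of_nonneg hr.le]
  rw [h6] at h5
  have h7 : 2 ≤ ‖d1 - d2‖ := by
    by_contra hlt
    push Not at hlt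
    nlinarith
  by_contra hcon
  have h8 := (norm_midpoint_lt_iff (x := d1) (y := -d2) (by rw [norm_neg, n1, n2])).2 (by
    intro hh; exact hcon (by rw [hh, neg_neg]))
  rw [← sub_eq_add_neg, norm_smul, n1] at h8
  norm_num at h8
  linarith

end Surgery

section Planar

variable {V : Type} [NormedAddCommGroup V] [NormedSpace ℝ V] [MeasurableSpace V] [BorelSpace V]

/-- determinant bracket in coordinates -/
def br (Φ : V ≃L[ℝ] ℝ × ℝ) (x y : V) : ℝ := (Φ x).1 * (Φ y).2 - (Φ x).2 * (Φ y).1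

lemma br_swap (Φ : V ≃L[ℝ] ℝ × ℝ) (x y : V) : br Φ y x = - br Φ x y := by unfold br; ring

lemma br_smul (Φ : V ≃L[ℝ] ℝ × ℝ) (t : ℝ) (x y : V) : br Φ x (t • y) = t * br Φ x y := by
  simp [br]; ring

lemma br_neg (Φ : V ≃L[ℝ] ℝ × ℝ) (x y : V) : br Φ x (-y) = - br Φ x y := by
  simp [br]; ring

lemma br_self (Φ : V ≃L[ℝ] ℝ × ℝ) (x : V) : br Φ x x = 0 := by
  simp [br]; ring

lemma br_identity (Φ : V ≃L[ℝ] ℝ × ℝ) (a b c : V) :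
    br Φ b c • a + br Φ c a • b + br Φ a b • c = 0 := by
  apply Φ.injective
  ext <;> simp [br] <;> ring

lemma unit_of_br_zero (Φ : V ≃L[ℝ] ℝ × ℝ) {x y : V} (hx : ‖x‖ = 1) (hy : ‖y‖ = 1) (h : br Φ x y = 0) :
    y = x ∨ y = -x := by
  have hx0 : Φ x ≠ 0 := by
    intro h0
    have : x = 0 := by simpa using h0
    rw [this] at hx; simp at hx
  have hk : ∃ k : ℝ, y = k • x := by
    unfold br at h
    by_cases h1 : (Φ x).1 = 0
    · have h2 : (Φ x).2 ≠ 0 := fun h2 => hx0 (Prod.ext h1 h2)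
      refine ⟨(Φ y).2 / (Φ x).2, Φ.injective ?_⟩
      ext
      · simp [h1]
        have : (Φ x).2 * (Φ y).1 = 0 := by rw [h1] at h; linarith
        exact (mul_eq_zero.1 this).resolve_left h2
      · simp [h2]
    · refine ⟨(Φ y).1 / (Φ x).1, Φ.injective ?_⟩
      ext
      · simp [h1]
      · simp; field_simp; linarith
  obtain ⟨k, rfl⟩ := hk
  rw [norm_smul, hx, mul_one, Real.norm_eq_abs] at hy
  rcases (abs_eq zero_le_one).1 hy with rfl | rfl
  · left; simp
  · right; simp

/-- no positive cone relation -/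
def NoCone (D : Set V) : Prop := ∀ d1 ∈ D, ∀ d2 ∈ D, ∀ d3 ∈ D, d1 ≠ d2 → d3 ≠ d2 →
  ∀ α β : ℝ, 0 < α → 0 < β → d2 ≠ α • d1 + β • d3

lemma same_side (Φ : V ≃L[ℝ] ℝ × ℝ) {D : Set V} (hD : NoCone D) (hn : ∀ d ∈ D, ‖d‖ = 1) {a b c : V}
    (ha : a ∈ D) (hb : b ∈ D) (hc : c ∈ D) (hab : a ≠ b) (hac : a ≠ c) (hbc : b ≠ c)
    (h : 0 < br Φ a b * br Φ a c) : False := by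
  -- core
  have core : ∀ b c : V, b ∈ D → c ∈ D → a ≠ b → b ≠ c → 0 < br Φ a b * br Φ a c →
      0 < br Φ a c * br Φ b c → False := by
    intro b c hb hc hab hbc h1 h2
    have hid := br_identity Φ a b c
    have hac0 : br Φ a c ≠ 0 := by rintro h0; rw [h0] at h1; simp at h1
    refine hD a ha b hb c hc hab hbc.symm (br Φ b c / br Φ a c) (br Φ a b / br Φ a c) ?_ ?_ ?_
    · rw [div_eq_mul_inv, ← div_eq_mul_inv]
      have : br Φ b c / br Φ a c = (br Φ a c * br Φ b c) / (br Φ a c) ^ 2 := by field_simp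
      rw [this]; positivity
    · have : br Φ a b / br Φ a c = (br Φ a b * br Φ a c) / (br Φ a c) ^ 2 := by field_simp
      rw [this]; positivity
    · have h3 : br Φ a c • b = br Φ b c • a + br Φ a b • c := by
        rw [br_swap Φ a c] at hid
        rw [neg_smul] at hid
        have := eq_of_sub_eq_zero (show br Φ b c • a + br Φ a b • c - br Φ a c • b = 0 by
          rw [← hid]; abel)
        exact this.symm
      have h4 : b = (br Φ a c)⁻¹ • (br Φ a c • b) := by rw [smul_smul, inv_mul_cancel₀ hac0, one_smul]
      rw [h3, smul_add, smul_smul, smul_smul] at h4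
      rw [div_eq_inv_mul, div_eq_inv_mul]
      exact h4
  rcases lt_trichotomy 0 (br Φ a c * br Φ b c) with h1 | h1 | h1
  · exact core b c hb hc hab hbc h h1
  · have hac0 : br Φ a c ≠ 0 := by rintro h0; rw [h0] at h; simp at h
    have h2 : br Φ b c = 0 := (mul_eq_zero.1 h1.symm).resolve_left hac0
    rcases unit_of_br_zero Φ (hn b hb) (hn c hc) h2 with rfl | rfl
    · exact hbc rfl
    · rw [br_neg] at h; nlinarith [sq_nonneg (br Φ a b)]
  · refine core c b hc hb hac hbc.symm (by rwa [mul_comm]) ?_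
    rw [br_swap Φ b c]
    have h0 : br Φ a c ^ 2 > 0 := by
      have hac0 : br Φ a c ≠ 0 := by rintro h0; rw [h0] at h; simp at h
      positivity
    -- sign of ab equals sign of ac
    have h5 : 0 < (br Φ a b * br Φ a c) * (-(br Φ a c * br Φ b c)) := mul_pos h (by linarith)
    have h6 : (br Φ a b * br Φ a c) * (-(br Φ a c * br Φ b c)) = br Φ a c ^ 2 * (br Φ a b * -br Φ b c) := by ring
    rw [h6] at h5
    exact (mul_pos_iff_of_pos_left h0).1 h5

lemma four_dirs (Φ : V ≃L[ℝ] ℝ × ℝ) {D : Set V} (hD : NoCone D) (hn : ∀ d ∈ D, ‖d‖ = 1) {a b c d : V}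
    (ha : a ∈ D) (hb : b ∈ D) (hc : c ∈ D) (hd : d ∈ D) (hab : a ≠ b) (hac : a ≠ c) (had : a ≠ d)
    (hbc : b ≠ c) (hbd : b ≠ d) (hcd : c ≠ d) : -a = b ∨ -a = c ∨ -a = d := by
  by_contra hcon
  push Not at hcon
  have nz : ∀ v ∈ D, a ≠ v → -a ≠ v → br Φ a v ≠ 0 := by
    intro v hv h1 h2 h0
    rcases unit_of_br_zero Φ (hn a ha) (hn v hv) h0 with h | h
    · exact h1 h.symm
    · exact h2 h.symm
  have zb := nz b hb hab hcon.1
  have zc := nz c hc hac hcon.2.1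
  have zd := nz d hd had hcon.2.2
  have s1 := same_side Φ hD hn ha hb hc hab hac hbc
  have s2 := same_side Φ hD hn ha hb hd hab had hbd
  have s3 := same_side Φ hD hn ha hc hd hac had hcd
  rcases lt_or_gt_of_ne zb with h1 | h1 <;> rcases lt_or_gt_of_ne zc with h2 | h2 <;>
    rcases lt_or_gt_of_ne zd with h3 | h3
  all_goals first
    | exact s1 (mul_pos_of_neg_of_neg h1 h2)
    | exact s1 (mul_pos h1 h2)
    | exact s2 (mul_pos_of_neg_of_neg h1 h3)
    | exact s2 (mul_pos h1 h3)
    | exact s3 (mul_pos_of_neg_of_neg h2 h3)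
    | exact s3 (mul_pos h2 h3)

lemma limit_cross [StrictConvexSpace ℝ V] (Φ : V ≃L[ℝ] ℝ × ℝ) {N1 N2 E1 E2 D1 D2 : Set V} {c : V} {r : ℝ}
    (h1 : LM N1 E1 D1 c r) (h2 : LM N2 E2 D2 c r) (hE1 : E1.Nonempty) (hE2 : E2.Nonempty)
    (h12 : ∀ S, IsCompact S → IsPreconnected S → E1 ∪ E2 ⊆ S →
      Measure.hausdorffMeasure 1 N1 + Measure.hausdorffMeasure 1 N2 ≤ Measure.hausdorffMeasure 1 S) :
    ∃ x y : V, br Φ x y ≠ 0 ∧ (∀ z ∈ N1, ‖z - c‖ ≤ r → ∃ t : ℝ, z = c + t • x) ∧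
      (∀ z ∈ N2, ‖z - c‖ ≤ r → ∃ t : ℝ, z = c + t • y) := by
  have hr : 0 < r := h1.con.2.1
  have hUc : IsCompact (N1 ∪ N2) := h1.comp.union h2.comp
  have hUp : IsPreconnected (N1 ∪ N2) := h1.conn.union c h1.cN h2.cN h2.conn
  have hUE : E1 ∪ E2 ⊆ N1 ∪ N2 := union_subset_union h1.sub h2.sub
  have hUm : Measure.hausdorffMeasure 1 (N1 ∪ N2) ≤ Measure.hausdorffMeasure 1 N1 + Measure.hausdorffMeasure 1 N2 :=
    measure_union_le _ _
  have hfin : Measure.hausdorffMeasure 1 N1 + Measure.hausdorffMeasure 1 N2 ≠ ∞ := ENNReal.add_ne_top.2 ⟨h1.fin, h2.fin⟩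
  have hUfin : Measure.hausdorffMeasure 1 (N1 ∪ N2) ≠ ∞ := ne_top_of_le_ne_top hfin hUm
  have hU : LM (N1 ∪ N2) (E1 ∪ E2) (D1 ∪ D2) c r := by
    refine ⟨hUc, hUp, hUfin, hUE, fun S hS hS' hES => hUm.trans (h12 S hS hS' hES), Or.inl h1.cN, ?_, ?_⟩
    · rintro e (he | he)
      exacts [h1.far e he, h2.far e he]
    · simpa using h1.con.union h2.con
  have hnc : NoCone (D1 ∪ D2) := fun d1 hd1 d2 hd2 d3 hd3 h12 h32 α β hα hβ => hU.no_cone hd1 hd2 hd3 h12 h32 hα hβ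
  have hn := hU.con.2.2.1
  have hdisj : ∀ d ∈ D1, d ∉ D2 := by
    intro d hd hd'
    have hl : leg c d r ⊆ N1 ∩ N2 := fun z hz => ⟨(h1.con.leg_subset h1.cN hd hr.le le_rfl hz).1,
      (h2.con.leg_subset h2.cN hd' hr.le le_rfl hz).1⟩
    have hm := measure_union_add_inter (μ := (Measure.hausdorffMeasure 1 : Measure V)) N1 h2.comp.isClosed.measurableSet
    have hle := h12 _ hUc hUp hUE
    have h3 : Measure.hausdorffMeasure 1 (N1 ∪ N2) + Measure.hausdorffMeasure 1 (N1 ∩ N2) ≤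
        Measure.hausdorffMeasure 1 (N1 ∪ N2) + 0 := by
      rw [hm, add_zero]; exact hle
    have h4 := (ENNReal.add_le_add_iff_left hUfin).1 h3
    have h5 := (measure_mono hl).trans h4
    rw [leg_measure (h1.con.2.2.1 d hd) hr.le] at h5
    simp at h5
    linarith
  obtain ⟨x1, hx1, x2, hx2, hx12⟩ := h1.two_dirs hE1
  obtain ⟨y1, hy1, y2, hy2, hy12⟩ := h2.two_dirs hE2
  have hne : ∀ x ∈ D1, ∀ y ∈ D2, x ≠ y := fun x hx y hy hxy => hdisj x hx (hxy ▸ hy)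
  have hx : ∀ d ∈ D1, d = x1 ∨ d = x2 := by
    intro d hd
    by_contra hcon
    push Not at hcon
    have f1 := four_dirs Φ hnc hn (Or.inl hd) (Or.inl hx1) (Or.inl hx2) (Or.inr hy1) hcon.1 hcon.2
      (hne d hd y1 hy1) hx12 (hne x1 hx1 y1 hy1) (hne x2 hx2 y1 hy1)
    have f2 := four_dirs Φ hnc hn (Or.inl hx1) (Or.inl hx2) (Or.inr hy1) (Or.inr hy2) hx12 (hne x1 hx1 y1 hy1)
      (hne x1 hx1 y2 hy2) (hne x2 hx2 y1 hy1) (hne x2 hx2 y2 hy2) hy12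
    have f3 := four_dirs Φ hnc hn (Or.inl hx2) (Or.inl hx1) (Or.inr hy1) (Or.inr hy2) hx12.symm (hne x2 hx2 y1 hy1)
      (hne x2 hx2 y2 hy2) (hne x1 hx1 y1 hy1) (hne x1 hx1 y2 hy2) hy12
    have f4 := four_dirs Φ hnc hn (Or.inr hy1) (Or.inl hx1) (Or.inl hx2) (Or.inr hy2) (hne x1 hx1 y1 hy1).symm
      (hne x2 hx2 y1 hy1).symm hy12 hx12 (hne x1 hx1 y2 hy2) (hne x2 hx2 y2 hy2)
    have g1 := hne d hd y1 hy1
    have g2 := hne d hd y2 hy2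
    have hcon1 := hcon.1
    have hcon2 := hcon.2
    rcases f1 with f1 | f1 | f1
    · rw [← f1, neg_neg] at f2; tauto
    · rw [← f1, neg_neg] at f3; tauto
    · rw [← f1, neg_neg] at f4
      rcases f4 with f4 | f4 | f4
      · exact hcon1 f4
      · exact hcon2 f4
      · exact g2 f4
  have hy : ∀ d ∈ D2, d = y1 ∨ d = y2 := by
    intro d hd
    by_contra hcon
    push Not at hcon
    have f1 := four_dirs Φ hnc hn (Or.inr hd) (Or.inr hy1) (Or.inr hy2) (Or.inl hx1) hcon.1 hcon.2
      (hne x1 hx1 d hd).symm hy12 (hne x1 hx1 y1 hy1).symm (hne x1 hx1 y2 hy2).symm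
    have f2 := four_dirs Φ hnc hn (Or.inr hy1) (Or.inr hy2) (Or.inl hx1) (Or.inl hx2) hy12 (hne x1 hx1 y1 hy1).symm
      (hne x2 hx2 y1 hy1).symm (hne x1 hx1 y2 hy2).symm (hne x2 hx2 y2 hy2).symm hx12
    have f3 := four_dirs Φ hnc hn (Or.inr hy2) (Or.inr hy1) (Or.inl hx1) (Or.inl hx2) hy12.symm (hne x1 hx1 y2 hy2).symm
      (hne x2 hx2 y2 hy2).symm (hne x1 hx1 y1 hy1).symm (hne x2 hx2 y1 hy1).symm hx12
    have f4 := four_dirs Φ hnc hn (Or.inl hx1) (Or.inr hy1) (Or.inr hy2) (Or.inl hx2) (hne x1 hx1 y1 hy1)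
      (hne x1 hx1 y2 hy2) hx12 hy12 (hne x2 hx2 y1 hy1).symm (hne x2 hx2 y2 hy2).symm
    have g1 := (hne x1 hx1 d hd).symm
    have g2 := (hne x2 hx2 d hd).symm
    have hcon1 := hcon.1
    have hcon2 := hcon.2
    rcases f1 with f1 | f1 | f1
    · rw [← f1, neg_neg] at f2; tauto
    · rw [← f1, neg_neg] at f3; tauto
    · rw [← f1, neg_neg] at f4
      rcases f4 with f4 | f4 | f4
      · exact hcon1 f4
      · exact hcon2 f4
      · exact g2 f4
  have ax := h1.antipodal hx1 hx2 hx12 hx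
  have ay := h2.antipodal hy1 hy2 hy12 hy
  refine ⟨x1, y1, ?_, ?_, ?_⟩
  · intro h0
    rcases unit_of_br_zero Φ (h1.con.2.2.1 _ hx1) (h2.con.2.2.1 _ hy1) h0 with h | h
    · exact hne _ hx1 _ hy1 h.symm
    · rw [← ax] at h; exact hne _ hx2 _ hy1 h.symm
  · intro z hz hzr
    by_cases hzc : z = c
    · exact ⟨0, by simp [hzc]⟩
    have hd := (h1.con.2.2.2 z hzc hzr).1 hz
    have e := norm_smul_nrm (z - c)
    rcases hx _ hd with h | h
    · refine ⟨‖z - c‖, ?_⟩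
      rw [← h, e]; abel
    · refine ⟨-‖z - c‖, ?_⟩
      rw [h, ax] at e
      rw [neg_smul, ← smul_neg, e]; abel
  · intro z hz hzr
    by_cases hzc : z = c
    · exact ⟨0, by simp [hzc]⟩
    have hd := (h2.con.2.2.2 z hzc hzr).1 hz
    have e := norm_smul_nrm (z - c)
    rcases hy _ hd with h | h
    · refine ⟨‖z - c‖, ?_⟩
      rw [← h, e]; abel
    · refine ⟨-‖z - c‖, ?_⟩
      rw [h, ay] at e
      rw [neg_smul, ← smul_neg, e]; abel

end Planar

section Tube

variable {V : Type} [NormedAddCommGroup V] [NormedSpace ℝ V] [MeasurableSpace V] [BorelSpace V]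

/-- cut-wire lemma -/
lemma cut_wire {X : Set V} (hX : IsCompact X) {A B : Set V} (hA : IsClosed A) (hB : IsClosed B) :
    (∃ K ⊆ X, IsCompact K ∧ IsPreconnected K ∧ (K ∩ A).Nonempty ∧ (K ∩ B).Nonempty) ∨
    ∃ L R : Set V, IsCompact L ∧ IsCompact R ∧ Disjoint L R ∧ L ∪ R = X ∧ X ∩ A ⊆ L ∧ X ∩ B ⊆ R := by
  haveI : CompactSpace X := isCompact_iff_compactSpace.1 hX
  set A' : Set X := Subtype.val ⁻¹' A
  set B' : Set X := Subtype.val ⁻¹' B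
  have cA : IsClosed A' := hA.preimage continuous_subtype_val
  have cB : IsClosed B' := hB.preimage continuous_subtype_val
  let π : X → ConnectedComponents X := ConnectedComponents.mk
  have hπ : Continuous π := ConnectedComponents.continuous_coe
  have cA2 : IsClosed (π '' A') := (cA.isCompact.image hπ).isClosed
  have cB2 : IsClosed (π '' B') := (cB.isCompact.image hπ).isClosed
  by_cases hd : π '' A' ⊆ (π '' B')ᶜ
  · right
    obtain ⟨C, hC, h1, h2⟩ := exists_clopen_of_closed_subset_open cA2 cB2.isOpen_compl hd
    have hC' : IsClopen (π ⁻¹' C) := hC.preimage hπ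
    refine ⟨Subtype.val '' (π ⁻¹' C), Subtype.val '' (π ⁻¹' C)ᶜ, 
      (hC'.1.isCompact).image continuous_subtype_val,
      (hC'.compl.1.isCompact).image continuous_subtype_val, ?_, ?_, ?_, ?_⟩
    · rw [disjoint_image_iff Subtype.val_injective]; exact disjoint_compl_right
    · rw [← image_union, union_compl_self, image_univ, Subtype.range_coe]
    · rintro z ⟨hz, hzA⟩
      exact ⟨⟨z, hz⟩, h1 ⟨⟨z, hz⟩, hzA, rfl⟩, rfl⟩
    · rintro z ⟨hz, hzA⟩
      exact ⟨⟨z, hz⟩, fun h => h2 h ⟨⟨z, hz⟩, hzA, rfl⟩, rfl⟩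
  · left
    rw [not_subset] at hd
    obtain ⟨_, ⟨a, ha, rfl⟩, hn⟩ := hd
    rw [notMem_compl_iff] at hn
    obtain ⟨b, hb, hab⟩ := hn
    have hab' : b ∈ connectedComponent a := by
      rw [← ConnectedComponents.coe_eq_coe']; exact hab
    refine ⟨Subtype.val '' (connectedComponent a), by rintro _ ⟨z, _, rfl⟩; exact z.2,
      (isClosed_connectedComponent.isCompact).image continuous_subtype_val,
      isPreconnected_connectedComponent.image _ continuous_subtype_val.continuousOn,
      ⟨a, ⟨a, mem_connectedComponent, rfl⟩, ha⟩, ⟨b, ⟨b, hab', rfl⟩, hb⟩⟩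

lemma through {E T : Set V} (u w : V → ℝ) (κ : ℝ≥0) (hu : LipschitzWith κ u) (hw : LipschitzWith κ w)
    (c x y : V) (hz : ∀ z, z = c + u z • x + w z • y) (huu : ∀ s t : ℝ, u (c + s • x + t • y) = s)
    (hww : ∀ s t : ℝ, w (c + s • x + t • y) = t)
    (hT : IsCompact T) (hTc : IsPreconnected T) (hfin : Measure.hausdorffMeasure 1 T ≠ ∞)
    (hmin : ∀ S, IsCompact S → IsPreconnected S → E ⊆ S →
      Measure.hausdorffMeasure 1 T ≤ Measure.hausdorffMeasure 1 S) (hET : E ⊆ T) (hE : E.Nonempty)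
    (ρ ε : ℝ) (hρ : 0 < ρ) (hε : 0 ≤ ε) (hερ : ε < ρ) (hsm : κ * (4 * ε * ‖y‖) < ρ / 4)
    (hfar : ∀ e ∈ E, ρ < max |u e| |w e|) (a : V) (ha : a ∈ T) (ha' : max |u a| |w a| ≤ ρ / 4)
    (htube : ∀ z ∈ T, |u z| ≤ ρ → |w z| ≤ ρ → |w z| ≤ ε) :
    ∃ K ⊆ T, IsCompact K ∧ IsPreconnected K ∧ (∀ z ∈ K, |w z| ≤ ε) ∧ (∃ p ∈ K, u p = -ρ) ∧ ∃ q ∈ K, u q = ρ := by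
  classical
  have cu := hu.continuous
  have cw := hw.continuous
  set X : Set V := T ∩ {z | |u z| ≤ ρ ∧ |w z| ≤ ρ} with hXdef
  have hbox : IsClosed {z : V | |u z| ≤ ρ ∧ |w z| ≤ ρ} :=
    (isClosed_le cu.abs continuous_const).inter (isClosed_le cw.abs continuous_const)
  have hX : IsCompact X := hT.inter_right hbox
  rcases cut_wire hX (isClosed_eq cu (continuous_const (y := -ρ))) (isClosed_eq cu (continuous_const (y := ρ))) with
    ⟨K, h1, h2, h3, ⟨p, hp, hp'⟩, ⟨q, hq, hq'⟩⟩ | ⟨L, R, hL, hR, hLR, hun, hLA, hRB⟩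
  · exact ⟨K, fun z hz => (h1 hz).1, h2, h3, fun z hz => htube z (h1 hz).1 (h1 hz).2.1 (h1 hz).2.2,
      ⟨p, hp, hp'⟩, ⟨q, hq, hq'⟩⟩
  exfalso
  have hLX : L ⊆ X := hun ▸ subset_union_left
  have hRX : R ⊆ X := hun ▸ subset_union_right
  let fL : V → V := fun z => c + (min (u z) (-(ρ/2))) • x + w z • y
  let fR : V → V := fun z => c + (max (u z) (ρ/2)) • x + w z • y
  have cfL : Continuous fL := by fun_prop
  have cfR : Continuous fR := by fun_prop
  let O : Set V := T ∩ {z | ρ ≤ max |u z| |w z|}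
  have hO : IsCompact O := hT.inter_right (isClosed_le continuous_const (cu.abs.max cw.abs))
  let φ : V → V := fun z => if z ∈ L then fL z else if z ∈ R then fR z else z
  have hTU : T ⊆ L ∪ R ∪ O := by
    intro z hzT
    rw [hun]
    by_cases h : ρ ≤ max |u z| |w z|
    · exact Or.inr ⟨hzT, h⟩
    · rw [not_le, max_lt_iff] at h
      exact Or.inl ⟨hzT, h.1.le, h.2.le⟩
  have hφL : EqOn φ fL L := fun z hz => by simp [φ, hz]
  have hφR : EqOn φ fR R := fun z hz => by
    have : z ∉ L := fun h => hLR.le_bot ⟨h, hz⟩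
    simp [φ, hz, this]
  have hXO : ∀ z ∈ X, z ∈ O → |u z| = ρ := by
    intro z hz hzO
    have h1 := htube z hz.1 hz.2.1 hz.2.2
    have h2 : ρ ≤ max |u z| |w z| := hzO.2
    rw [le_max_iff] at h2
    rcases h2 with h2 | h2
    · exact le_antisymm hz.2.1 h2
    · linarith
  have hφO : EqOn φ id O := by
    intro z hzO
    by_cases h1 : z ∈ L
    · rw [hφL h1]
      have h2 := hXO z (hLX h1) hzO
      rcases eq_or_eq_neg_of_abs_eq h2 with h | h
      · exact (hLR.le_bot ⟨h1, hRB ⟨hLX h1, h⟩⟩).elim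
      · change c + (min (u z) (-(ρ/2))) • x + w z • y = z
        rw [min_eq_left (by rw [h]; linarith)]; exact (hz z).symm
    · by_cases h1' : z ∈ R
      · rw [hφR h1']
        have h2 := hXO z (hRX h1') hzO
        rcases eq_or_eq_neg_of_abs_eq h2 with h | h
        · change c + (max (u z) (ρ/2)) • x + w z • y = z
          rw [max_eq_left (by rw [h]; linarith)]; exact (hz z).symm
        · exact (hLR.le_bot ⟨hLA ⟨hRX h1', h⟩, h1'⟩).elim
      · simp [φ, h1, h1']
  have hφ : ContinuousOn φ T := by
    refine ContinuousOn.mono ?_ hTU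
    refine ContinuousOn.union_of_isClosed (ContinuousOn.union_of_isClosed ?_ ?_ hL.isClosed hR.isClosed) ?_
      (hL.union hR).isClosed hO.isClosed
    · exact cfL.continuousOn.congr hφL
    · exact cfR.continuousOn.congr hφR
    · exact continuousOn_id.congr hφO
  have hE' : E ⊆ φ '' T := by
    intro e he
    exact ⟨e, hET he, hφO ⟨hET he, (hfar e he).le⟩⟩
  have hm := hmin _ (hT.image_of_continuousOn hφ) (hTc.image _ hφ) hE'
  set M : Set V := T ∩ {z | max |u z| |w z| < ρ / 2} with hM
  have hMm : MeasurableSet M := hT.isClosed.measurableSet.inter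
    (isOpen_lt (cu.abs.max cw.abs) continuous_const).measurableSet
  let sg : ℝ → Set V := fun s => segment ℝ (c + s • x + (-ε) • y) (c + s • x + ε • y)
  have hsg : ∀ s, Measure.hausdorffMeasure 1 (sg s) = ENNReal.ofReal (2 * ε * ‖y‖) := by
    intro s
    rw [seg_len, dist_eq_norm]
    congr 1
    have : (c + s • x + (-ε) • y) - (c + s • x + ε • y) = (-(2 * ε)) • y := by module
    rw [this, norm_smul, norm_neg, Real.norm_of_nonneg (by positivity)]
  have hsgm : ∀ s t, |t| ≤ ε → c + s • x + t • y ∈ sg s := by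
    intro s t ht
    rw [abs_le] at ht
    rcases hε.eq_or_lt with h | h
    · have : t = -ε := by linarith
      rw [this]; exact left_mem_segment ℝ _ _
    · refine ⟨(ε - t)/(2*ε), (t+ε)/(2*ε), div_nonneg (by linarith) (by linarith), div_nonneg (by linarith) (by linarith),
        by field_simp; ring, ?_⟩
      have h1 : (ε - t)/(2*ε) = 1 - (t+ε)/(2*ε) := by field_simp; ring
      have h2 : t = -ε + (t+ε)/(2*ε) * (2*ε) := by field_simp; ring
      rw [h1]
      conv_rhs => rw [h2]
      module
  have hsub : φ '' T ⊆ (T \ M) ∪ (sg (-(ρ/2)) ∪ sg (ρ/2)) := by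
    rintro _ ⟨z, hzT, rfl⟩
    rcases hTU hzT with (h | h) | h
    · rw [hφL h]
      have hzX := hLX h
      rcases le_total (u z) (-(ρ/2)) with h1 | h1
      · left
        have : fL z = z := by
          change c + (min (u z) (-(ρ/2))) • x + w z • y = z
          rw [min_eq_left h1]; exact (hz z).symm
        rw [this]
        refine ⟨hzT, fun h2 => ?_⟩
        have h3 : max |u z| |w z| < ρ / 2 := h2.2
        have := (max_lt_iff.1 h3).1
        rw [abs_lt] at this; linarith
      · right; left
        change c + (min (u z) (-(ρ/2))) • x + w z • y ∈ _
        rw [min_eq_right h1]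
        exact hsgm _ _ (htube z hzT hzX.2.1 hzX.2.2)
    · rw [hφR h]
      have hzX := hRX h
      rcases le_total (ρ/2) (u z) with h1 | h1
      · left
        have : fR z = z := by
          change c + (max (u z) (ρ/2)) • x + w z • y = z
          rw [max_eq_left h1]; exact (hz z).symm
        rw [this]
        refine ⟨hzT, fun h2 => ?_⟩
        have h3 : max |u z| |w z| < ρ / 2 := h2.2
        have := (max_lt_iff.1 h3).1
        rw [abs_lt] at this; linarith
      · right; right
        change c + (max (u z) (ρ/2)) • x + w z • y ∈ _
        rw [max_eq_right h1]
        exact hsgm _ _ (htube z hzT hzX.2.1 hzX.2.2)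
    · rw [hφO h]
      left
      refine ⟨hzT, fun h2 => ?_⟩
      have h3 : max |u z| |w z| < ρ / 2 := h2.2
      have h4 : ρ ≤ max |u z| |w z| := h.2
      linarith
  have hb : Measure.hausdorffMeasure 1 T ≤ Measure.hausdorffMeasure 1 (T \ M) + ENNReal.ofReal (4 * ε * ‖y‖) := by
    refine hm.trans ((measure_mono hsub).trans ((measure_union_le _ _).trans ?_))
    gcongr
    refine (measure_union_le _ _).trans ?_
    rw [hsg, hsg, ← ENNReal.ofReal_add (by positivity) (by positivity)]
    exact ENNReal.ofReal_le_ofReal (by linarith)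
  have hMT : M ⊆ T := inter_subset_left
  have hsum : Measure.hausdorffMeasure 1 (T \ M) + Measure.hausdorffMeasure 1 M = Measure.hausdorffMeasure 1 T := by
    have := measure_diff_add_inter (μ := (Measure.hausdorffMeasure 1 : Measure V)) T hMm
    rwa [inter_eq_self_of_subset_right hMT] at this
  have hdf : Measure.hausdorffMeasure 1 (T \ M) ≠ ∞ := ne_top_of_le_ne_top hfin (measure_mono diff_subset)
  have hMle : Measure.hausdorffMeasure 1 M ≤ ENNReal.ofReal (4 * ε * ‖y‖) := by
    rw [← hsum] at hb
    exact (ENNReal.add_le_add_iff_left hdf).1 hb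
  obtain ⟨e, he⟩ := hE
  have hlip : LipschitzWith κ (fun z => max |u z| |w z|) := by
    have h1 : LipschitzWith κ (fun z => |u z|) := by
      have := (lipschitzWith_one_norm (E := ℝ)).comp hu
      rw [one_mul] at this
      exact this
    have h2 : LipschitzWith κ (fun z => |w z|) := by
      have := (lipschitzWith_one_norm (E := ℝ)).comp hw
      rw [one_mul] at this
      exact this
    simpa using h1.max h2
  have hl := lip_len hTc _ κ hlip ha (hET he) (ρ/4) (ρ/2) ha' (by have := hfar e he; linarith)
  have : ENNReal.ofReal (ρ/2 - ρ/4) ≤ ENNReal.ofReal (κ * (4 * ε * ‖y‖)) := by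
    refine hl.trans ?_
    rw [ENNReal.ofReal_mul (by positivity), ENNReal.ofReal_coe_nnreal]
    gcongr
    refine le_trans (measure_mono ?_) hMle
    rintro z ⟨h1, h2⟩
    exact ⟨h1, h2.2⟩
  rw [ENNReal.ofReal_le_ofReal_iff (by positivity)] at this
  linarith

end Tube

section CrossA

variable {V : Type} [NormedAddCommGroup V] [NormedSpace ℝ V] [MeasurableSpace V] [BorelSpace V]

lemma coords (Φ : V ≃L[ℝ] ℝ × ℝ) (c x y : V) (hxy : br Φ x y ≠ 0) :
    ∃ (u w : V → ℝ) (κ : ℝ≥0), LipschitzWith κ u ∧ LipschitzWith κ w ∧ 1 ≤ κ ∧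
      (∀ z, z = c + u z • x + w z • y) ∧ (∀ s t : ℝ, u (c + s • x + t • y) = s) ∧
      (∀ s t : ℝ, w (c + s • x + t • y) = t) := by
  let f1 : V →L[ℝ] ℝ := (ContinuousLinearMap.fst ℝ ℝ ℝ).comp (Φ : V →L[ℝ] ℝ × ℝ)
  let f2 : V →L[ℝ] ℝ := (ContinuousLinearMap.snd ℝ ℝ ℝ).comp (Φ : V →L[ℝ] ℝ × ℝ)
  let U : V →L[ℝ] ℝ := (br Φ x y)⁻¹ • ((Φ y).2 • f1 - (Φ y).1 • f2)
  let W : V →L[ℝ] ℝ := (br Φ x y)⁻¹ • ((Φ x).1 • f2 - (Φ x).2 • f1)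
  have hU : ∀ z, U z = (br Φ x y)⁻¹ * ((Φ y).2 * (Φ z).1 - (Φ y).1 * (Φ z).2) := fun z => rfl
  have hW : ∀ z, W z = (br Φ x y)⁻¹ * ((Φ x).1 * (Φ z).2 - (Φ x).2 * (Φ z).1) := fun z => rfl
  have lip : ∀ (F : V →L[ℝ] ℝ) (k : ℝ≥0), ‖F‖₊ ≤ k → LipschitzWith k (fun z => F (z - c)) := by
    intro F k hk
    refine LipschitzWith.of_dist_le_mul fun p q => ?_
    rw [dist_eq_norm, dist_eq_norm, ← map_sub, sub_sub_sub_cancel_right]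
    refine (F.le_opNorm _).trans ?_
    gcongr
    exact_mod_cast hk
  refine ⟨fun z => U (z - c), fun z => W (z - c), max 1 (max ‖U‖₊ ‖W‖₊), lip _ _ (by simp), lip _ _ (by simp),
    le_max_left _ _, ?_, ?_, ?_⟩
  · intro z
    have : z - c = U (z-c) • x + W (z-c) • y := by
      apply Φ.injective
      rw [hU, hW]
      generalize z - c = v
      ext
      · simp only [map_add, map_smul, Prod.fst_add, Prod.smul_fst, smul_eq_mul]
        field_simp; simp only [br]; ring
      · simp only [map_add, map_smul, Prod.snd_add, Prod.smul_snd, smul_eq_mul]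
        field_simp; simp only [br]; ring
    rw [add_assoc, ← this]; abel
  · intro s t
    have : c + s • x + t • y - c = s • x + t • y := by abel
    simp only [this]
    rw [hU]
    simp only [map_add, map_smul, Prod.fst_add, Prod.smul_fst, smul_eq_mul, Prod.snd_add, Prod.smul_snd]
    field_simp; simp only [br]; ring
  · intro s t
    have : c + s • x + t • y - c = s • x + t • y := by abel
    simp only [this]
    rw [hW]
    simp only [map_add, map_smul, Prod.fst_add, Prod.smul_fst, smul_eq_mul, Prod.snd_add, Prod.smul_snd]
    field_simp; simp only [br]; ring

/-- being a minimal continuum for its terminals -/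
structure MinTree (T E : Set V) : Prop where
  comp : IsCompact T
  conn : IsPreconnected T
  fin : Measure.hausdorffMeasure 1 T ≠ ∞
  sub : E ⊆ T
  ne : E.Nonempty
  min : ∀ S, IsCompact S → IsPreconnected S → E ⊆ S →
    Measure.hausdorffMeasure 1 T ≤ Measure.hausdorffMeasure 1 S

lemma crossA (Φ : V ≃L[ℝ] ℝ × ℝ) (c x y : V) (r : ℝ) (hr : 0 < r) (hxy : br Φ x y ≠ 0) (N1 N2 : Set V)
    (hN1 : N1.Nonempty) (hN2 : N2.Nonempty)
    (hl1 : ∀ z ∈ N1, ‖z - c‖ ≤ r → ∃ t : ℝ, z = c + t • x)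
    (hl2 : ∀ z ∈ N2, ‖z - c‖ ≤ r → ∃ t : ℝ, z = c + t • y) :
    ∃ η > 0, ∀ T1 T2 E1 E2 : Set V, MinTree T1 E1 → MinTree T2 E2 → Disjoint T1 T2 →
      (∀ e ∈ E1, r ≤ ‖e - c‖) → (∀ e ∈ E2, r ≤ ‖e - c‖) →
      ∀ a ∈ T1, ∀ b ∈ T2, dist a c < η → dist b c < η →
      (∀ z ∈ T1, Metric.infDist z N1 < η) → (∀ z ∈ T2, Metric.infDist z N2 < η) → False := by
  obtain ⟨u, w, κ, hu, hw, hκ, hz, huu, hww⟩ := coords Φ c x y hxy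
  have hκ' : (1:ℝ) ≤ κ := by exact_mod_cast hκ
  have hu0 : u c = 0 := by simpa using huu 0 0
  have hw0 : w c = 0 := by simpa using hww 0 0
  set B : ℝ := 1 + ‖x‖ + ‖y‖ with hB
  have hBx : ‖x‖ ≤ B := by have := norm_nonneg y; linarith
  have hBy : ‖y‖ ≤ B := by have := norm_nonneg x; linarith
  have hB1 : 1 ≤ B := by have := norm_nonneg y; have := norm_nonneg x; linarith
  obtain ⟨ρ, hρ, hρr⟩ : ∃ ρ > 0, ρ * B ≤ r / 2 :=
    ⟨r / 2 / B, by positivity, by field_simp; rfl⟩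
  obtain ⟨η, hη, hη1, hη2⟩ : ∃ η > 0, η ≤ r / 2 ∧ κ * κ * (32 * B) * η ≤ ρ := by
    have hp : 0 < (κ:ℝ) * κ * (32 * B) := by positivity
    refine ⟨min (r/2) (ρ / (κ * κ * (32 * B))), lt_min (by linarith) (by positivity), min_le_left _ _, ?_⟩
    calc κ * κ * (32 * B) * min (r/2) (ρ / (κ * κ * (32 * B))) ≤ κ * κ * (32 * B) * (ρ / (κ * κ * (32 * B))) := by
          gcongr; exact min_le_right _ _
      _ = ρ := by field_simp
  have hκη : κ * η ≤ ρ / 32 := by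
    have : (κ:ℝ) * η * 1 * 1 ≤ κ * η * κ * B := by gcongr
    nlinarith
  have hκη2 : κ * (4 * (κ * η) * B) < ρ / 4 := by nlinarith
  refine ⟨η, hη, ?_⟩
  intro T1 T2 E1 E2 m1 m2 hd hE1 hE2 a ha b hb hac hbc hn1 hn2
  have lipb : ∀ (f : V → ℝ), LipschitzWith κ f → ∀ p q, dist p q < η → |f p - f q| ≤ κ * η := by
    intro f hf p q hpq
    have := hf.dist_le_mul p q
    rw [Real.dist_eq] at this
    refine this.trans ?_
    gcongr
  have box : ∀ z, |u z| ≤ ρ → |w z| ≤ ρ → ‖z - c‖ ≤ r / 2 := by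
    intro z h1 h2
    have : z - c = u z • x + w z • y := by
      conv_lhs => rw [hz z]
      abel
    rw [this]
    refine (norm_add_le _ _).trans ?_
    rw [norm_smul, norm_smul, Real.norm_eq_abs, Real.norm_eq_abs]
    calc |u z| * ‖x‖ + |w z| * ‖y‖ ≤ ρ * ‖x‖ + ρ * ‖y‖ := by gcongr
      _ ≤ ρ * B := by rw [hB]; nlinarith
      _ ≤ _ := hρr
  have far : ∀ e, r ≤ ‖e - c‖ → ρ < max |u e| |w e| := by
    intro e he
    by_contra hcon
    rw [not_lt, max_le_iff] at hcon
    have := box e hcon.1 hcon.2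
    linarith
  have near : ∀ p, dist p c < η → max |u p| |w p| ≤ ρ / 4 := by
    intro p hp
    have h1 := lipb u hu p c hp
    have h2 := lipb w hw p c hp
    rw [hu0, sub_zero] at h1
    rw [hw0, sub_zero] at h2
    exact max_le (by linarith) (by linarith)
  have close : ∀ N : Set V, N.Nonempty → ∀ z, Metric.infDist z N < η → |u z| ≤ ρ → |w z| ≤ ρ →
      ∃ p ∈ N, dist z p < η ∧ ‖p - c‖ ≤ r := by
    intro N hN z hzN h1 h2
    obtain ⟨p, hp, hzp⟩ := (Metric.infDist_lt_iff hN).1 hzN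
    refine ⟨p, hp, hzp, ?_⟩
    have h3 := box z h1 h2
    rw [← dist_eq_norm] at h3 ⊢
    have := dist_triangle p z c
    rw [dist_comm p z] at this
    linarith
  have tube1 : ∀ z ∈ T1, |u z| ≤ ρ → |w z| ≤ ρ → |w z| ≤ κ * η := by
    intro z hzT h1 h2
    obtain ⟨p, hp, hzp, hpr⟩ := close N1 hN1 z (hn1 z hzT) h1 h2
    obtain ⟨t, rfl⟩ := hl1 p hp hpr
    have h3 := lipb w hw _ _ hzp
    have h4 : w (c + t • x) = 0 := by simpa using hww t 0
    rwa [h4, sub_zero] at h3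
  have tube2 : ∀ z ∈ T2, |w z| ≤ ρ → |u z| ≤ ρ → |u z| ≤ κ * η := by
    intro z hzT h1 h2
    obtain ⟨p, hp, hzp, hpr⟩ := close N2 hN2 z (hn2 z hzT) h2 h1
    obtain ⟨t, rfl⟩ := hl2 p hp hpr
    have h3 := lipb u hu _ _ hzp
    have h4 : u (c + t • y) = 0 := by simpa using huu 0 t
    rwa [h4, sub_zero] at h3
  obtain ⟨K1, s1, c1, p1, q1, ⟨a1, ha1, ha1'⟩, ⟨b1, hb1, hb1'⟩⟩ := through u w κ hu hw c x y hz huu hww m1.comp m1.conn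
    m1.fin m1.min m1.sub m1.ne ρ (κ * η) hρ (by positivity) (by linarith)
    (lt_of_le_of_lt (by gcongr) hκη2) (fun e he => far e (hE1 e he)) a ha (near a hac) tube1
  obtain ⟨K2, s2, c2, p2, q2, ⟨a2, ha2, ha2'⟩, ⟨b2, hb2, hb2'⟩⟩ := through w u κ hw hu c y x
    (fun z => by rw [add_right_comm]; exact hz z)
    (fun s t => by rw [add_right_comm]; exact hww t s)
    (fun s t => by rw [add_right_comm]; exact huu t s) m2.comp m2.conn
    m2.fin m2.min m2.sub m2.ne ρ (κ * η) hρ (by positivity) (by linarith)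
    (lt_of_le_of_lt (by gcongr) hκη2) (fun e he => by rw [max_comm]; exact far e (hE2 e he)) b hb
    (by rw [max_comm]; exact near b hbc) tube2
  refine crossing u w hu.continuous hw.continuous (fun p q h1 h2 => by rw [hz p, hz q, h1, h2]) K1 K2 c1 c2 p1 p2
    (hd.mono s1 s2) ρ ?_ ?_ a1 ha1 ha1' b1 hb1 hb1' a2 ha2 ha2' b2 hb2 hb2'
  · intro z hzK; have := q1 z hzK; linarith
  · intro z hzK; have := q2 z hzK; linarith

end CrossA

section Sep

variable {V : Type} [NormedAddCommGroup V] [NormedSpace ℝ V] [MeasurableSpace V] [BorelSpace V]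

lemma fatten {M : ℕ} (es e : Fin M → V) {S : Set V} (hS : IsCompact S) (hc : IsPreconnected S)
    (h : ∀ m, es m ∈ S) (ε : ℝ) (hd : ∀ m, dist (es m) (e m) ≤ ε) :
    ∃ S', IsCompact S' ∧ IsPreconnected S' ∧ S ⊆ S' ∧ (∀ m, e m ∈ S') ∧
      Measure.hausdorffMeasure 1 S' ≤ Measure.hausdorffMeasure 1 S + ENNReal.ofReal (M * ε) := by
  rcases Nat.eq_zero_or_pos M with rfl | hM
  · exact ⟨S, hS, hc, subset_rfl, fun m => m.elim0, le_self_add⟩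
  haveI : Nonempty (Fin M) := ⟨⟨0, hM⟩⟩
  refine ⟨⋃ m, (S ∪ segment ℝ (es m) (e m)), isCompact_iUnion fun m => hS.union (segment_compact _ _), ?_, ?_, ?_, ?_⟩
  · refine isPreconnected_iUnion ⟨es ⟨0, hM⟩, mem_iInter.2 fun m => Or.inl (h _)⟩ fun m => ?_
    exact hc.union (es m) (h m) (left_mem_segment ℝ _ _) (convex_segment _ _).isPreconnected
  · intro z hz; exact mem_iUnion.2 ⟨⟨0, hM⟩, Or.inl hz⟩
  · intro m; exact mem_iUnion.2 ⟨m, Or.inr (right_mem_segment ℝ _ _)⟩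
  · rw [← union_iUnion]
    refine (measure_union_le _ _).trans ?_
    gcongr
    refine (measure_iUnion_fintype_le _ _).trans ?_
    calc _ ≤ ∑ m : Fin M, ENNReal.ofReal ε := by
          refine Finset.sum_le_sum fun m _ => ?_
          rw [seg_len]
          exact ENNReal.ofReal_le_ofReal (hd m)
      _ = ENNReal.ofReal (M * ε) := by
        simp only [Finset.sum_const, Finset.card_univ, Fintype.card_fin, nsmul_eq_mul]
        rw [ENNReal.ofReal_mul (by positivity), ENNReal.ofReal_natCast]

lemma tend_close {M : ℕ} (u : Ultrafilter ℕ) (e : ℕ → Fin M → V) (es : Fin M → V)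
    (he : ∀ m, Tendsto (fun n => e n m) u (𝓝 (es m))) (ε : ℝ) (hε : 0 < ε) :
    ∀ᶠ n in u, ∀ m, dist (es m) (e n m) ≤ ε := by
  rw [eventually_all]
  intro m
  filter_upwards [Metric.tendsto_nhds.1 (he m) ε hε] with n hn
  rw [dist_comm]; exact hn.le

lemma one_limit [ProperSpace V] [StrictConvexSpace ℝ V] (u : Ultrafilter ℕ) (hu : (u : Filter ℕ) ≤ atTop)
    {M : ℕ} (hM : 1 ≤ M) (e : ℕ → Fin M → V) (R : ℝ) (hR0 : 0 ≤ R) (hR : ∀ n m, ‖e n m‖ ≤ R) (T : ℕ → Set V)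
    (hT : ∀ n, MinTree (T n) (range (e n))) :
    ∃ (es : Fin M → V) (N : Set V), (∀ m, Tendsto (fun n => e n m) u (𝓝 (es m))) ∧ MinTree N (range es) ∧
      (∀ ε > 0, ∀ᶠ n in u, Measure.hausdorffMeasure 1 N ≤ Measure.hausdorffMeasure 1 (T n) + ENNReal.ofReal ε) ∧
      (∀ ε > 0, ∀ᶠ n in u, ∀ z ∈ T n, Metric.infDist z N < ε) ∧ (∀ c, ∃ D r, Conic c N D r) ∧
      (∀ n, ∀ z ∈ T n, ‖z‖ ≤ R + M * R) := by
  have hl : ∀ m, ∃ x, Tendsto (fun n => e n m) u (𝓝 x) := fun m =>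
    ultra_lim u _ R (Eventually.of_forall fun n => hR n m)
  choose es hes using hl
  have hC : ∀ n, Measure.hausdorffMeasure 1 (T n) ≤ ENNReal.ofReal (M * R) := by
    intro n
    obtain ⟨S, h1, h2, h3, h4⟩ := star_bound (e n) R (hR n)
    exact ((hT n).min S h1 h2 (range_subset_iff.2 h3)).trans h4
  obtain ⟨G, q, hG, hq, hlen, hinf⟩ := limit_tree u hu hM e es hes R (M * R) hR T (fun n => (hT n).comp)
    (fun n => (hT n).conn) (by positivity) hC (fun n m => (hT n).sub (mem_range_self m))
    (fun n S h1 h2 h3 => (hT n).min S h1 h2 (range_subset_iff.2 h3))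
  have hlow : ∀ ε > 0, ∀ᶠ n in u, Measure.hausdorffMeasure 1 (netset G q) ≤
      Measure.hausdorffMeasure 1 (T n) + ENNReal.ofReal ε := by
    intro ε hε
    filter_upwards [hlen ε hε] with n hn
    refine (netset_measure G q).trans ((ENNReal.ofReal_le_ofReal hn).trans ?_)
    rw [ENNReal.ofReal_add ENNReal.toReal_nonneg hε.le, ENNReal.ofReal_toReal (hT n).fin]
  refine ⟨es, netset G q, hes, ⟨netset_compact G q, (netset_connected hG q).isPreconnected,
    ne_top_of_le_ne_top ENNReal.ofReal_ne_top (netset_measure G q), ?_, ⟨es ⟨0, hM⟩, mem_range_self _⟩, ?_⟩, hlow, hinf,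
    fun c => conic_netset c G q, ?_⟩
  · rintro _ ⟨m, rfl⟩
    obtain ⟨i, hi⟩ := hq m
    rw [← hi]; exact netset_vertex G q i
  · intro S h1 h2 h3
    refine ENNReal.le_of_forall_pos_le_add fun ε hε _ => ?_
    have hε' : (0:ℝ) < ε := hε
    have hMp : (0:ℝ) < M := by exact_mod_cast hM
    obtain ⟨n, hn1, hn2⟩ := ((hlow (ε/2) (by positivity)).and
      (tend_close u e es hes (ε / 2 / M) (by positivity))).exists
    obtain ⟨S', k1, k2, k3, k4, k5⟩ := fatten es (e n) h1 h2 (fun m => h3 (mem_range_self m)) _ hn2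
    have h4 := (hT n).min S' k1 k2 (range_subset_iff.2 k4)
    calc _ ≤ _ := hn1
      _ ≤ Measure.hausdorffMeasure 1 S + ENNReal.ofReal (M * (ε / 2 / M)) + ENNReal.ofReal (ε/2) := by
        gcongr; exact h4.trans k5
      _ = Measure.hausdorffMeasure 1 S + ε := by
        rw [add_assoc, ← ENNReal.ofReal_add (by positivity) (by positivity)]
        congr 1
        have : (M * (ε / 2 / M) + ε / 2 : ℝ) = ε := by field_simp; ring
        rw [this, ENNReal.ofReal_coe_nnreal]
  · intro n z hz
    have h1 := conn_len (hT n).conn hz ((hT n).sub (mem_range_self ⟨0, hM⟩))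
    have h2 := (ENNReal.ofReal_le_ofReal_iff (by positivity)).1 (h1.trans (hC n))
    have h3 := hR n ⟨0, hM⟩
    rw [dist_eq_norm] at h2
    have := norm_sub_norm_le z (e n ⟨0, hM⟩)
    linarith

lemma lim_mem {u : Ultrafilter ℕ} {N : Set V} (hN : IsClosed N) (hne : N.Nonempty) (T : ℕ → Set V) (a : ℕ → V) (c : V)
    (ha : Tendsto a u (𝓝 c)) (haT : ∀ n, a n ∈ T n)
    (h : ∀ ε > 0, ∀ᶠ n in u, ∀ z ∈ T n, Metric.infDist z N < ε) : c ∈ N := by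
  rw [hN.mem_iff_infDist_zero hne]
  have h1 : Tendsto (fun n => Metric.infDist (a n) N) u (𝓝 (Metric.infDist c N)) :=
    (Metric.continuous_infDist_pt N).continuousAt.tendsto.comp ha
  refine le_antisymm (le_of_forall_pos_le_add fun ε hε => ?_) Metric.infDist_nonneg
  rw [zero_add]
  refine le_of_tendsto h1 ?_
  filter_upwards [h ε hε] with n hn
  exact (hn _ (haT n)).le

theorem sepA [ProperSpace V] [StrictConvexSpace ℝ V] (Φ : V ≃L[ℝ] ℝ × ℝ) (M : ℕ) (hM : 1 ≤ M) (R κ : ℝ)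
    (hR0 : 0 ≤ R) (hκ : 0 < κ) :
    ∃ δ > 0, ∀ e1 e2 : Fin M → V, (∀ m, ‖e1 m‖ ≤ R) → (∀ m, ‖e2 m‖ ≤ R) → ∀ T1 T2 : Set V,
      MinTree T1 (range e1) → MinTree T2 (range e2) → Disjoint T1 T2 →
      (∀ S, IsCompact S → IsPreconnected S → range e1 ∪ range e2 ⊆ S →
        Measure.hausdorffMeasure 1 T1 + Measure.hausdorffMeasure 1 T2 ≤ Measure.hausdorffMeasure 1 S) →
      ∀ a ∈ T1, ∀ b ∈ T2, (∀ m, κ ≤ ‖e1 m - a‖) → (∀ m, κ ≤ ‖e2 m - b‖) → δ ≤ dist a b := by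
  by_contra hcon
  push Not at hcon
  have hpos : ∀ n : ℕ, (0:ℝ) < 1 / (n + 1) := fun n => by positivity
  choose e1 e2 hR1 hR2 T1 T2 m1 m2 hd h12 a ha b hb k1 k2 hab using fun n : ℕ => hcon _ (hpos n)
  set u : Ultrafilter ℕ := Ultrafilter.of atTop with hudef
  have hu : (u : Filter ℕ) ≤ atTop := Ultrafilter.of_le _
  obtain ⟨s1, N1, hs1, n1, low1, inf1, con1, bd1⟩ := one_limit u hu hM e1 R hR0 hR1 T1 m1
  obtain ⟨s2, N2, hs2, n2, low2, inf2, con2, -⟩ := one_limit u hu hM e2 R hR0 hR2 T2 m2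
  obtain ⟨c, hc⟩ := ultra_lim u a _ (Eventually.of_forall fun n => bd1 n _ (ha n))
  have hc' : Tendsto b u (𝓝 c) := by
    have h0 : Tendsto (fun n => dist (a n) (b n)) u (𝓝 0) := by
      refine squeeze_zero (fun _ => dist_nonneg) (fun n => (hab n).le) ?_
      exact (tendsto_one_div_add_atTop_nhds_zero_nat).mono_left hu
    exact hc.congr_dist h0
  have c1 : c ∈ N1 := lim_mem n1.comp.isClosed (n1.ne.mono n1.sub) T1 a c hc ha inf1
  have c2 : c ∈ N2 := lim_mem n2.comp.isClosed (n2.ne.mono n2.sub) T2 b c hc' hb inf2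
  obtain ⟨D1, r1, hD1⟩ := con1 c
  obtain ⟨D2, r2, hD2⟩ := con2 c
  have f1 : ∀ m, κ ≤ ‖s1 m - c‖ := fun m =>
    ge_of_tendsto ((hs1 m).sub hc).norm (Eventually.of_forall fun n => k1 n m)
  have f2 : ∀ m, κ ≤ ‖s2 m - c‖ := fun m =>
    ge_of_tendsto ((hs2 m).sub hc').norm (Eventually.of_forall fun n => k2 n m)
  set r : ℝ := min (κ / 2) (min r1 r2) with hr
  have hr1 := hD1.2.1
  have hr2 := hD2.2.1
  have hr0 : 0 < r := lt_min (by positivity) (lt_min hr1 hr2)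
  have hrκ : r ≤ κ / 2 := min_le_left _ _
  have hrr1 : r ≤ r1 := (min_le_right _ _).trans (min_le_left _ _)
  have hrr2 : r ≤ r2 := (min_le_right _ _).trans (min_le_right _ _)
  have lm1 : LM N1 (range s1) D1 c r := ⟨n1.comp, n1.conn, n1.fin, n1.sub, n1.min, c1,
    by rintro _ ⟨m, rfl⟩; have := f1 m; linarith, hD1.mono hr0 hrr1⟩
  have lm2 : LM N2 (range s2) D2 c r := ⟨n2.comp, n2.conn, n2.fin, n2.sub, n2.min, c2,
    by rintro _ ⟨m, rfl⟩; have := f2 m; linarith, hD2.mono hr0 hrr2⟩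
  have hMp : (0:ℝ) < M := by exact_mod_cast hM
  obtain ⟨x, y, hxy, hl1, hl2⟩ := limit_cross Φ lm1 lm2 n1.ne n2.ne (by
    intro S g1 g2 g3
    refine ENNReal.le_of_forall_pos_le_add fun ε hε _ => ?_
    have hε' : (0:ℝ) < ε := hε
    obtain ⟨n, hn1, hn2, hn3, hn4⟩ := ((low1 (ε/4) (by positivity)).and ((low2 (ε/4) (by positivity)).and
      ((tend_close u e1 s1 hs1 (ε / 4 / M) (by positivity)).and
      (tend_close u e2 s2 hs2 (ε / 4 / M) (by positivity))))).exists
    obtain ⟨S', q1, q2, q3, q4, q5⟩ := fatten s1 (e1 n) g1 g2 (fun m => g3 (Or.inl (mem_range_self m))) _ hn3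
    obtain ⟨S'', p1, p2, p3, p4, p5⟩ := fatten s2 (e2 n) q1 q2 (fun m => q3 (g3 (Or.inr (mem_range_self m)))) _ hn4
    have h4 := h12 n S'' p1 p2 (union_subset (range_subset_iff.2 fun m => p3 (q4 m)) (range_subset_iff.2 p4))
    have hq : (M * (ε / 4 / M) : ℝ) = ε / 4 := by field_simp
    rw [hq] at q5 p5
    calc _ ≤ (Measure.hausdorffMeasure 1 (T1 n) + ENNReal.ofReal (ε/4)) +
          (Measure.hausdorffMeasure 1 (T2 n) + ENNReal.ofReal (ε/4)) := add_le_add hn1 hn2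
      _ = (Measure.hausdorffMeasure 1 (T1 n) + Measure.hausdorffMeasure 1 (T2 n)) +
          (ENNReal.ofReal (ε/4) + ENNReal.ofReal (ε/4)) := by ring
      _ ≤ (Measure.hausdorffMeasure 1 S + ENNReal.ofReal (ε/4) + ENNReal.ofReal (ε/4)) +
          (ENNReal.ofReal (ε/4) + ENNReal.ofReal (ε/4)) := by
        exact add_le_add (h4.trans (p5.trans (add_le_add q5 le_rfl))) le_rfl
      _ = Measure.hausdorffMeasure 1 S + ε := by
        rw [add_assoc, add_assoc, ← ENNReal.ofReal_add (by positivity) (by positivity),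
          ← ENNReal.ofReal_add (by positivity) (by positivity), ← ENNReal.ofReal_add (by positivity) (by positivity)]
        congr 1
        have : (ε / 4 + (ε / 4 + (ε/4 + ε/4)) : ℝ) = ε := by ring
        rw [this, ENNReal.ofReal_coe_nnreal])
  obtain ⟨η, hη, hfin⟩ := crossA Φ c x y r hr0 hxy N1 N2 ⟨c, c1⟩ ⟨c, c2⟩ hl1 hl2
  have hη' : 0 < min η (κ/2) := lt_min hη (by positivity)
  obtain ⟨n, w1, w2, w3, w4⟩ := ((inf1 η hη).and ((inf2 η hη).and
    ((Metric.tendsto_nhds.1 hc _ hη').and (Metric.tendsto_nhds.1 hc' _ hη')))).exists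
  rw [lt_min_iff] at w3 w4
  refine hfin (T1 n) (T2 n) _ _ (m1 n) (m2 n) (hd n) ?_ ?_ (a n) (ha n) (b n) (hb n) w3.1 w4.1 w1 w2
  · rintro _ ⟨m, rfl⟩
    have h1 := k1 n m
    have h2 := dist_triangle (e1 n m) c (a n)
    rw [dist_comm c, dist_eq_norm, dist_eq_norm (e1 n m)] at h2
    linarith [w3.2]
  · rintro _ ⟨m, rfl⟩
    have h1 := k2 n m
    have h2 := dist_triangle (e2 n m) c (b n)
    rw [dist_comm c, dist_eq_norm, dist_eq_norm (e2 n m)] at h2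
    linarith [w4.2]

end Sep

section Forest

variable {V : Type} [NormedAddCommGroup V] [NormedSpace ℝ V] [MeasurableSpace V] [BorelSpace V]

open scoped Pointwise in
lemma smul_len {s : ℝ} (hs : 0 < s) (S : Set V) :
    Measure.hausdorffMeasure 1 (s • S) = ENNReal.ofReal s * Measure.hausdorffMeasure 1 S := by
  rw [Measure.hausdorffMeasure_smul₀ zero_le_one hs.ne', NNReal.rpow_one, ENNReal.smul_def, smul_eq_mul]
  congr 1
  rw [← ENNReal.ofReal_coe_nnreal, coe_nnnorm, Real.norm_of_nonneg hs.le]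

open scoped Pointwise in
lemma smul_pre {s : ℝ} {S : Set V} (h : IsPreconnected S) : IsPreconnected (s • S) :=
  h.image _ (continuous_const_smul s).continuousOn

open scoped Pointwise in
/-- scaled competitors -/
lemma smul_min {s : ℝ} (hs : 0 < s) {E : Set V} {L : ℝ≥0∞}
    (h : ∀ S, IsCompact S → IsPreconnected S → E ⊆ S → L ≤ Measure.hausdorffMeasure 1 S) (S : Set V)
    (h1 : IsCompact S) (h2 : IsPreconnected S) (h3 : s • E ⊆ S) :
    ENNReal.ofReal s * L ≤ Measure.hausdorffMeasure 1 S := by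
  have h4 := h (s⁻¹ • S) (h1.smul _) (smul_pre h2) (by
    intro z hz
    exact ⟨s • z, h3 ⟨z, hz, rfl⟩, inv_smul_smul₀ hs.ne' z⟩)
  calc ENNReal.ofReal s * L ≤ ENNReal.ofReal s * Measure.hausdorffMeasure 1 (s⁻¹ • S) := by gcongr
    _ = Measure.hausdorffMeasure 1 (s • s⁻¹ • S) := (smul_len hs _).symm
    _ = _ := by rw [smul_inv_smul₀ hs.ne']

open scoped Pointwise in
lemma MinTree.smul {T E : Set V} (h : MinTree T E) {s : ℝ} (hs : 0 < s) : MinTree (s • T) (s • E) := by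
  refine ⟨h.comp.smul _, smul_pre h.conn, ?_, Set.smul_set_mono h.sub, h.ne.smul_set, ?_⟩
  · rw [smul_len hs]; exact ENNReal.mul_ne_top ENNReal.ofReal_ne_top h.fin
  · intro S h1 h2 h3
    rw [smul_len hs]
    exact smul_min hs h.min S h1 h2 h3

open scoped Pointwise in
theorem sepB [ProperSpace V] [StrictConvexSpace ℝ V] (Φ : V ≃L[ℝ] ℝ × ℝ) (M : ℕ) (hM : 1 ≤ M) (R κ : ℝ)
    (hR0 : 0 ≤ R) (hκ : 0 < κ) :
    ∃ δ > 0, ∀ m : ℝ, 0 < m → ∀ e1 e2 : Fin M → V, (∀ i, ‖e1 i‖ ≤ R * m) → (∀ i, ‖e2 i‖ ≤ R * m) → ∀ T1 T2 : Set V,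
      MinTree T1 (range e1) → MinTree T2 (range e2) → Disjoint T1 T2 →
      (∀ S, IsCompact S → IsPreconnected S → range e1 ∪ range e2 ⊆ S →
        Measure.hausdorffMeasure 1 T1 + Measure.hausdorffMeasure 1 T2 ≤ Measure.hausdorffMeasure 1 S) →
      ∀ a ∈ T1, ∀ b ∈ T2, (∀ i, κ * m ≤ ‖e1 i - a‖) → (∀ i, κ * m ≤ ‖e2 i - b‖) → δ * m ≤ dist a b := by
  obtain ⟨δ, hδ, h⟩ := sepA Φ M hM R κ hR0 hκ
  refine ⟨δ, hδ, ?_⟩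
  intro m hm e1 e2 hR1 hR2 T1 T2 m1 m2 hd h12 a ha b hb k1 k2
  have hm' : 0 < m⁻¹ := inv_pos.2 hm
  have hr : ∀ e : Fin M → V, range (fun i => m⁻¹ • e i) = m⁻¹ • range e := fun e => by
    rw [← image_smul, ← range_comp]; rfl
  have hn : ∀ v : V, ‖m⁻¹ • v‖ = ‖v‖ / m := fun v => by
    rw [norm_smul, Real.norm_of_nonneg hm'.le]; field_simp
  have := h (fun i => m⁻¹ • e1 i) (fun i => m⁻¹ • e2 i)
    (fun i => by rw [hn, div_le_iff₀ hm]; exact hR1 i) (fun i => by rw [hn, div_le_iff₀ hm]; exact hR2 i)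
    (m⁻¹ • T1) (m⁻¹ • T2) (by rw [hr]; exact m1.smul hm') (by rw [hr]; exact m2.smul hm')
    (by
      rw [← image_smul, ← image_smul]
      exact (disjoint_image_iff (smul_right_injective V hm'.ne')).2 hd)
    (by
      intro S h1 h2 h3
      rw [smul_len hm', smul_len hm', ← mul_add]
      rw [hr, hr, ← Set.smul_set_union] at h3
      exact smul_min hm' h12 S h1 h2 h3)
    (m⁻¹ • a) ⟨a, ha, rfl⟩ (m⁻¹ • b) ⟨b, hb, rfl⟩
    (fun i => by rw [← smul_sub, hn, le_div_iff₀ hm]; exact k1 i)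
    (fun i => by rw [← smul_sub, hn, le_div_iff₀ hm]; exact k2 i)
  rw [dist_eq_norm, ← smul_sub, hn, le_div_iff₀ hm] at this
  rwa [dist_eq_norm]

/-- Admissible sets -/
def Adm {X : Type} [TopologicalSpace X] {r : ℕ} (Ep : Fin r → Set X) (S : Set X) : Prop :=
  IsCompact S ∧ ∀ j, ∃ x ∈ S, Ep j ⊆ connectedComponentIn S x

lemma cc_closed {F : Set V} (hF : IsCompact F) (x : V) : IsClosed (connectedComponentIn F x) := by
  by_cases hx : x ∈ F
  · rw [connectedComponentIn_eq_image hx]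
    exact hF.isClosed.isClosedEmbedding_subtypeVal.isClosedMap _ isClosed_connectedComponent
  · rw [connectedComponentIn_eq_empty hx]; exact isClosed_empty

lemma cc_disj {F : Set V} (x y : V) : connectedComponentIn F x = connectedComponentIn F y ∨
    Disjoint (connectedComponentIn F x) (connectedComponentIn F y) := by
  by_cases h : Disjoint (connectedComponentIn F x) (connectedComponentIn F y)
  · exact Or.inr h
  · rw [not_disjoint_iff] at h
    obtain ⟨z, h1, h2⟩ := h
    exact Or.inl ((connectedComponentIn_eq h1).trans (connectedComponentIn_eq h2).symm)

/-- replacing a saturated piece of a forest -/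
lemma forest_replace {r : ℕ} {F E : Set V} {Ep : Fin r → Set V} (hEf : E.Finite) (hEp : ∀ j, Ep j ⊆ E) (hF : Adm Ep F)
    (hmin : ∀ S, Adm Ep S → Measure.hausdorffMeasure 1 F ≤ Measure.hausdorffMeasure 1 S)
    (hfin : Measure.hausdorffMeasure 1 F ≠ ∞) (hcc : ∀ x ∈ F, (connectedComponentIn F x ∩ E).Nonempty)
    {P : Set V} (hP : IsClosed P) (hPF : P ⊆ F)
    (hsat : ∀ x ∈ F, connectedComponentIn F x ⊆ P ∨ Disjoint (connectedComponentIn F x) P)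
    (hne : (E ∩ P).Nonempty) (S : Set V) (hS : IsCompact S) (hSc : IsPreconnected S) (hES : E ∩ P ⊆ S) :
    Measure.hausdorffMeasure 1 P ≤ Measure.hausdorffMeasure 1 S := by
  have hcl : F \ P = ⋃ e ∈ (E ∩ F) \ P, connectedComponentIn F e := by
    ext z
    simp only [mem_iUnion, exists_prop]
    constructor
    · rintro ⟨hz, hzP⟩
      obtain ⟨e, he, heE⟩ := hcc z hz
      refine ⟨e, ⟨⟨heE, connectedComponentIn_subset _ _ he⟩, fun heP => ?_⟩, ?_⟩
      · rcases hsat z hz with h | h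
        · exact hzP (h (mem_connectedComponentIn hz))
        · exact h.le_bot ⟨he, heP⟩
      · rw [← connectedComponentIn_eq he]; exact mem_connectedComponentIn hz
    · rintro ⟨e, ⟨⟨heE, heF⟩, heP⟩, hz⟩
      refine ⟨connectedComponentIn_subset _ _ hz, fun hzP => ?_⟩
      rcases hsat e heF with h | h
      · exact heP (h (mem_connectedComponentIn heF))
      · exact h.le_bot ⟨hz, hzP⟩
  have hclosed : IsClosed (F \ P) := by
    rw [hcl]
    exact ((hEf.inter_of_left _).diff).isClosed_biUnion fun e _ => cc_closed hF.1 e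
  have hcomp : IsCompact (F \ P) := hF.1.of_isClosed_subset hclosed diff_subset
  have hadm : Adm Ep (S ∪ F \ P) := by
    refine ⟨hS.union hcomp, fun j => ?_⟩
    obtain ⟨x, hx, hj⟩ := hF.2 j
    rcases hsat x hx with h | h
    · obtain ⟨s, hs⟩ := hne
      have hsS := hES hs
      refine ⟨s, Or.inl hsS, fun z hz => ?_⟩
      exact hSc.subset_connectedComponentIn hsS subset_union_left (hES ⟨hEp j hz, h (hj hz)⟩)
    · have hsub : connectedComponentIn F x ⊆ S ∪ F \ P := fun z hz =>
        Or.inr ⟨connectedComponentIn_subset _ _ hz, fun hzP => h.le_bot ⟨hz, hzP⟩⟩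
      refine ⟨x, hsub (mem_connectedComponentIn hx), hj.trans ?_⟩
      exact isPreconnected_connectedComponentIn.subset_connectedComponentIn (mem_connectedComponentIn hx) hsub
  have h1 := (hmin _ hadm).trans (measure_union_le _ _)
  have h2 := measure_diff_add_inter (μ := (Measure.hausdorffMeasure 1 : Measure V)) F hP.measurableSet
  rw [inter_eq_self_of_subset_right hPF] at h2
  rw [← h2, add_comm] at h1
  exact (ENNReal.add_le_add_iff_right (ne_top_of_le_ne_top hfin (measure_mono diff_subset))).1 h1

lemma exists_param {A : Set V} (hA : A.Finite) (hne : A.Nonempty) {M : ℕ} (hM : A.ncard ≤ M) :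
    ∃ e : Fin M → V, range e = A := by
  haveI := hA.fintype
  haveI : Nonempty A := hne.to_subtype
  have h1 : Fintype.card A ≤ Fintype.card (Fin M) := by
    rw [Fintype.card_fin, ← Nat.card_eq_fintype_card, Nat.card_coe_set_eq]; exact hM
  obtain ⟨f⟩ := Function.Embedding.nonempty_of_card_le h1
  refine ⟨fun i => (Function.invFun f i : A), ?_⟩
  have : range (fun i => ((Function.invFun f i : A) : V)) = Subtype.val '' range (Function.invFun f) := by
    rw [← range_comp]; rfl
  rw [this, (Function.invFun_surjective f.injective).range_eq, image_univ, Subtype.range_coe]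

theorem sepC [ProperSpace V] [StrictConvexSpace ℝ V] (Φ : V ≃L[ℝ] ℝ × ℝ) (M : ℕ) (R κ : ℝ)
    (hR0 : 0 ≤ R) (hκ : 0 < κ) :
    ∃ δ > 0, ∀ m : ℝ, 0 < m → ∀ E : Set V, (∀ e ∈ E, ‖e‖ ≤ R * m) → E.Finite → E.ncard ≤ M →
      ∀ (r : ℕ) (Ep : Fin r → Set V), (∀ j, Ep j ⊆ E) → ∀ F, Adm Ep F →
      (∀ S, Adm Ep S → Measure.hausdorffMeasure 1 F ≤ Measure.hausdorffMeasure 1 S) →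
      (∀ x ∈ F, (connectedComponentIn F x ∩ E).Nonempty) →
      ∀ a ∈ F, ∀ b ∈ F, (∀ e ∈ E, κ * m ≤ ‖e - a‖) → (∀ e ∈ E, κ * m ≤ ‖e - b‖) →
      connectedComponentIn F a ≠ connectedComponentIn F b → δ * m ≤ dist a b := by
  rcases Nat.eq_zero_or_pos M with rfl | hM
  · refine ⟨1, one_pos, ?_⟩
    intro m _ E _ hE hE0 r Ep _ F _ _ hcc a ha
    have : E = ∅ := (ncard_eq_zero hE).1 (Nat.le_zero.1 hE0)
    obtain ⟨z, hz⟩ := hcc a ha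
    rw [this] at hz
    exact hz.2.elim
  obtain ⟨δ, hδ, h⟩ := sepB Φ M hM R κ hR0 hκ
  refine ⟨δ, hδ, ?_⟩
  intro m hm E hER hEf hEM r Ep hEp F hF hmin hcc a ha b hb ka kb hab
  have hEne : E.Nonempty := (hcc a ha).mono inter_subset_right
  have hfin : Measure.hausdorffMeasure 1 F ≠ ∞ := by
    obtain ⟨e, he⟩ := exists_param hEf hEne hEM
    obtain ⟨S, s1, s2, s3, s4⟩ := star_bound e (R * m) (fun i => hER _ (he ▸ mem_range_self i))
    have hES : E ⊆ S := by rw [← he]; exact range_subset_iff.2 s3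
    refine ne_top_of_le_ne_top ENNReal.ofReal_ne_top ((hmin S ⟨s1, fun j => ?_⟩).trans s4)
    obtain ⟨z, hz⟩ := hEne
    exact ⟨z, hES hz, ((hEp j).trans hES).trans (s2.subset_connectedComponentIn (hES hz) subset_rfl)⟩
  set T1 := connectedComponentIn F a with hT1
  set T2 := connectedComponentIn F b with hT2
  have hd : Disjoint T1 T2 := (cc_disj a b).resolve_left hab
  have hT1F : T1 ⊆ F := connectedComponentIn_subset _ _
  have hT2F : T2 ⊆ F := connectedComponentIn_subset _ _
  have cl1 : IsClosed T1 := cc_closed hF.1 a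
  have cl2 : IsClosed T2 := cc_closed hF.1 b
  have n1 : (E ∩ T1).Nonempty := by rw [inter_comm]; exact hcc a ha
  have n2 : (E ∩ T2).Nonempty := by rw [inter_comm]; exact hcc b hb
  have sat : ∀ c x, connectedComponentIn F x ⊆ connectedComponentIn F c ∨
      Disjoint (connectedComponentIn F x) (connectedComponentIn F c) := fun c x =>
    (cc_disj x c).imp_left (fun h => h.subset)
  have mk : ∀ c ∈ F, MinTree (connectedComponentIn F c) (E ∩ connectedComponentIn F c) := by
    intro c hc
    have hn : (E ∩ connectedComponentIn F c).Nonempty := by rw [inter_comm]; exact hcc c hc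
    refine ⟨hF.1.of_isClosed_subset (cc_closed hF.1 c) (connectedComponentIn_subset _ _),
      isPreconnected_connectedComponentIn,
      ne_top_of_le_ne_top hfin (measure_mono (connectedComponentIn_subset _ _)), inter_subset_right, hn, ?_⟩
    exact forest_replace hEf hEp hF hmin hfin hcc (cc_closed hF.1 c) (connectedComponentIn_subset _ _)
      (fun x _ => sat c x) hn
  obtain ⟨e1, he1⟩ := exists_param (hEf.inter_of_left T1) n1 ((ncard_le_ncard inter_subset_left hEf).trans hEM)
  obtain ⟨e2, he2⟩ := exists_param (hEf.inter_of_left T2) n2 ((ncard_le_ncard inter_subset_left hEf).trans hEM)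
  have q1 : ∀ i, e1 i ∈ E := fun i => (he1 ▸ mem_range_self i : e1 i ∈ E ∩ T1).1
  have q2 : ∀ i, e2 i ∈ E := fun i => (he2 ▸ mem_range_self i : e2 i ∈ E ∩ T2).1
  refine h m hm e1 e2 (fun i => hER _ (q1 i)) (fun i => hER _ (q2 i)) T1 T2 (he1 ▸ mk a ha) (he2 ▸ mk b hb) hd ?_
    a (mem_connectedComponentIn ha) b (mem_connectedComponentIn hb) (fun i => ka _ (q1 i)) (fun i => kb _ (q2 i))
  intro S s1 s2 s3
  rw [← measure_union hd cl2.measurableSet]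
  rw [he1, he2, ← inter_union_distrib_left] at s3
  refine forest_replace hEf hEp hF hmin hfin hcc (cl1.union cl2) (union_subset hT1F hT2F) ?_
    (n1.mono (inter_subset_inter_right _ subset_union_left)) S s1 s2 s3
  intro x _
  rcases sat a x with h | h
  · exact Or.inl (h.trans subset_union_left)
  · rcases sat b x with h' | h'
    · exact Or.inl (h'.trans subset_union_right)
    · exact Or.inr (disjoint_union_right.2 ⟨h, h'⟩)

end Forest

section Transfer

lemma tauLen_eq {V : Type} [NormedAddCommGroup V] [NormedSpace ℝ V] [MeasurableSpace V] [BorelSpace V]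
    (Φ : V ≃L[ℝ] ℝ × ℝ) (τ : P2 → ℝ) (hτ : ∀ v, τ (Φ v) = ‖v‖) (S : Set P2) :
    tauLen τ S = Measure.hausdorffMeasure 1 (Φ ⁻¹' S) := by
  have hdiam : ∀ A : Set P2, tauDiam τ A = Metric.ediam (Φ ⁻¹' A) := by
    intro A
    unfold tauDiam Metric.ediam
    have key : ∀ x y, ENNReal.ofReal (τ (Φ x - Φ y)) = edist x y := fun x y => by
      rw [← map_sub, hτ, edist_dist, dist_eq_norm]
    apply le_antisymm
    · refine iSup₂_le fun x hx => iSup₂_le fun y hy => ?_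
      obtain ⟨x, rfl⟩ := Φ.surjective x
      obtain ⟨y, rfl⟩ := Φ.surjective y
      rw [key]
      exact le_iSup₂_of_le x hx (le_iSup₂_of_le y hy le_rfl)
    · refine iSup₂_le fun x hx => iSup₂_le fun y hy => ?_
      rw [← key]
      exact le_iSup₂_of_le (Φ x) hx (le_iSup₂_of_le (Φ y) hy le_rfl)
  have hsup : ∀ A : Set V, (⨆ _ : A.Nonempty, Metric.ediam A ^ (1:ℝ)) = Metric.ediam A := by
    intro A
    rcases A.eq_empty_or_nonempty with rfl | h
    · simp
    · simp [h]
  rw [Measure.hausdorffMeasure_apply]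
  unfold tauLen
  simp only [hsup]
  have hin : ∀ ε : ℝ≥0∞, (⨅ (A : ℕ → Set P2) (_ : S ⊆ ⋃ i, A i) (_ : ∀ i, tauDiam τ (A i) ≤ ε), ∑' i, tauDiam τ (A i)) =
      ⨅ (t : ℕ → Set V) (_ : Φ ⁻¹' S ⊆ ⋃ n, t n) (_ : ∀ n, Metric.ediam (t n) ≤ ε), ∑' n, Metric.ediam (t n) := by
    intro ε
    apply le_antisymm
    · refine le_iInf fun t => le_iInf fun h1 => le_iInf fun h2 => ?_
      have hp : ∀ n, Φ ⁻¹' (Φ '' t n) = t n := fun n => preimage_image_eq _ Φ.injective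
      refine iInf_le_of_le (fun n => Φ '' t n) (iInf_le_of_le ?_ (iInf_le_of_le ?_ ?_))
      · rw [← image_iUnion]
        intro z hz
        obtain ⟨z, rfl⟩ := Φ.surjective z
        exact ⟨z, h1 hz, rfl⟩
      · intro n; rw [hdiam, hp]; exact h2 n
      · simp only [hdiam, hp]; exact le_rfl
    · refine le_iInf fun t => le_iInf fun h1 => le_iInf fun h2 => ?_
      refine iInf_le_of_le (fun n => Φ ⁻¹' t n) (iInf_le_of_le ?_ (iInf_le_of_le ?_ ?_))
      · rw [← preimage_iUnion]; exact preimage_mono h1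
      · intro n; rw [← hdiam]; exact h2 n
      · simp only [hdiam]; exact le_rfl
  simp only [hin]
  apply le_antisymm
  · refine iSup₂_le fun ε hε => ?_
    exact le_iSup₂_of_le (ENNReal.ofReal ε) (ENNReal.ofReal_pos.2 hε) le_rfl
  · refine iSup₂_le fun ε hε => ?_
    have hmin : 0 < (min ε 1).toReal := ENNReal.toReal_pos (lt_min hε one_pos).ne' (by simp)
    refine le_iSup₂_of_le (min ε 1).toReal hmin ?_
    rw [ENNReal.ofReal_toReal (by simp)]
    refine le_iInf fun t => le_iInf fun h1 => le_iInf fun h2 => ?_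
    exact iInf_le_of_le t (iInf_le_of_le h1 (iInf_le_of_le (fun n => (h2 n).trans (min_le_left _ _)) le_rfl))

lemma adm_pre {V : Type} [NormedAddCommGroup V] [NormedSpace ℝ V] (Φ : V ≃L[ℝ] ℝ × ℝ) {r : ℕ} (Ep : Fin r → Set P2)
    (S : Set P2) : Adm (fun j => Φ ⁻¹' Ep j) (Φ ⁻¹' S) ↔ S ∈ OmegaSet Ep := by
  have hcc : ∀ x, Φ x ∈ S → Φ ⁻¹' (connectedComponentIn S (Φ x)) = connectedComponentIn (Φ ⁻¹' S) x := by
    intro x hx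
    have h1 := Φ.toHomeomorph.image_connectedComponentIn (s := Φ ⁻¹' S) (x := x) hx
    have h2 : Φ '' (Φ ⁻¹' S) = S := image_preimage_eq _ Φ.surjective
    change Φ '' _ = connectedComponentIn (Φ '' (Φ ⁻¹' S)) (Φ x) at h1
    rw [h2] at h1
    rw [← h1, preimage_image_eq _ Φ.injective]
  unfold Adm OmegaSet
  refine and_congr (Φ.toHomeomorph.isCompact_preimage) (forall_congr' fun j => ?_)
  constructor
  · rintro ⟨x, hx, h⟩
    refine ⟨Φ x, hx, ?_⟩
    rw [← hcc x hx] at h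
    exact (preimage_subset_preimage_iff (by rw [Φ.surjective.range_eq]; exact subset_univ _)).1 h
  · rintro ⟨x, hx, h⟩
    obtain ⟨x, rfl⟩ := Φ.surjective x
    refine ⟨x, hx, ?_⟩
    rw [← hcc x hx]
    exact preimage_mono h

theorem main_abs {V : Type} [NormedAddCommGroup V] [NormedSpace ℝ V] [MeasurableSpace V] [BorelSpace V]
    [ProperSpace V] [StrictConvexSpace ℝ V]
    (Φ : V ≃L[ℝ] ℝ × ℝ) (τ : P2 → ℝ) (hτ : ∀ v, τ (Φ v) = ‖v‖) (M : ℕ) :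
    ∃ δ₁ : ℝ, 0 < δ₁ ∧
      ∀ m : ℝ, 0 < m → ∀ E : Set P2, E ⊆ frontier (Qbox m) → E.Finite → E.ncard ≤ M →
        ∀ (r : ℕ) (Ep : Fin r → Set P2), IsPartitionOf Ep E →
          ∀ F ∈ OmegaMinSet τ Ep,
            (∀ x ∈ F, (connectedComponentIn F x ∩ E).Nonempty) →
            ∀ a ∈ F, ∀ b ∈ F, a ∈ Qbox (m / 2) → b ∈ Qbox (m / 2) →
              connectedComponentIn F a ≠ connectedComponentIn F b →
              δ₁ * m ≤ τ (a - b) := by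
  set K : ℝ := ‖(Φ : V →L[ℝ] ℝ × ℝ)‖ + 1 with hK
  have hK0 : 0 < K := by positivity
  have hΦ : ∀ v, ‖Φ v‖ ≤ K * ‖v‖ := fun v =>
    ((Φ : V →L[ℝ] ℝ × ℝ).le_opNorm v).trans (by gcongr; linarith)
  have hΦs : ∀ v, ‖v‖ ≤ ‖(Φ.symm : ℝ × ℝ →L[ℝ] V)‖ * ‖Φ v‖ := fun v => by
    have := (Φ.symm : ℝ × ℝ →L[ℝ] V).le_opNorm (Φ v)
    simpa using this
  obtain ⟨δ, hδ, h⟩ := sepC Φ M ‖(Φ.symm : ℝ × ℝ →L[ℝ] V)‖ (1 / (2 * K)) (norm_nonneg _) (by positivity)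
  refine ⟨δ, hδ, ?_⟩
  intro m hm E hE hEf hEM r Ep hpart F hF hcc a ha b hb haQ hbQ hab
  have hQ : ∀ m, Qbox m = Metric.closedBall (0 : ℝ × ℝ) m := by
    intro m
    rw [← Prod.mk_zero_zero, ← closedBall_prod_same, Real.closedBall_eq_Icc]
    simp [Qbox]
  have hEn : ∀ e ∈ E, ‖e‖ = m := by
    intro e he
    have := hE he
    rw [hQ, frontier_closedBall _ hm.ne'] at this
    simpa using this
  have hQn : ∀ p ∈ Qbox (m/2), ‖p‖ ≤ m / 2 := by
    intro p hp
    rw [hQ] at hp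
    simpa using hp
  have hcc' : ∀ x, Φ x ∈ F → Φ ⁻¹' (connectedComponentIn F (Φ x)) = connectedComponentIn (Φ ⁻¹' F) x := by
    intro x hx
    have h1 := Φ.toHomeomorph.image_connectedComponentIn (s := Φ ⁻¹' F) (x := x) hx
    have h2 : Φ '' (Φ ⁻¹' F) = F := image_preimage_eq _ Φ.surjective
    change Φ '' _ = connectedComponentIn (Φ '' (Φ ⁻¹' F)) (Φ x) at h1
    rw [h2] at h1
    rw [← h1, preimage_image_eq _ Φ.injective]
  obtain ⟨a, rfl⟩ := Φ.surjective a
  obtain ⟨b, rfl⟩ := Φ.surjective b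
  have hfar : ∀ p, Φ p ∈ Qbox (m/2) → ∀ e ∈ Φ ⁻¹' E, 1 / (2 * K) * m ≤ ‖e - p‖ := by
    intro p hp e he
    have h1 := hQn _ hp
    have h2 := hEn _ he
    have h3 := hΦ (e - p)
    rw [map_sub] at h3
    have h4 := norm_sub_norm_le (Φ e) (Φ p)
    rw [h2] at h4
    rw [div_mul_eq_mul_div, div_le_iff₀ (by positivity)]
    linarith
  have hres := h m hm (Φ ⁻¹' E) (fun e he => by rw [← hEn _ he]; exact hΦs e)
    (hEf.preimage Φ.injective.injOn)
    (by rw [← ncard_image_of_injective _ Φ.injective, image_preimage_eq _ Φ.surjective]; exact hEM)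
    r (fun j => Φ ⁻¹' Ep j) (fun j => preimage_mono (hpart.2.2 ▸ subset_iUnion Ep j)) (Φ ⁻¹' F)
    ((adm_pre Φ Ep F).2 hF.1)
    (by
      intro S hS
      have hS' : Φ ⁻¹' (Φ '' S) = S := preimage_image_eq _ Φ.injective
      rw [← hS'] at hS ⊢
      rw [adm_pre] at hS
      rw [← tauLen_eq Φ τ hτ, ← tauLen_eq Φ τ hτ, hF.2]
      exact iInf₂_le _ hS)
    (by
      intro x hx
      rw [← hcc' x hx, ← preimage_inter]
      obtain ⟨z, hz⟩ := hcc _ hx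
      obtain ⟨z, rfl⟩ := Φ.surjective z
      exact ⟨z, hz⟩)
    a ha b hb (hfar a haQ) (hfar b hbQ)
    (by
      rw [← hcc' a ha, ← hcc' b hb]
      exact fun heq => hab (Φ.surjective.preimage_injective heq))
  rwa [← map_sub, hτ, ← dist_eq_norm]

/-- type synonym for the plane -/
def NP : Type := ℝ × ℝ

instance : AddCommGroup NP := inferInstanceAs (AddCommGroup (ℝ × ℝ))
noncomputable instance : Module ℝ NP := inferInstanceAs (Module ℝ (ℝ × ℝ))
instance : FiniteDimensional ℝ NP := inferInstanceAs (FiniteDimensional ℝ (ℝ × ℝ))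

/-- identity map -/
noncomputable def idNP : NP ≃ₗ[ℝ] ℝ × ℝ := LinearEquiv.refl ℝ (ℝ × ℝ)

theorem main_tau (τ : P2 → ℝ) (hτ : IsStrictlyConvexNorm τ) (M : ℕ) :
    ∃ δ₁ : ℝ, 0 < δ₁ ∧
      ∀ m : ℝ, 0 < m → ∀ E : Set P2, E ⊆ frontier (Qbox m) → E.Finite → E.ncard ≤ M →
        ∀ (r : ℕ) (Ep : Fin r → Set P2), IsPartitionOf Ep E →
          ∀ F ∈ OmegaMinSet τ Ep,
            (∀ x ∈ F, (connectedComponentIn F x ∩ E).Nonempty) →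
            ∀ a ∈ F, ∀ b ∈ F, a ∈ Qbox (m / 2) → b ∈ Qbox (m / 2) →
              connectedComponentIn F a ≠ connectedComponentIn F b →
              δ₁ * m ≤ τ (a - b) := by
  obtain ⟨hn, hs⟩ := hτ
  letI : Norm NP := ⟨fun x => τ (idNP x)⟩
  have hnorm : ∀ x : NP, ‖x‖ = τ (idNP x) := fun _ => rfl
  have core : NormedSpace.Core ℝ NP :=
    { norm_nonneg := fun x => by
        have h1 := hn.add_le (idNP x) ((-1 : ℝ) • idNP x)
        rw [hn.smul_eq] at h1
        have h2 : idNP x + (-1 : ℝ) • idNP x = 0 := by simp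
        rw [h2, (hn.eq_zero_iff 0).2 rfl] at h1
        rw [hnorm]
        norm_num at h1
        exact h1
      norm_smul := fun c x => by rw [hnorm, hnorm, map_smul, hn.smul_eq, Real.norm_eq_abs]
      norm_triangle := fun x y => by rw [hnorm, hnorm, hnorm, map_add]; exact hn.add_le _ _
      norm_eq_zero_iff := fun x => by rw [hnorm, hn.eq_zero_iff]; exact idNP.map_eq_zero_iff }
  letI : NormedAddCommGroup NP := NormedAddCommGroup.ofCore core
  letI : NormedSpace ℝ NP := NormedSpace.ofCore core
  letI : MeasurableSpace NP := borel NP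
  haveI : BorelSpace NP := ⟨rfl⟩
  haveI : ProperSpace NP := FiniteDimensional.proper_real NP
  haveI : StrictConvexSpace ℝ NP := by
    refine StrictConvexSpace.of_norm_add fun x y hx hy hxy => ?_
    by_contra hcon
    have h1 := hs (idNP x) (idNP y) (by
      rintro ⟨c, hc, h | h⟩
      · have : x = c • y := idNP.injective (by rw [h, map_smul])
        exact hcon (this ▸ SameRay.sameRay_nonneg_smul_left y hc)
      · have : y = c • x := idNP.injective (by rw [h, map_smul])
        exact hcon (this ▸ SameRay.sameRay_nonneg_smul_right x hc))
    rw [← map_add, ← hnorm, ← hnorm, ← hnorm] at h1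
    have h2 : ‖x + y‖ < ‖x‖ + ‖y‖ := h1
    linarith
  exact main_abs idNP.toContinuousLinearEquiv τ (fun v => rfl) M

end Transfer

end Helpers

/-- For a strictly convex norm `τ` and `M ∈ ℕ`, there exists `δ₁ > 0`
(depending only on `M` and `τ`) such that for every `m > 0`, every `E ⊆ ∂Q_m` with
`|E| ≤ M`, every partition `E̲` of `E`, every Steiner forest `F ∈ Ω^min_{E̲}` whose
components all meet `E`, and any two points of `Q_{m/2}` lying in distinct connected
components of `F`, their `τ`-distance is at least `δ₁ m`. -/
theorem statement14 (τ : P2 → ℝ) (hτ : IsStrictlyConvexNorm τ) (M : ℕ) :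
    ∃ δ₁ : ℝ, 0 < δ₁ ∧
      ∀ m : ℝ, 0 < m → ∀ E : Set P2, E ⊆ frontier (Qbox m) → E.Finite → E.ncard ≤ M →
        ∀ (r : ℕ) (Ep : Fin r → Set P2), IsPartitionOf Ep E →
          ∀ F ∈ OmegaMinSet τ Ep,
            (∀ x ∈ F, (connectedComponentIn F x ∩ E).Nonempty) →
            ∀ a ∈ F, ∀ b ∈ F, a ∈ Qbox (m / 2) → b ∈ Qbox (m / 2) →
              connectedComponentIn F a ≠ connectedComponentIn F b →
              δ₁ * m ≤ τ (a - b) := by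
  exact main_tau τ hτ M
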